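/- arXiv:1610.09268 — 2 statements merged into one kernel-verified Lean document; each statement's English description precedes it below -/
import Mathlib

section
/- For all positive integers η and d there exists an integer A(η,d) ≥ d−1, independent of N and of K, with the following property: for every algebraically closed field K, every N, and every form F of degree d in R = K[x_1,…,x_N] of strength at least A(η,d), the ideal of R generated by F together with all the partial derivatives ∂F/∂x_1,…,∂F/∂x_N has height at least η+2 (equivalently, R/FR satisfies Serre's condition R_η). -/
open MvPolynomial

/-- The height of an ideal: the infimum of the heights of the prime ideals containing it
(so the unit ideal has height `⊤`). -/
noncomputable def idealHeight {R : Type*} [CommRing R] (I : Ideal R) : ℕ∞ :=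
  ⨅ (P : PrimeSpectrum R) (_ : I ≤ P.asIdeal), Order.height P

/-- A Noetherian local ring is regular if its maximal ideal is generated by
(Krull dimension)-many elements. -/
def IsRegularLocal (A : Type*) [CommRing A] [IsLocalRing A] : Prop :=
  IsNoetherianRing A ∧
    ∃ s : Finset A, Ideal.span (s : Set A) = IsLocalRing.maximalIdeal A ∧
      (s.card : WithBot ℕ∞) = ringKrullDim A

/-- Serre's condition `R_η` for a ring `A`: for every prime ideal `P` of `A` of height
at most `η`, the localization of `A` at `P` is a regular local ring. -/
def SerreConditionR (η : ℕ) (A : Type*) [CommRing A] : Prop :=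
  ∀ (P : Ideal A) [hP : P.IsPrime],
    Order.height (⟨P, hP⟩ : PrimeSpectrum A) ≤ (η : ℕ∞) →
      IsRegularLocal (Localization.AtPrime P)

/-- `G` is an `R_η`-sequence: it generates a proper ideal and the quotient of the ring by the
ideal generated by each initial segment satisfies Serre's condition `R_η`. -/
def IsRnSequence (η : ℕ) {R : Type*} [CommRing R] {s : ℕ} (G : Fin s → R) : Prop :=
  Ideal.span (Set.range G) ≠ ⊤ ∧
    ∀ i : ℕ, i ≤ s →
      SerreConditionR η (R ⧸ Ideal.span (G '' {j : Fin s | (j : ℕ) < i}))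

/-- `F`, a form of degree `d`, has a `k`-collapse: `F` lies in an ideal generated by
`k` forms of strictly smaller positive degree.  A form of degree `d` has strength at
least `s` iff it has no `s`-collapse. -/
def HasCollapse {K : Type*} [CommSemiring K] {σ : Type*} (d k : ℕ)
    (F : MvPolynomial σ K) : Prop :=
  ∃ (G : Fin k → MvPolynomial σ K) (e : Fin k → ℕ),
    (∀ i, 0 < e i ∧ e i < d ∧ (G i).IsHomogeneous (e i)) ∧
    F ∈ Ideal.span (Set.range G)

section Taylor

variable {σ R A : Type*} [CommRing R] [CommRing A] [Algebra R A]

theorem aeval_sub_aeval_mem (I : Ideal A) {b b' : σ → A} (h : ∀ j, b' j - b j ∈ I)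
    (p : MvPolynomial σ R) : aeval b' p - aeval b p ∈ I := by
  induction p using MvPolynomial.induction_on with
  | C r => simp
  | add p q hp hq =>
    simp only [map_add]
    convert I.add_mem hp hq using 1
    ring
  | mul_X p i hp =>
    simp only [map_mul, aeval_X]
    convert I.add_mem (I.mul_mem_right (b' i) hp) (I.mul_mem_left (aeval b p) (h i)) using 1
    ring

/-- First order Taylor expansion of a polynomial modulo the square of an ideal. -/
theorem aeval_sub_aeval_sub_sum_mem [Fintype σ] (I : Ideal A) {b b' : σ → A}
    (h : ∀ j, b' j - b j ∈ I) (p : MvPolynomial σ R) :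
    aeval b' p - aeval b p - ∑ j, aeval b (pderiv j p) * (b' j - b j) ∈ I ^ 2 := by
  classical
  induction p using MvPolynomial.induction_on with
  | C r => simp
  | add p q hp hq =>
    simp only [map_add, add_mul, Finset.sum_add_distrib]
    convert Ideal.add_mem _ hp hq using 1
    ring
  | mul_X p i hp =>
    have hsq : (aeval b' p - aeval b p) * (b' i - b i) ∈ I ^ 2 := by
      rw [pow_two]
      exact Ideal.mul_mem_mul (aeval_sub_aeval_mem I h p) (h i)
    have hsum : ∑ j, aeval b (pderiv j (p * X i)) * (b' j - b j) =
        b i * ∑ j, aeval b (pderiv j p) * (b' j - b j) + aeval b p * (b' i - b i) := by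
      simp only [Derivation.leibniz, smul_eq_mul, map_add, map_mul, aeval_X, add_mul,
        Finset.sum_add_distrib, pderiv_X, Finset.mul_sum]
      rw [Finset.sum_eq_single i (by intro j _ hj; simp [hj.symm]) (by simp),
        add_comm]
      simp [mul_assoc]
    rw [hsum]
    simp only [map_mul, aeval_X]
    convert Ideal.add_mem _ (Ideal.mul_mem_left _ (b i) hp) hsq using 1
    ring

end Taylor

section Substitution

variable {σ L : Type*} [CommRing L]

theorem X_mem_idealOfVars (j : σ) : (X j : MvPolynomial σ L) ∈ idealOfVars σ L :=
  Ideal.subset_span ⟨j, rfl⟩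

theorem idealOfVars_le_comap {χ : MvPolynomial σ L →ₐ[L] MvPolynomial σ L}
    (h : ∀ j, χ (X j) ∈ idealOfVars σ L) : idealOfVars σ L ≤ Ideal.comap χ (idealOfVars σ L) := by
  rw [idealOfVars, Ideal.span_le]
  rintro _ ⟨j, rfl⟩
  exact h j

theorem map_mem_pow_idealOfVars {χ : MvPolynomial σ L →ₐ[L] MvPolynomial σ L}
    (h : ∀ j, χ (X j) ∈ idealOfVars σ L) {n : ℕ} {p : MvPolynomial σ L}
    (hp : p ∈ idealOfVars σ L ^ n) : χ p ∈ idealOfVars σ L ^ n :=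
  ((Ideal.pow_right_mono (idealOfVars_le_comap h) n).trans (Ideal.le_comap_pow _ n)) hp

/-- A substitution tangent to the identity does not change the leading part of a polynomial. -/
theorem map_sub_self_mem_pow_idealOfVars {χ : MvPolynomial σ L →ₐ[L] MvPolynomial σ L}
    (h : ∀ j, χ (X j) - X j ∈ idealOfVars σ L ^ 2) {n : ℕ} {p : MvPolynomial σ L}
    (hp : p ∈ idealOfVars σ L ^ n) :
    χ p - p ∈ idealOfVars σ L ^ (n + 1) := by
  have hX (j : σ) : χ (X j) ∈ idealOfVars σ L := by
    simpa using add_mem (Ideal.pow_le_self two_ne_zero (h j)) (X_mem_idealOfVars (L := L) j)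
  induction n generalizing p with
  | zero =>
    have hle (j : σ) : χ (X j) - X j ∈ idealOfVars σ L := Ideal.pow_le_self two_ne_zero (h j)
    have := aeval_sub_aeval_mem (R := L) (idealOfVars σ L) hle p
    have hχ : aeval (fun j => χ (X j)) = χ := by ext; simp
    rw [hχ] at this
    simpa using! this
  | succ n ih =>
    rw [pow_succ] at hp
    induction hp using Submodule.mul_induction_on' with
    | mem_mul_mem a ha b hb =>
      have hb' : χ b - b ∈ idealOfVars σ L ^ 2 := by
        induction hb using Submodule.span_induction with
        | mem x hx => obtain ⟨j, rfl⟩ := hx; exact h j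
        | zero => simp
        | add x y _ _ hx hy =>
          rw [map_add]
          convert Ideal.add_mem _ hx hy using 1
          ring
        | smul r x hx hxs =>
          have hr : χ r - r ∈ idealOfVars σ L ^ (0 + 1) := by
            have := aeval_sub_aeval_mem (R := L) (idealOfVars σ L)
              (fun j => Ideal.pow_le_self two_ne_zero (h j)) r
            have hχ : aeval (fun j => χ (X j)) = χ := by ext; simp
            rw [hχ] at this
            simpa using! this
          rw [zero_add, pow_one] at hr
          have h1 : (χ r - r) * x ∈ idealOfVars σ L ^ 2 := by
            rw [pow_two]; exact Ideal.mul_mem_mul hr hx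
          have h2 : χ r * (χ x - x) ∈ idealOfVars σ L ^ 2 := Ideal.mul_mem_left _ _ hxs
          rw [smul_eq_mul, map_mul]
          convert Ideal.add_mem _ h1 h2 using 1
          ring
      have hbm : χ b ∈ idealOfVars σ L := idealOfVars_le_comap hX hb
      have h1 : (χ a - a) * χ b ∈ idealOfVars σ L ^ (n + 1 + 1) := by
        rw [pow_succ _ (n + 1)]; exact Ideal.mul_mem_mul (ih ha) hbm
      have h2 : a * (χ b - b) ∈ idealOfVars σ L ^ (n + 1 + 1) := by
        rw [show n + 1 + 1 = n + 2 by ring, pow_add]; exact Ideal.mul_mem_mul ha hb'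
      rw [map_mul]
      convert Ideal.add_mem _ h1 h2 using 1
      ring
    | add x _ y _ hx hy =>
      rw [map_add]
      convert Ideal.add_mem _ hx hy using 1
      ring

/-- A substitution tangent to the identity has an inverse up to any given order. -/
theorem exists_algHom_map_X_add_sub_X_mem {s : σ → MvPolynomial σ L}
    (hs : ∀ j, s j ∈ idealOfVars σ L ^ 2)
    (n : ℕ) : ∃ ψ : MvPolynomial σ L →ₐ[L] MvPolynomial σ L,
      (∀ j, ψ (X j) ∈ idealOfVars σ L) ∧ ∀ j, ψ (X j + s j) - X j ∈ idealOfVars σ L ^ (n + 2) := by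
  induction n with
  | zero => exact ⟨AlgHom.id L _, X_mem_idealOfVars, fun j => by simpa using hs j⟩
  | succ n ih =>
    obtain ⟨ψ, hψ, hψs⟩ := ih
    let e (j : σ) : MvPolynomial σ L := ψ (X j + s j) - X j
    let χ : MvPolynomial σ L →ₐ[L] MvPolynomial σ L := aeval fun j => X j - e j
    have he (j : σ) : e j ∈ idealOfVars σ L ^ (n + 2) := hψs j
    have hχ (j : σ) : χ (X j) - X j ∈ idealOfVars σ L ^ 2 := by
      simpa [χ] using Ideal.pow_le_pow_right (by omega) (he j)
    have hχm (j : σ) : χ (X j) ∈ idealOfVars σ L := by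
      simpa using add_mem (Ideal.pow_le_self two_ne_zero (hχ j)) (X_mem_idealOfVars (L := L) j)
    refine ⟨χ.comp ψ, fun j => idealOfVars_le_comap hχm (hψ j), fun j => ?_⟩
    have : (χ.comp ψ) (X j + s j) - X j = χ (e j) - e j := by
      have : ψ (X j + s j) = X j + e j := by simp [e]
      rw [AlgHom.comp_apply, this, map_add]
      simp [χ]
      ring
    rw [this]
    exact map_sub_self_mem_pow_idealOfVars hχ (he j)

end Substitution

section LeadingForm

attribute [local instance] MvPolynomial.gradedAlgebra

variable {σ K L : Type*} [CommRing K] [CommRing L] [Algebra K L]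

theorem coeff_aeval_C_add_X_monomial_sub (a : σ → L) (n : ℕ) :
    ∀ s : σ →₀ ℕ, s.degree = n → ∀ x : σ →₀ ℕ, n ≤ x.degree →
      coeff x (aeval (fun j => C (a j) + X j) (monomial s (1 : K)) - monomial s (1 : L)) = 0 := by
  classical
  induction n with
  | zero =>
    intro s hs x _
    rw [(Finsupp.degree_eq_zero_iff s).1 hs]
    simp
  | succ n ih =>
    intro s hs x hx
    obtain ⟨i, hi⟩ : ∃ i, s i ≠ 0 := by
      by_contra! h
      have : s = 0 := Finsupp.ext h
      simp [this] at hs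
    obtain ⟨t, rfl⟩ := le_iff_exists_add'.mp
      (Finsupp.single_le_iff.2 (Nat.one_le_iff_ne_zero.2 hi) : Finsupp.single i 1 ≤ s)
    have ht : t.degree = n := by simpa using hs
    set A : MvPolynomial σ L := aeval (fun j => C (a j) + X j) (monomial t (1 : K)) with hA
    have hsplit : aeval (fun j => C (a j) + X j) (monomial (t + Finsupp.single i 1) (1 : K)) -
        monomial (t + Finsupp.single i 1) (1 : L) =
        C (a i) * (A - monomial t 1) + C (a i) * monomial t 1 + (A - monomial t 1) * X i := by
      rw [monomial_add_single, monomial_add_single]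
      simp only [map_mul, pow_one, aeval_X, ← hA]
      ring
    rw [hsplit, coeff_add, coeff_add, coeff_C_mul, coeff_C_mul, ih t ht x (by omega),
      coeff_monomial, if_neg (by rintro rfl; omega), coeff_mul_X']
    split_ifs with hxi
    · rw [ih t ht _]
      · simp
      · obtain ⟨y, rfl⟩ := le_iff_exists_add'.mp (Finsupp.single_le_iff.2
          (Nat.one_le_iff_ne_zero.2 (Finsupp.mem_support_iff.1 hxi)) : Finsupp.single i 1 ≤ x)
        simpa using hx
    · simp

theorem homogeneousComponent_aeval_C_add_X {d : ℕ} {F : MvPolynomial σ K}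
    (hF : F.IsHomogeneous d) (a : σ → L) :
    homogeneousComponent d (aeval (fun j => C (a j) + X j) F : MvPolynomial σ L) =
      map (algebraMap K L) F := by
  ext x
  rw [coeff_homogeneousComponent]
  split_ifs with hx
  · have hsum : aeval (fun j => C (a j) + X j) F - map (algebraMap K L) F =
        ∑ s ∈ F.support, C (algebraMap K L (coeff s F)) *
          (aeval (fun j => C (a j) + X j) (monomial s (1 : K)) - monomial s (1 : L)) := by
      conv_lhs => rw [F.as_sum]
      rw [map_sum, map_sum, ← Finset.sum_sub_distrib]
      refine Finset.sum_congr rfl fun s _ => ?_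
      rw [map_monomial, aeval_monomial, aeval_monomial, mul_sub, C_mul_monomial, mul_one, map_one,
        one_mul]
      rfl
    rw [← sub_eq_zero, ← coeff_sub, hsum, coeff_sum]
    refine Finset.sum_eq_zero fun s hs => ?_
    rw [coeff_C_mul, coeff_aeval_C_add_X_monomial_sub a d s _ x hx.ge, mul_zero]
    exact (hF.degree_eq_sum_deg_support hs).symm
  · rw [coeff_map, hF.coeff_eq_zero hx, map_zero]

/-- If `F` vanishes to order `d + 1` along a perturbation of the family `a + X` by elements
`τ i` of order one, then `F` lies in the ideal of the components of the `τ i` of degree less than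
`d`. -/
theorem map_mem_span_homogeneousComponent [Fintype σ] {ι : Type*} [Fintype ι] {d : ℕ}
    (hd : 0 < d) {F : MvPolynomial σ K} (hF : F.IsHomogeneous d) {a : σ → L}
    (ha : ∀ j, aeval a (pderiv j F) = 0) (w : ι → σ → L) {τ : ι → MvPolynomial σ L}
    (hτ : ∀ i, τ i ∈ idealOfVars σ L)
    (h : aeval (fun j => C (a j) + X j - ∑ i, C (w i j) * τ i) F ∈ idealOfVars σ L ^ (d + 1)) :
    map (algebraMap K L) F ∈ Ideal.span (Set.range fun p : ι × Fin (d - 1) =>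
      homogeneousComponent ((p.2 : ℕ) + 1) (τ p.1)) := by
  classical
  set J := Ideal.span (Set.range fun p : ι × Fin (d - 1) =>
      homogeneousComponent ((p.2 : ℕ) + 1) (τ p.1)) with hJ
  let τ' (i : ι) : MvPolynomial σ L :=
    τ i - ∑ k : Fin (d - 1), homogeneousComponent ((k : ℕ) + 1) (τ i)
  have hτ' (i : ι) : τ' i ∈ idealOfVars σ L ^ d := by
    rw [mem_pow_idealOfVars_iff']
    intro x hx
    simp only [τ', coeff_sub, coeff_sum, coeff_homogeneousComponent]
    rcases Nat.eq_zero_or_pos x.degree with h0 | h0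
    · have h1 := (mem_pow_idealOfVars_iff' 1 (τ i)).1 (by simpa using hτ i) x (by omega)
      rw [h1]; simp
    · rw [Finset.sum_eq_single ⟨x.degree - 1, by omega⟩]
      · simp [Nat.sub_add_cancel h0]
      · intro k _ hk
        rw [if_neg]
        intro hk'
        exact hk (Fin.ext (by simp; omega))
      · simp
  have hmem (i : ι) : τ' i - τ i ∈ J := by
    simp only [τ', sub_sub_cancel_left]
    exact J.neg_mem (J.sum_mem fun k _ => Ideal.subset_span ⟨(i, k), rfl⟩)
  let b (j : σ) : MvPolynomial σ L := C (a j) + X j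
  let b' (j : σ) : MvPolynomial σ L := b j - ∑ i, C (w i j) * τ' i
  have h1 : aeval b' F - aeval (fun j => C (a j) + X j - ∑ i, C (w i j) * τ i) F ∈ J := by
    refine aeval_sub_aeval_mem J (fun j => ?_) F
    simp only [b', b, sub_sub_sub_cancel_left, ← Finset.sum_sub_distrib, ← mul_sub]
    refine J.sum_mem fun i _ => J.mul_mem_left _ ?_
    rw [← neg_sub]
    exact J.neg_mem (hmem i)
  have hbd (j : σ) : b' j - b j ∈ idealOfVars σ L ^ d := by
    simp only [b', sub_sub_cancel_left]
    exact neg_mem (sum_mem fun i _ => Ideal.mul_mem_left _ _ (hτ' i))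
  have hder (j : σ) : aeval b (pderiv j F) ∈ idealOfVars σ L := by
    have := aeval_sub_aeval_mem (R := K) (idealOfVars σ L) (b := fun j => C (a j)) (b' := b)
      (fun j => by simpa [b] using X_mem_idealOfVars j) (pderiv j F)
    have h0 : aeval (fun j => (C (a j) : MvPolynomial σ L)) (pderiv j F) = 0 := by
      have : aeval (fun j => (C (a j) : MvPolynomial σ L)) (pderiv j F) =
          C (aeval a (pderiv j F)) :=
        aeval_algebraMap_apply _ a (pderiv j F)
      rw [this, ha, C_0]
    simpa [h0] using this
  have h2 : aeval b' F - aeval b F ∈ idealOfVars σ L ^ (d + 1) := by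
    have hsq := aeval_sub_aeval_sub_sum_mem _ hbd F
    rw [← pow_mul] at hsq
    have hs : ∑ j, aeval b (pderiv j F) * (b' j - b j) ∈ idealOfVars σ L ^ (d + 1) :=
      sum_mem fun j _ => by
        rw [pow_succ']; exact Ideal.mul_mem_mul (hder j) (hbd j)
    convert add_mem (Ideal.pow_le_pow_right (by omega) hsq) hs using 1
    ring
  have h3 : homogeneousComponent d (aeval b F) ∈ J := by
    have hcomp : ∀ q ∈ idealOfVars σ L ^ (d + 1), homogeneousComponent d q = 0 := by
      intro q hq
      ext x
      rw [coeff_homogeneousComponent, coeff_zero, ite_eq_right_iff]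
      intro hx
      exact (mem_pow_idealOfVars_iff' _ _).1 hq x (by omega)
    have hsplit : aeval b F = (aeval b' F -
        aeval (fun j => C (a j) + X j - ∑ i, C (w i j) * τ i) F) +
        (aeval (fun j => C (a j) + X j - ∑ i, C (w i j) * τ i) F -
          (aeval b' F - aeval b F)) := by ring
    rw [hsplit, map_add, hcomp _ (sub_mem h h2), add_zero]
    refine homogeneousComponent_mem_of_mem ?_ h1 _
    refine Ideal.homogeneous_span _ _ ?_
    rintro _ ⟨p, rfl⟩
    exact ⟨_, homogeneousComponent_mem _ _⟩
  rwa [homogeneousComponent_aeval_C_add_X hF] at h3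

end LeadingForm

section JacobianRank

theorem Submodule.exists_fin_span_range_eq {R M : Type*} [CommRing R] [AddCommGroup M] [Module R M]
    {p : Submodule R M} (hp : p.FG) {n : ℕ} (hn : p.spanFinrank ≤ n) :
    ∃ g : Fin n → M, Submodule.span R (Set.range g) = p := by
  classical
  have := hp.finite_generators.to_subtype
  have hcard : Nat.card p.generators ≤ n := (hp.generators_ncard).le.trans hn
  let e := Finite.equivFin p.generators
  refine ⟨fun i => if h : (i : ℕ) < Nat.card p.generators then e.symm ⟨i, h⟩ else 0, ?_⟩
  apply le_antisymm
  · rw [Submodule.span_le]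
    rintro _ ⟨i, rfl⟩
    dsimp only
    split_ifs
    · exact Submodule.FG.generators_mem p (Subtype.prop _)
    · exact p.zero_mem
  · conv_lhs => rw [← p.span_generators]
    refine Submodule.span_mono fun x hx => ⟨Fin.castLE hcard (e ⟨x, hx⟩), ?_⟩
    have h : ((e ⟨x, hx⟩ : Fin _) : ℕ) < Nat.card p.generators := Fin.is_lt _
    exact (dif_pos h).trans (congrArg Subtype.val (e.symm_apply_apply ⟨x, hx⟩))

/-- A prime of height at most `n` in a regular ring is generically cut out by `n` equations. -/
theorem IsRegularRing.exists_fin_mul_mem_span {R : Type*} [CommRing R] [IsRegularRing R]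
    (P : Ideal R) [P.IsPrime] {n : ℕ} (hn : P.height ≤ n) :
    ∃ f : Fin n → R, (∀ i, f i ∈ P) ∧ ∀ p ∈ P, ∃ u ∉ P, u * p ∈ Ideal.span (Set.range f) := by
  let S := Localization.AtPrime P
  let m := IsLocalRing.maximalIdeal S
  have hm : (m.spanFinrank : WithBot ℕ∞) = P.height := by
    rw [← IsLocalization.AtPrime.ringKrullDim_eq_height P S]
    exact IsRegularLocalRing.spanFinrank_maximalIdeal
  have hle : m.spanFinrank ≤ n := by
    have : ((m.spanFinrank : ℕ∞) : WithBot ℕ∞) ≤ ((n : ℕ∞) : WithBot ℕ∞) :=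
      hm.le.trans (WithBot.coe_le_coe.2 hn)
    exact_mod_cast this
  obtain ⟨g, hg⟩ := Submodule.exists_fin_span_range_eq (IsNoetherian.noetherian m) hle
  choose f s hfs using fun i => IsLocalization.exists_mk'_eq P.primeCompl (g i)
  have hfg (i : Fin n) : algebraMap R S (f i) = algebraMap R S (s i) * g i := by
    rw [← hfs i, IsLocalization.mk'_spec']
  have hgm (i : Fin n) : g i ∈ m := hg ▸ Submodule.subset_span ⟨i, rfl⟩
  refine ⟨f, fun i => ?_, fun p hp => ?_⟩
  · have : algebraMap R S (f i) ∈ m := by rw [hfg]; exact m.mul_mem_left _ (hgm i)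
    exact (IsLocalization.AtPrime.to_map_mem_maximal_iff S P _).1 this
  · have hmap : m ≤ (Ideal.span (Set.range f)).map (algebraMap R S) := by
      rw [← hg, Submodule.span_le]
      rintro _ ⟨i, rfl⟩
      have hu : IsUnit (algebraMap R S (s i)) := IsLocalization.map_units S (s i)
      refine (Ideal.unit_mul_mem_iff_mem _ hu).1 ?_
      rw [← hfg]
      exact Ideal.mem_map_of_mem _ (Ideal.subset_span ⟨i, rfl⟩)
    have hpm : algebraMap R S p ∈ m := (IsLocalization.AtPrime.to_map_mem_maximal_iff S P _).2 hp
    obtain ⟨u, hu, h⟩ := (IsLocalization.algebraMap_mem_map_algebraMap_iff P.primeCompl S _ p).1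
      (hmap hpm)
    exact ⟨u, hu, h⟩

/-- The Jacobian matrix of a prime of height at most `n` has rank at most `n` at its zeros. -/
theorem exists_fin_pderiv_mem_span {σ K L : Type*} [Finite σ] [Field K] [Field L] [Algebra K L]
    (P : Ideal (MvPolynomial σ K)) [P.IsPrime] {n : ℕ} (hn : P.height ≤ n) {a : σ → L}
    (ha : ∀ p, aeval a p = 0 ↔ p ∈ P) :
    ∃ M : Fin n → σ → L, ∀ p ∈ P,
      (fun j => aeval a (pderiv j p)) ∈ Submodule.span L (Set.range M) := by
  obtain ⟨f, hf, h⟩ := IsRegularRing.exists_fin_mul_mem_span P hn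
  refine ⟨fun i j => aeval a (pderiv j (f i)), fun p hp => ?_⟩
  obtain ⟨u, hu, hup⟩ := h p hp
  obtain ⟨q, hq⟩ := Ideal.mem_span_range_iff_exists_fun.1 hup
  have hu0 : aeval a u ≠ 0 := fun h => hu ((ha u).1 h)
  refine (Submodule.smul_mem_iff _ hu0).1 ?_
  have : (aeval a u • fun j => aeval a (pderiv j p)) =
      ∑ i, aeval a (q i) • fun j => aeval a (pderiv j (f i)) := by
    ext j
    have hd := congrArg (fun r => aeval a (pderiv j r)) hq
    simp only [map_sum, Derivation.leibniz, smul_eq_mul, map_add, map_mul, (ha p).2 hp,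
      (ha _).2 (hf _), zero_mul, add_zero] at hd
    simpa using hd.symm
  rw [this]
  exact Submodule.sum_mem _ fun i _ =>
    Submodule.smul_mem _ _ (Submodule.subset_span ⟨i, rfl⟩)

end JacobianRank

section FormalLift

theorem Matrix.exists_mul_mul_eq_self {ι σ L : Type*} [Fintype ι] [Fintype σ] [Field L]
    (M : Matrix ι σ L) : ∃ W : Matrix σ ι L, M * W * M = M := by
  classical
  let f := Matrix.toLin' M
  obtain ⟨g, hg⟩ := f.rangeRestrict.exists_rightInverse_of_surjective f.range_rangeRestrict
  obtain ⟨g', hg'⟩ := g.exists_extend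
  refine ⟨LinearMap.toMatrix' g', Matrix.toLin'.injective ?_⟩
  rw [Matrix.toLin'_mul, Matrix.toLin'_mul, Matrix.toLin'_toMatrix']
  ext1 v
  ext1
  have h1 : g' (f (Pi.single v 1)) = g (f.rangeRestrict (Pi.single v 1)) :=
    LinearMap.congr_fun hg' (f.rangeRestrict (Pi.single v 1))
  have h2 : f (g (f.rangeRestrict (Pi.single v 1))) = f (Pi.single v 1) :=
    congrArg Subtype.val (LinearMap.congr_fun hg (f.rangeRestrict (Pi.single v 1)))
  simpa [f] using (congrArg f h1).trans h2

variable {σ K L : Type*} [Field K] [Field L] [Algebra K L]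

/-- A first order deformation of the generic point of `P` lifts to any finite order. -/
theorem exists_sub_mem_sq_and_aeval_mem_pow [Fintype σ] [Algebra.FormallySmooth K L]
    (P : Ideal (MvPolynomial σ K)) [P.IsPrime]
    [Algebra (MvPolynomial σ K ⧸ P) L] [IsFractionRing (MvPolynomial σ K ⧸ P) L]
    [IsScalarTower K (MvPolynomial σ K ⧸ P) L] {a : σ → L}
    (ha : ∀ j, a j = algebraMap (MvPolynomial σ K ⧸ P) L (Ideal.Quotient.mk P (X j)))
    {b : σ → MvPolynomial σ L} (hb : ∀ j, b j - C (a j) ∈ idealOfVars σ L)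
    (hP : ∀ p ∈ P, ∑ j, C (aeval a (pderiv j p)) * (b j - C (a j)) = 0) {n : ℕ} (hn : 2 ≤ n) :
    ∃ φ : σ → MvPolynomial σ L, (∀ j, φ j - b j ∈ idealOfVars σ L ^ 2) ∧
      ∀ p ∈ P, aeval φ p ∈ idealOfVars σ L ^ n := by
  let S := MvPolynomial σ L
  let m := idealOfVars σ L
  have hCa (p : MvPolynomial σ K) : aeval (fun j => (C (a j) : S)) p = C (aeval a p) :=
    aeval_algebraMap_apply _ a p
  have hap (p : MvPolynomial σ K) :
      aeval a p = algebraMap (MvPolynomial σ K ⧸ P) L (Ideal.Quotient.mk P p) := by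
    have : aeval a = (IsScalarTower.toAlgHom K (MvPolynomial σ K ⧸ P) L).comp
        (Ideal.Quotient.mkₐ K P) := by
      ext j; simp [ha]
    rw [this]; rfl
  have hap0 (p : MvPolynomial σ K) : aeval a p = 0 ↔ p ∈ P := by
    rw [hap, FaithfulSMul.algebraMap_eq_zero_iff, Ideal.Quotient.eq_zero_iff_mem]
  have hbP (p : MvPolynomial σ K) (hp : p ∈ P) : aeval b p ∈ m ^ 2 := by
    have := aeval_sub_aeval_sub_sum_mem m hb p
    simp only [hCa] at this
    rwa [hP p hp, (hap0 p).2 hp, C_0, sub_zero, sub_zero] at this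
  let f₀ : MvPolynomial σ K →ₐ[K] S ⧸ m ^ 2 := (Ideal.Quotient.mkₐ K (m ^ 2)).comp (aeval b)
  let f₁ : (MvPolynomial σ K ⧸ P) →ₐ[K] S ⧸ m ^ 2 :=
    Ideal.Quotient.liftₐ P f₀ fun p hp => Ideal.Quotient.eq_zero_iff_mem.2 (hbP p hp)
  have hunit (y : nonZeroDivisors (MvPolynomial σ K ⧸ P)) : IsUnit (f₁ y) := by
    obtain ⟨y, hy⟩ := y
    obtain ⟨p, rfl⟩ := Ideal.Quotient.mk_surjective y
    have hp : aeval a p ≠ 0 := fun h => nonZeroDivisors.ne_zero hy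
      (Ideal.Quotient.eq_zero_iff_mem.2 ((hap0 p).1 h))
    have hsplit : f₁ (Ideal.Quotient.mk P p) = Ideal.Quotient.mk (m ^ 2) (C (aeval a p)) +
        Ideal.Quotient.mk (m ^ 2) (aeval b p - C (aeval a p)) := by
      rw [← map_add, add_sub_cancel]
      rfl
    rw [hsplit]
    refine IsNilpotent.isUnit_add_left_of_commute ⟨2, ?_⟩ ?_ (Commute.all _ _)
    · rw [← map_pow, Ideal.Quotient.eq_zero_iff_mem]
      refine Ideal.pow_mem_pow ?_ 2
      rw [← hCa]
      exact aeval_sub_aeval_mem m hb p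
    · exact (hp.isUnit.map C).map _
  let f₂ : L →ₐ[K] S ⧸ m ^ 2 := IsLocalization.liftAlgHom hunit
  have hf₂ (p : MvPolynomial σ K) : f₂ (aeval a p) = Ideal.Quotient.mk (m ^ 2) (aeval b p) := by
    rw [hap]
    exact IsLocalization.lift_eq hunit _
  let g : S ⧸ m ^ n →ₐ[K] S ⧸ m ^ 2 := Ideal.Quotient.factorₐ K (Ideal.pow_le_pow_right hn)
  have hg : Function.Surjective g := Ideal.Quotient.factor_surjective (Ideal.pow_le_pow_right hn)
  have hker : IsNilpotent (RingHom.ker (g : S ⧸ m ^ n →+* S ⧸ m ^ 2)) := by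
    have hle : RingHom.ker (g : S ⧸ m ^ n →+* S ⧸ m ^ 2) ≤ m.map (Ideal.Quotient.mk (m ^ n)) := by
      intro x hx
      obtain ⟨q, rfl⟩ := Ideal.Quotient.mk_surjective x
      exact Ideal.mem_map_of_mem _
        (Ideal.pow_le_self two_ne_zero (Ideal.Quotient.eq_zero_iff_mem.1 hx))
    refine ⟨n, le_bot_iff.1 ((Ideal.pow_right_mono hle n).trans ?_)⟩
    rw [← Ideal.map_pow, Ideal.map_quotient_self]
  let φ := Algebra.FormallySmooth.liftOfSurjective f₂ g hg hker
  choose φ' hφ' using fun j => Ideal.Quotient.mk_surjective (φ (a j))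
  refine ⟨φ', fun j => ?_, fun p hp => ?_⟩
  · have h1 : g (φ (a j)) = f₂ (a j) :=
      Algebra.FormallySmooth.liftOfSurjective_apply f₂ g hg hker _
    have h2 := hf₂ (X j)
    rw [aeval_X, aeval_X, ← h1, ← hφ'] at h2
    exact Ideal.Quotient.eq.1 h2
  · rw [← Ideal.Quotient.eq_zero_iff_mem]
    have : (Ideal.Quotient.mkₐ K (m ^ n)).comp (aeval φ') = φ.comp (aeval a) := by
      ext j
      simp [hφ']
    have h := AlgHom.congr_fun this p
    rw [AlgHom.comp_apply, AlgHom.comp_apply, (hap0 p).2 hp, map_zero] at h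
    exact h

/-- Formally near its generic point, the zero locus of `P` is a graph over the complement of a
set of coordinates spanning the Jacobian. -/
theorem exists_aeval_sub_sum_mem_pow [Fintype σ] [Algebra.FormallySmooth K L]
    (P : Ideal (MvPolynomial σ K)) [P.IsPrime]
    [Algebra (MvPolynomial σ K ⧸ P) L] [IsFractionRing (MvPolynomial σ K ⧸ P) L]
    [IsScalarTower K (MvPolynomial σ K ⧸ P) L] {a : σ → L}
    (ha : ∀ j, a j = algebraMap (MvPolynomial σ K ⧸ P) L (Ideal.Quotient.mk P (X j)))
    {ι : Type*} [Fintype ι] (M : ι → σ → L)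
    (hM : ∀ p ∈ P, (fun j => aeval a (pderiv j p)) ∈ Submodule.span L (Set.range M)) (n : ℕ) :
    ∃ (w : ι → σ → L) (τ : ι → MvPolynomial σ L), (∀ i, τ i ∈ idealOfVars σ L) ∧
      ∀ p ∈ P, aeval (fun j => C (a j) + X j - ∑ i, C (w i j) * τ i) p ∈
        idealOfVars σ L ^ (n + 2) := by
  classical
  obtain ⟨W, hW⟩ := Matrix.exists_mul_mul_eq_self (Matrix.of M)
  let lin (i : ι) : MvPolynomial σ L := ∑ k, C (M i k) * X k
  have hlin (i : ι) : lin i ∈ idealOfVars σ L :=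
    sum_mem fun k _ => Ideal.mul_mem_left _ _ (X_mem_idealOfVars k)
  let b (j : σ) : MvPolynomial σ L := C (a j) + X j - ∑ i, C (W j i) * lin i
  have hbsub (j : σ) : b j - C (a j) = X j - ∑ i, C (W j i) * lin i := by simp only [b]; ring
  have hb (j : σ) : b j - C (a j) ∈ idealOfVars σ L := by
    rw [hbsub]
    exact sub_mem (X_mem_idealOfVars j) (sum_mem fun i _ => Ideal.mul_mem_left _ _ (hlin i))
  have hrow (v : σ → L) (hv : v ∈ Submodule.span L (Set.range M)) :
      ∑ j, C (v j) * (b j - C (a j)) = 0 := by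
    induction hv using Submodule.span_induction with
    | mem v hv =>
      obtain ⟨i', rfl⟩ := hv
      have h1 (k : σ) : M i' k = ∑ i, (∑ j, M i' j * W j i) * M i k := by
        have := congrFun (congrFun hW i') k
        simpa [Matrix.mul_apply] using this.symm
      simp only [hbsub, mul_sub, Finset.sum_sub_distrib, sub_eq_zero, lin]
      conv_lhs => enter [2, k]; rw [h1 k]
      simp only [map_sum, map_mul, Finset.sum_mul, Finset.mul_sum]
      rw [Finset.sum_comm, Finset.sum_congr rfl fun i _ => Finset.sum_comm, Finset.sum_comm]
      simp only [mul_assoc]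
    | zero => simp
    | add v v' _ _ hv hv' => simp [add_mul, Finset.sum_add_distrib, hv, hv']
    | smul c v _ hv => simp [mul_assoc, ← Finset.mul_sum, hv]
  obtain ⟨φ, hφ, hφP⟩ := exists_sub_mem_sq_and_aeval_mem_pow P ha hb
    (fun p hp => hrow _ (hM p hp)) (Nat.le_add_left 2 n)
  obtain ⟨ψ, hψ, hψs⟩ := exists_algHom_map_X_add_sub_X_mem hφ n
  refine ⟨fun i j => W j i, fun i => ψ (lin i), fun i => idealOfVars_le_comap hψ (hlin i),
    fun p hp => ?_⟩
  have h1 : aeval (fun j => ψ (φ j)) p ∈ idealOfVars σ L ^ (n + 2) := by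
    have : aeval (fun j => ψ (φ j)) p = ψ (aeval φ p) := by
      have : aeval (fun j => ψ (φ j)) = (ψ.restrictScalars K).comp (aeval φ) := by ext; simp
      rw [this]; rfl
    rw [this]
    exact map_mem_pow_idealOfVars hψ (hφP p hp)
  have h2 : ∀ j, (C (a j) + X j - ∑ i, C (W j i) * ψ (lin i)) - ψ (φ j) ∈
      idealOfVars σ L ^ (n + 2) := fun j => by
    have : (C (a j) + X j - ∑ i, C (W j i) * ψ (lin i)) - ψ (φ j) =
        -(ψ (X j + (φ j - b j)) - X j) := by
      have hC (c : L) : ψ (C c) = C c := ψ.commutes c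
      simp only [b, map_add, map_sub, map_sum, map_mul, hC]
      ring
    rw [this]
    exact neg_mem (hψs j)
  convert add_mem (aeval_sub_aeval_mem _ h2 p) h1 using 1
  ring

end FormalLift

section Descent

theorem Algebra.nonempty_algHom_of_finiteType (K A : Type*) [Field K] [IsAlgClosed K] [CommRing A]
    [Nontrivial A] [Algebra K A] [Algebra.FiniteType K A] : Nonempty (A →ₐ[K] K) := by
  obtain ⟨M, hM⟩ := Ideal.exists_maximal A
  let : Field (A ⧸ M) := Ideal.Quotient.field M
  have : Module.Finite K (A ⧸ M) := finite_of_finite_type_of_isJacobsonRing K (A ⧸ M)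
  exact ⟨(IsAlgClosed.lift (M := K) (R := K) (S := A ⧸ M)).comp (Ideal.Quotient.mkₐ K M)⟩

theorem HasCollapse.of_map {K L σ : Type*} [Field K] [IsAlgClosed K] [Field L] [Algebra K L]
    {d k : ℕ} {F : MvPolynomial σ K} (h : HasCollapse d k (map (algebraMap K L) F)) :
    HasCollapse d k F := by
  classical
  obtain ⟨G, e, hG, hF⟩ := h
  obtain ⟨c, hc⟩ := Ideal.mem_span_range_iff_exists_fun.1 hF
  let T : Finset L := Finset.univ.biUnion fun i => (G i).coeffs ∪ (c i).coeffs
  let A := Algebra.adjoin K (T : Set L)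
  have : Algebra.FiniteType K A := (Subalgebra.fg_iff_finiteType _).1 ⟨T, rfl⟩
  have hlift (p : MvPolynomial σ L) (hp : p.coeffs ⊆ T) :
      ∃ q : MvPolynomial σ A, map (algebraMap A L) q = p := by
    refine mem_range_map_iff_coeffs_subset.2 fun x hx => ?_
    exact ⟨⟨x, Algebra.subset_adjoin (hp hx)⟩, rfl⟩
  have hsub (i : Fin k) : (G i).coeffs ∪ (c i).coeffs ⊆ T :=
    Finset.subset_biUnion_of_mem (fun i => (G i).coeffs ∪ (c i).coeffs) (Finset.mem_univ i)
  choose G' hG' using fun i => hlift (G i) (Finset.union_subset_left (hsub i))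
  choose c' hc' using fun i => hlift (c i) (Finset.union_subset_right (hsub i))
  have hinj : Function.Injective (algebraMap A L) := Subtype.val_injective
  obtain ⟨φ⟩ := Algebra.nonempty_algHom_of_finiteType K A
  have hA : ∑ i, c' i * G' i = map (algebraMap K A) F := by
    apply map_injective _ hinj
    rw [map_sum, map_map, ← IsScalarTower.algebraMap_eq, ← hc]
    simp [hG', hc']
  refine ⟨fun i => map (φ : A →+* K) (G' i), e, fun i => ⟨(hG i).1, (hG i).2.1, ?_⟩, ?_⟩
  · refine IsHomogeneous.map (IsHomogeneous.of_map hinj ?_) _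
    rw [hG']
    exact (hG i).2.2
  · refine Ideal.mem_span_range_iff_exists_fun.2 ⟨fun i => map (φ : A →+* K) (c' i), ?_⟩
    have := congrArg (map (φ : A →+* K)) hA
    rw [map_sum, map_map, φ.comp_algebraMap, Algebra.algebraMap_self, map_id] at this
    simpa using this

end Descent

/-- A form that is singular along a prime of height at most `h` has a collapse of bounded length. -/
theorem hasCollapse_of_pderiv_mem {σ K : Type*} [Finite σ] [Field K] [IsAlgClosed K]
    {d h : ℕ} (hd : 0 < d) {F : MvPolynomial σ K} (hF : F.IsHomogeneous d)
    (P : Ideal (MvPolynomial σ K)) [P.IsPrime] (hP : P.height ≤ h) (hFP : F ∈ P)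
    (hder : ∀ j, pderiv j F ∈ P) : HasCollapse d (h * (d - 1)) F := by
  have := Fintype.ofFinite σ
  let A := MvPolynomial σ K ⧸ P
  let L := FractionRing A
  let a (j : σ) : L := algebraMap A L (Ideal.Quotient.mk P (X j))
  have hap (p : MvPolynomial σ K) : aeval a p = 0 ↔ p ∈ P := by
    have : aeval a = (IsScalarTower.toAlgHom K A L).comp (Ideal.Quotient.mkₐ K P) := by
      ext j; simp [a, A]
    rw [this]
    change algebraMap A L (Ideal.Quotient.mk P p) = 0 ↔ _
    rw [FaithfulSMul.algebraMap_eq_zero_iff, Ideal.Quotient.eq_zero_iff_mem]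
  have : Algebra.EssFiniteType A L := .of_isLocalization L (nonZeroDivisors A)
  have : Algebra.EssFiniteType K L := .comp K A L
  obtain ⟨M, hM⟩ := exists_fin_pderiv_mem_span P hP hap
  obtain ⟨w, τ, hτ, hwτ⟩ := exists_aeval_sub_sum_mem_pow P (fun _ => rfl) M hM (d - 1)
  have hFd := hwτ F hFP
  rw [show d - 1 + 2 = d + 1 by omega] at hFd
  have hspan := map_mem_span_homogeneousComponent hd hF (fun j => (hap _).2 (hder j)) w hτ hFd
  refine HasCollapse.of_map (L := L)
    ⟨fun i => homogeneousComponent (((finProdFinEquiv.symm i).2 : ℕ) + 1)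
      (τ (finProdFinEquiv.symm i).1), fun i => ((finProdFinEquiv.symm i).2 : ℕ) + 1,
      fun i => ⟨Nat.succ_pos _,
        by have := (finProdFinEquiv.symm i).2.is_lt; dsimp only; omega,
        homogeneousComponent_isHomogeneous _ _⟩, ?_⟩
  convert hspan
  exact finProdFinEquiv.symm.surjective.range_comp
    (fun p : Fin h × Fin (d - 1) => homogeneousComponent ((p.2 : ℕ) + 1) (τ p.1))

/-- For all positive `η`, `d` there is `A ≥ d - 1`, independent of `N` and `K`,
such that over any algebraically closed field `K`, any form `F` of degree `d` in
`K[x_1, …, x_N]` of strength at least `A` satisfies: the ideal generated by `F` together with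
all its partial derivatives has height at least `η + 2`. -/
theorem statement0 (η d : ℕ) (hη : 0 < η) (hd : 0 < d) :
    ∃ A : ℕ, d - 1 ≤ A ∧
      ∀ (K : Type*) [Field K] [IsAlgClosed K] (N : ℕ)
        (F : MvPolynomial (Fin N) K),
        F.IsHomogeneous d → F ≠ 0 → ¬ HasCollapse d A F →
        ((η : ℕ∞) + 2) ≤
          idealHeight (Ideal.span ({F} ∪ Set.range fun j : Fin N => pderiv j F)) := by
  refine ⟨(η + 1) * (d - 1), Nat.le_mul_of_pos_left _ η.succ_pos, ?_⟩
  intro K _ _ N F hF _ hcollapse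
  refine le_iInf₂ fun P hP => ?_
  by_contra! hlt
  have hmem (p : MvPolynomial (Fin N) K)
      (hp : p ∈ ({F} ∪ Set.range fun j : Fin N => pderiv j F : Set _)) : p ∈ P.asIdeal :=
    hP (Ideal.subset_span hp)
  refine hcollapse (hasCollapse_of_pderiv_mem hd hF P.asIdeal ?_ (hmem F (Or.inl rfl))
    fun j => hmem _ (Or.inr ⟨j, rfl⟩))
  rw [PrimeSpectrum.height_eq_orderHeight]
  refine Order.le_of_lt_add_one (hlt.trans_le ?_)
  push_cast
  rw [add_assoc, one_add_one_eq_two]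
end

section
/- For every positive integer η and every d ≥ 1 there exist functions ηA_1,…,ηA_d from ℕ^d to ℕ, independent of N and of K, with the following property: for every algebraically closed field K, every N, and every graded K-vector subspace V = V_1 ⊕ … ⊕ V_d of R = K[x_1,…,x_N] with dimension sequence δ = (δ_1,…,δ_d), if for each 1 ≤ i ≤ d every nonzero element of V_i has strength at least ηA_i(δ), then every sequence of K-linearly independent forms in V is an R_η-sequence (and in particular a regular sequence). -/
open MvPolynomial

universe u

namespace AnanyanHochster

section RegularLocal

open IsLocalRing

variable {A : Type*} [CommRing A]

theorem isRegularLocalRing_quotient_span_range [IsRegularLocalRing A] {r : ℕ}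
    (x : Fin r → maximalIdeal A)
    (hx : LinearIndependent (ResidueField A) fun i ↦ (maximalIdeal A).toCotangent (x i)) :
    IsRegularLocalRing (A ⧸ Ideal.span (Set.range fun i ↦ (x i : A))) ∧
      ringKrullDim (A ⧸ Ideal.span (Set.range fun i ↦ (x i : A))) + r = ringKrullDim A := by
  set I : Ideal A := Ideal.span (Set.range fun i ↦ (x i : A)) with hI
  have hIm : I ≤ maximalIdeal A := by
    rw [hI, Ideal.span_le]; rintro _ ⟨i, rfl⟩; exact (x i).2
  have hItop : I ≠ ⊤ := fun h ↦ Ideal.IsPrime.ne_top' (top_le_iff.1 (h ▸ hIm))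
  have : Nontrivial (A ⧸ I) := Ideal.Quotient.nontrivial_iff.2 hItop
  have : IsLocalRing (A ⧸ I) :=
    .of_surjective' (Ideal.Quotient.mk I) Ideal.Quotient.mk_surjective
  set W := Submodule.span (ResidueField A)
    (Set.range fun i ↦ (maximalIdeal A).toCotangent (x i)) with hW
  obtain ⟨W', hW'⟩ := Submodule.exists_isCompl W
  have hWr : Module.finrank (ResidueField A) W = r := by
    rw [hW, finrank_span_eq_card hx, Fintype.card_fin]
  set m := Module.finrank (ResidueField A) W' with hm
  have hsum : r + m = Module.finrank (ResidueField A) (CotangentSpace A) := by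
    rw [← hWr, hm, Submodule.finrank_add_eq_of_isCompl hW']
  let b := Module.finBasis (ResidueField A) W'
  have hb : ∀ i, ∃ y : maximalIdeal A, (maximalIdeal A).toCotangent y = (b i : CotangentSpace A) :=
    fun i ↦ (maximalIdeal A).toCotangent_surjective _
  choose y hy using hb
  have hspan : Submodule.span A (Set.range x ∪ Set.range y) = ⊤ := by
    rw [← CotangentSpace.span_image_eq_top_iff, Set.image_union, Submodule.span_union,
      ← Set.range_comp, ← Set.range_comp]
    have h1 : Submodule.span (ResidueField A) (Set.range ((maximalIdeal A).toCotangent ∘ y))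
        = W' := by
      have : ((maximalIdeal A).toCotangent ∘ y) = W'.subtype ∘ b := by
        ext i; simp [hy]
      rw [this, Set.range_comp, ← Submodule.map_span, b.span_eq]
      simp
    rw [h1]
    exact hW'.sup_eq_top
  have hmax : maximalIdeal (A ⧸ I) =
      Ideal.span (Set.range fun i ↦ Ideal.Quotient.mk I (y i : A)) := by
    have h1 : maximalIdeal A = Ideal.span (Set.range (fun i ↦ (x i : A)) ∪
        Set.range fun i ↦ (y i : A)) := by
      have := congrArg (Submodule.map (maximalIdeal A).subtype) hspan
      rw [Submodule.map_span, Submodule.map_top, Submodule.range_subtype, Set.image_union,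
        ← Set.range_comp, ← Set.range_comp] at this
      exact this.symm
    have h2 : maximalIdeal (A ⧸ I) = (maximalIdeal A).map (Ideal.Quotient.mk I) := by
      refine (IsLocalRing.eq_maximalIdeal ?_).symm
      exact Ideal.map_eq_top_or_isMaximal_of_surjective _ Ideal.Quotient.mk_surjective
        inferInstance |>.resolve_left fun h ↦ by
          have := congrArg (Ideal.comap (Ideal.Quotient.mk I)) h
          rw [Ideal.comap_map_of_surjective _ Ideal.Quotient.mk_surjective,
            ← RingHom.ker_eq_comap_bot, Ideal.mk_ker, sup_eq_left.2 hIm, Ideal.comap_top] at this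
          exact Ideal.IsPrime.ne_top' this
    have h3 := congrArg (Ideal.map (Ideal.Quotient.mk I)) h1
    rw [Ideal.span_union, Ideal.map_sup, ← hI, Ideal.map_quotient_self, bot_sup_eq,
      Ideal.map_span, ← Set.range_comp] at h3
    exact h2.trans h3
  have hle : (maximalIdeal (A ⧸ I)).spanFinrank ≤ m := by
    rw [hmax]
    refine (Submodule.spanFinrank_span_le_ncard_of_finite (Set.finite_range _)).trans ?_
    rw [← Set.image_univ]
    refine (Set.ncard_image_le (Set.finite_univ)).trans ?_
    simp [Set.ncard_univ, hm]
  have hdimA : ringKrullDim A = ((r + m : ℕ) : WithBot ℕ∞) := by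
    rw [hsum, (IsRegularLocalRing.iff_finrank_cotangentSpace A).1 inferInstance]
  have hle2 : ringKrullDim A ≤ ringKrullDim (A ⧸ I) + r := by
    refine (ringKrullDim_le_ringKrullDim_quotient_add_encard
      (Set.range fun i ↦ (x i : A)) ?_).trans ?_
    · rw [ringJacobson_eq_maximalIdeal]; rintro _ ⟨i, rfl⟩; exact (x i).2
    · rw [← hI]
      gcongr
      have : (Set.range fun i ↦ (x i : A)).encard ≤ (r : ℕ∞) := by
        rw [← Set.image_univ]
        refine (Set.encard_image_le _ _).trans ?_
        simp
      exact_mod_cast this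
  have hfin : FiniteRingKrullDim (A ⧸ I) := inferInstance
  obtain ⟨k, hk⟩ : ∃ k : ℕ, ringKrullDim (A ⧸ I) = k := by
    have h0 := ringKrullDim_ne_top (R := A ⧸ I)
    have h1 := ringKrullDim_ne_bot (R := A ⧸ I)
    cases h : ringKrullDim (A ⧸ I) with
    | bot => exact absurd h h1
    | coe a =>
      cases a with
      | top => exact absurd h h0
      | coe a => exact ⟨a, rfl⟩
  have hk1 : (m : WithBot ℕ∞) ≤ k := by
    rw [hdimA, hk] at hle2
    have : r + m ≤ k + r := by exact_mod_cast hle2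
    have : m ≤ k := by omega
    exact_mod_cast this
  have hreg : IsRegularLocalRing (A ⧸ I) := by
    apply IsRegularLocalRing.of_spanFinrank_maximalIdeal_le
    rw [hk]
    exact le_trans (by exact_mod_cast hle) hk1
  refine ⟨hreg, ?_⟩
  have h3 := hreg.spanFinrank_maximalIdeal
  rw [hk] at h3
  have h3' : (maximalIdeal (A ⧸ I)).spanFinrank = k := by exact_mod_cast h3
  have : m ≤ k := by exact_mod_cast hk1
  have : k = m := by omega
  rw [hk, hdimA, this]
  push_cast
  exact add_comm _ _

theorem exists_natCast_ringKrullDim_eq [IsNoetherianRing A] [IsLocalRing A] :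
    ∃ n : ℕ, ringKrullDim A = n := by
  have h0 := ringKrullDim_ne_top (R := A)
  have h1 := ringKrullDim_ne_bot (R := A)
  cases h : ringKrullDim A with
  | bot => exact absurd h h1
  | coe a =>
    cases a with
    | top => exact absurd h h0
    | coe a => exact ⟨a, rfl⟩

theorem isRegularLocalRing_quotient_singleton [IsRegularLocalRing A] {x : A}
    (hx : x ∈ maximalIdeal A) (hx2 : x ∉ maximalIdeal A ^ 2) :
    IsRegularLocalRing (A ⧸ Ideal.span {x}) ∧
      ringKrullDim (A ⧸ Ideal.span {x}) + 1 = ringKrullDim A := by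
  have h := isRegularLocalRing_quotient_span_range (A := A) (r := 1) (fun _ ↦ ⟨x, hx⟩) (by
    rw [linearIndependent_unique_iff]
    simpa [Ideal.toCotangent_eq_zero] using hx2)
  have hr : (Set.range fun i : Fin 1 ↦ (((fun _ ↦ ⟨x, hx⟩ : Fin 1 → maximalIdeal A) i : A))) = {x} :=
    Set.range_const
  rw [hr] at h
  exact_mod_cast h

theorem exists_mem_maximalIdeal_notMem_sq [IsRegularLocalRing A] {n : ℕ}
    (hn : ringKrullDim A = (n + 1 : ℕ)) :
    ∃ x ∈ maximalIdeal A, x ∉ maximalIdeal A ^ 2 ∧ ∀ q ∈ minimalPrimes A, x ∉ q := by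
  by_contra! hcon
  have hfin : (insert (maximalIdeal A ^ 2) (minimalPrimes A)).Finite :=
    (minimalPrimes.finite_of_isNoetherianRing A).insert _
  have := (Ideal.subset_union_prime_finite hfin (f := id) (maximalIdeal A ^ 2)
    (maximalIdeal A ^ 2) (fun q hq h1 _ ↦ (hq.resolve_left h1).1.1) (I := maximalIdeal A)).1 (by
      intro x hx
      by_cases hx2 : x ∈ maximalIdeal A ^ 2
      · exact Set.mem_biUnion (Set.mem_insert _ _) hx2
      · obtain ⟨q, hq, hxq⟩ := hcon x hx hx2
        exact Set.mem_biUnion (Set.mem_insert_of_mem _ hq) hxq)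
  obtain ⟨q, hq, hle⟩ := this
  rcases hq with rfl | hq
  · have h0 : maximalIdeal A = ⊥ := by
      apply Submodule.eq_bot_of_le_smul_of_le_jacobson_bot (maximalIdeal A) _
        (IsNoetherian.noetherian _)
      · simpa [sq] using hle
      · rw [IsLocalRing.jacobson_eq_maximalIdeal _ bot_ne_top]
    have h1 := (inferInstance : IsRegularLocalRing A).spanFinrank_maximalIdeal
    rw [h0, hn] at h1
    simp at h1
    norm_cast at h1
  · have h1 : maximalIdeal A = q :=
      ((maximalIdeal.isMaximal A).eq_of_le hq.1.1.ne_top hle)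
    have h2 := maximalIdeal_height_eq_ringKrullDim (R := A)
    rw [hn, h1] at h2
    have := hq.1.1
    have h3 : q.height = 0 := by
      rw [Ideal.height_eq_zero_iff]; exact hq
    rw [h3] at h2
    norm_cast at h2

theorem isDomain_of_isRegularLocalRing (A : Type*) [CommRing A] [IsRegularLocalRing A] :
    IsDomain A := by
  obtain ⟨n, hn⟩ := exists_natCast_ringKrullDim_eq (A := A)
  induction n generalizing A with
  | zero =>
    have h1 := (inferInstance : IsRegularLocalRing A).spanFinrank_maximalIdeal
    rw [hn] at h1
    have h2 : (maximalIdeal A).spanFinrank = 0 := by exact_mod_cast h1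
    rw [Submodule.spanFinrank_eq_zero_iff_eq_bot (IsNoetherian.noetherian _)] at h2
    exact ((IsLocalRing.isField_iff_maximalIdeal_eq).2 h2).isDomain
  | succ n ih =>
    obtain ⟨x, hx, hx2, hxq⟩ := exists_mem_maximalIdeal_notMem_sq hn
    obtain ⟨hreg, hdim⟩ := isRegularLocalRing_quotient_singleton hx hx2
    have hdom : IsDomain (A ⧸ Ideal.span {x}) := by
      apply ih
      obtain ⟨k, hk⟩ := exists_natCast_ringKrullDim_eq (A := A ⧸ Ideal.span {x})
      rw [hk, hn] at hdim
      have : k + 1 = n + 1 := by exact_mod_cast hdim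
      rw [hk]; congr; omega
    have hp : (Ideal.span {x}).IsPrime := (Ideal.Quotient.isDomain_iff_prime _).1 hdom
    obtain ⟨q, hq, hqx⟩ := Ideal.exists_minimalPrimes_le (I := (⊥ : Ideal A)) (J := Ideal.span {x})
      bot_le
    have hqp : q.IsPrime := hq.1.1
    have h0 : q = ⊥ := by
      apply Submodule.eq_bot_of_le_smul_of_le_jacobson_bot (maximalIdeal A) _
        (IsNoetherian.noetherian _)
      · intro y hy
        obtain ⟨z, rfl⟩ := Ideal.mem_span_singleton.1 (hqx hy)
        exact Submodule.smul_mem_smul hx ((hqp.mem_or_mem hy).resolve_left (hxq q hq))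
      · rw [IsLocalRing.jacobson_eq_maximalIdeal _ bot_ne_top]
    rw [h0] at hqp
    exact IsDomain.of_bot_isPrime A

end RegularLocal

section Chain

open RingTheory.Sequence IsLocalRing

variable {A : Type*} [CommRing A]

theorem ofList_take_ofFn {n : ℕ} (g : Fin n → A) (i : ℕ) :
    Ideal.ofList ((List.ofFn g).take i) = Ideal.span (g '' {j | (j : ℕ) < i}) := by
  apply congrArg Ideal.span
  ext r
  simp only [Set.mem_ofPred_eq, Set.mem_image, List.mem_take_iff_getElem, List.getElem_ofFn,
    List.length_ofFn]
  constructor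
  · rintro ⟨j, hj, rfl⟩
    exact ⟨⟨j, by omega⟩, by simp; omega, rfl⟩
  · rintro ⟨j, hj, rfl⟩
    exact ⟨j, by have := j.2; omega, rfl⟩

theorem isWeaklyRegular_ofFn {n : ℕ} (g : Fin n → A)
    (hp : ∀ i : Fin n, (Ideal.span (g '' {j | j < i})).IsPrime)
    (hg : ∀ i : Fin n, g i ∉ Ideal.span (g '' {j | j < i})) :
    IsWeaklyRegular A (List.ofFn g) := by
  rw [isWeaklyRegular_iff]
  intro i hi
  have hi' : i < n := by simpa using hi
  have key := ofList_take_ofFn g i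
  have hset : {j : Fin n | (j : ℕ) < i} = {j | j < (⟨i, hi'⟩ : Fin n)} := by
    ext j; simp [Fin.lt_def]
  rw [hset] at key
  have hP := hp ⟨i, hi'⟩
  have hgi := hg ⟨i, hi'⟩
  rw [← key] at hP hgi
  rw [isSMulRegular_iff_right_eq_zero_of_smul]
  intro m hm
  obtain ⟨a, rfl⟩ := Submodule.mkQ_surjective _ m
  rw [← map_smul, Submodule.mkQ_apply, Submodule.Quotient.mk_eq_zero] at hm
  rw [Submodule.mkQ_apply, Submodule.Quotient.mk_eq_zero]
  simp only [smul_eq_mul, Ideal.mul_top, List.getElem_ofFn] at hm ⊢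
  exact (hP.mem_or_mem hm).resolve_left hgi

theorem span_image_lt_eq {n : ℕ} (g : Fin n → A) (i : ℕ) (hi : i ≤ n) :
    Ideal.span (g '' {j | (j : ℕ) < i}) =
      Ideal.span (Set.range fun j : Fin i ↦ g (Fin.castLE hi j)) := by
  congr 1
  ext r
  simp only [Set.mem_image, Set.mem_ofPred_eq, Set.mem_range]
  constructor
  · rintro ⟨j, hj, rfl⟩
    exact ⟨⟨j, hj⟩, rfl⟩
  · rintro ⟨j, rfl⟩
    exact ⟨_, by simp, rfl⟩

theorem exists_isRegular_of_isRegularLocalRing [IsRegularLocalRing A] {n : ℕ}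
    (hn : ringKrullDim A = n) :
    ∃ rs : List A, rs.length = n ∧ (∀ r ∈ rs, r ∈ maximalIdeal A) ∧ IsRegular A rs := by
  have hfr : Module.finrank (ResidueField A) (CotangentSpace A) = n := by
    have := (IsRegularLocalRing.iff_finrank_cotangentSpace A).1 inferInstance
    rw [hn] at this
    exact_mod_cast this
  let b := (Module.finBasisOfFinrankEq (ResidueField A) (CotangentSpace A) hfr)
  choose x hx using fun i ↦ (maximalIdeal A).toCotangent_surjective (b i)
  have hli : LinearIndependent (ResidueField A) fun i ↦ (maximalIdeal A).toCotangent (x i) := by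
    simpa [hx] using b.linearIndependent
  have hq : ∀ i (hi : i ≤ n),
      IsRegularLocalRing (A ⧸ Ideal.span ((fun i ↦ (x i : A)) '' {j | (j : ℕ) < i})) ∧
      ringKrullDim (A ⧸ Ideal.span ((fun i ↦ (x i : A)) '' {j | (j : ℕ) < i})) + i =
        ringKrullDim A := by
    intro i hi
    rw [span_image_lt_eq _ i hi]
    exact isRegularLocalRing_quotient_span_range (fun j ↦ x (Fin.castLE hi j))
      (hli.comp _ (Fin.castLE_injective hi))
  refine ⟨List.ofFn fun i ↦ (x i : A), by simp, ?_, ?_, ?_⟩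
  · intro r hr
    rw [List.mem_ofFn] at hr
    obtain ⟨i, rfl⟩ := hr
    exact (x i).2
  · apply isWeaklyRegular_ofFn
    · intro i
      have := (hq i i.2.le).1
      have := isDomain_of_isRegularLocalRing
        (A ⧸ Ideal.span ((fun i ↦ (x i : A)) '' {j | (j : ℕ) < i}))
      exact (Ideal.Quotient.isDomain_iff_prime _).1 this
    · intro i hmem
      have hset : {j : Fin n | (j : ℕ) < i + 1} = insert i {j | j < i} := by
        ext j; simp only [Set.mem_ofPred_eq, Set.mem_insert_iff, Fin.lt_def, Fin.ext_iff]; omega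
      obtain ⟨-, h1⟩ := hq i i.2.le
      obtain ⟨h3, h2⟩ := hq (i + 1) i.2
      rw [hset, Set.image_insert_eq, Ideal.span_insert,
        sup_eq_right.2 ((Ideal.span_singleton_le_iff_mem _).2 hmem)] at h2 h3
      have h1' : ringKrullDim (A ⧸ Ideal.span ((fun i ↦ (x i : A)) '' {j | j < i})) + (i : ℕ) =
        ringKrullDim A := h1
      obtain ⟨k, hk⟩ := exists_natCast_ringKrullDim_eq
        (A := A ⧸ Ideal.span ((fun i ↦ (x i : A)) '' {j | j < i}))
      rw [hk, hn] at h1' h2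
      have e1 : k + (i : ℕ) = n := by exact_mod_cast h1'
      have e2 : k + ((i : ℕ) + 1) = n := by exact_mod_cast h2
      omega
  · intro h
    rw [smul_eq_mul, Ideal.mul_top] at h
    have : Ideal.ofList (List.ofFn fun i ↦ (x i : A)) ≤ maximalIdeal A := by
      rw [Ideal.ofList, Ideal.span_le]
      intro r hr
      simp only [Set.mem_ofPred_eq, List.mem_ofFn] at hr
      obtain ⟨i, rfl⟩ := hr
      exact (x i).2
    exact Ideal.IsPrime.ne_top' (top_le_iff.1 (h ▸ this))

end Chain

section Depth

open RingTheory.Sequence IsLocalRing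
open CategoryTheory Abelian Limits Pointwise

variable {A : Type u} [CommRing A]

theorem mem_ofList_smul_top_of_subsingleton_ext (I : Ideal A) (rs : List A)
    (M : ModuleCat.{u} A) (hreg : IsWeaklyRegular M rs)
    (hext : ∀ i ≤ rs.length, Subsingleton (Ext (ModuleCat.of A (A ⧸ I)) M i)) (s : M)
    (hs : ∀ a ∈ I, a • s ∈ (Ideal.ofList rs • ⊤ : Submodule A M)) :
    s ∈ (Ideal.ofList rs • ⊤ : Submodule A M) := by
  induction rs generalizing M with
  | nil =>
    have h0 := hext 0 le_rfl
    have : Subsingleton (ModuleCat.of A (A ⧸ I) ⟶ M) := Ext.addEquiv₀.subsingleton_congr.mp h0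
    have hsub : Subsingleton ((ModuleCat.of A (A ⧸ I)) →ₗ[A] M) := ModuleCat.homAddEquiv.symm.subsingleton
    simp only [Ideal.ofList_nil, Submodule.bot_smul, Submodule.mem_bot] at hs ⊢
    let f : (A ⧸ I) →ₗ[A] M := Submodule.liftQ I (LinearMap.toSpanSingleton A M s) (by
      intro a ha
      exact hs a ha)
    have hf : f = 0 := hsub.elim _ _
    have := LinearMap.congr_fun hf (Submodule.Quotient.mk 1)
    have h1 : (1 : A) • s = 0 := this
    rwa [one_smul] at h1
  | cons r rs ih =>
    rw [isWeaklyRegular_cons_iff] at hreg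
    obtain ⟨hr, hreg⟩ := hreg
    have hext' : ∀ i ≤ rs.length,
        Subsingleton (Ext (ModuleCat.of A (A ⧸ I)) (ModuleCat.of A (QuotSMulTop r M)) i) := by
      intro i hi
      have zero1 := AddCommGrpCat.isZero_of_iff_subsingleton.mpr
        (hext i (by rw [List.length_cons]; omega))
      have zero2 := AddCommGrpCat.isZero_of_iff_subsingleton.mpr
        (hext (i + 1) (by rw [List.length_cons]; omega))
      exact AddCommGrpCat.subsingleton_of_isZero <| ShortComplex.Exact.isZero_of_both_zeros
        ((Ext.covariant_sequence_exact₃' (ModuleCat.of A (A ⧸ I))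
          hr.smulShortComplex_shortExact) i (i + 1) rfl)
        (zero1.eq_zero_of_src _) (zero2.eq_zero_of_tgt _)
    have hmem : ∀ y : M, (Submodule.mkQ (r • ⊤ : Submodule A M)) y ∈
        (Ideal.ofList rs • ⊤ : Submodule A (QuotSMulTop r M)) ↔
        y ∈ (Ideal.ofList (r :: rs) • ⊤ : Submodule A M) := by
      intro y
      rw [Ideal.ofList_cons_smul, ← Submodule.mem_comap,
        Submodule.comap_smul_top_of_surjective _ _ (Submodule.mkQ_surjective _),
        Submodule.ker_mkQ, sup_comm]
    rw [← hmem]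
    exact ih (ModuleCat.of A (QuotSMulTop r M)) hreg hext' _ fun a ha ↦ by
      have := (hmem (a • s)).2 (hs a ha)
      rwa [map_smul] at this

theorem ringKrullDim_le_length_of_isWeaklyRegular [IsRegularLocalRing A] (rs : List A)
    (hreg : IsWeaklyRegular A rs) (s : A) (hs : s ∉ Ideal.ofList rs)
    (hms : ∀ a ∈ maximalIdeal A, a * s ∈ Ideal.ofList rs) :
    ringKrullDim A ≤ rs.length := by
  obtain ⟨n, hn⟩ := exists_natCast_ringKrullDim_eq (A := A)
  by_contra! hlt
  rw [hn] at hlt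
  have hlt' : rs.length < n := by exact_mod_cast hlt
  obtain ⟨xs, hlen, hmem, hxs⟩ := exists_isRegular_of_isRegularLocalRing hn
  have htop : (maximalIdeal A) • (⊤ : Submodule A A) < ⊤ := by
    rw [smul_eq_mul, Ideal.mul_top]
    exact lt_top_iff_ne_top.2 Ideal.IsPrime.ne_top'
  have hext := ModuleCat.subsingleton_ext_of_exists_isRegular (maximalIdeal A)
    (ModuleCat.of A (A ⧸ maximalIdeal A)) (by
      rw [Module.support_eq_zeroLocus, Ideal.annihilator_quotient])
    (ModuleCat.of A A) htop xs hmem hxs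
  have := mem_ofList_smul_top_of_subsingleton_ext (maximalIdeal A) rs (ModuleCat.of A A) hreg
    (fun i hi ↦ hext i (by omega)) s (by simpa using hms)
  rw [smul_eq_mul, Ideal.mul_top] at this
  exact hs this

end Depth

section Unmixed

open RingTheory.Sequence IsLocalRing

variable {R : Type*} [CommRing R]

theorem height_le_length_of_isWeaklyRegular [IsRegularRing R] (rs : List R)
    (hreg : IsWeaklyRegular R rs) (P : Ideal R) [hP : P.IsPrime] (s : R)
    (hs : ∀ r, r ∈ P ↔ r * s ∈ Ideal.ofList rs) : P.height ≤ rs.length := by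
  set A := Localization.AtPrime P
  have hregA := hreg.of_isLocalization A P.primeCompl
  have hmem : ∀ r, algebraMap R A r ∈ Ideal.ofList (rs.map (algebraMap R A)) ↔
      ∃ t ∈ P.primeCompl, t * r ∈ Ideal.ofList rs := by
    intro r
    rw [← Ideal.map_ofList, IsLocalization.algebraMap_mem_map_algebraMap_iff P.primeCompl]
  have h1 : algebraMap R A s ∉ Ideal.ofList (rs.map (algebraMap R A)) := by
    rw [hmem]
    rintro ⟨t, ht, hts⟩
    exact ht ((hs t).2 hts)
  have h2 : ∀ a ∈ maximalIdeal A, a * algebraMap R A s ∈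
      Ideal.ofList (rs.map (algebraMap R A)) := by
    intro a ha
    rw [← Localization.AtPrime.map_eq_maximalIdeal] at ha
    have : Ideal.map (algebraMap R A) P ≤
        (Ideal.ofList (rs.map (algebraMap R A))).colon {algebraMap R A s} := by
      rw [Ideal.map_le_iff_le_comap]
      intro r hr
      rw [Ideal.mem_comap, Submodule.mem_colon_singleton, smul_eq_mul, ← map_mul,
        ← Ideal.map_ofList]
      exact Ideal.mem_map_of_mem _ ((hs r).1 hr)
    simpa [Submodule.mem_colon_singleton] using this ha
  have h3 := ringKrullDim_le_length_of_isWeaklyRegular _ hregA _ h1 h2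
  rw [IsLocalization.AtPrime.ringKrullDim_eq_height P A, List.length_map] at h3
  exact_mod_cast h3

theorem isLocalization_quotient_map (I : Ideal R) (P : Ideal (R ⧸ I)) [P.IsPrime] :
    IsLocalization.AtPrime (Localization.AtPrime (P.comap (Ideal.Quotient.mk I)) ⧸
      I.map (algebraMap R (Localization.AtPrime (P.comap (Ideal.Quotient.mk I))))) P := by
  have h := (inferInstance : IsLocalization (Algebra.algebraMapSubmonoid (R ⧸ I)
    (P.comap (Ideal.Quotient.mk I)).primeCompl)
    (Localization.AtPrime (P.comap (Ideal.Quotient.mk I)) ⧸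
      I.map (algebraMap R (Localization.AtPrime (P.comap (Ideal.Quotient.mk I))))))
  have e : Algebra.algebraMapSubmonoid (R ⧸ I) (P.comap (Ideal.Quotient.mk I)).primeCompl =
      P.primeCompl := by
    ext x
    obtain ⟨x, rfl⟩ := Ideal.Quotient.mk_surjective x
    constructor
    · rintro ⟨y, hy, h⟩
      rw [← h]
      exact hy
    · intro hx
      exact ⟨x, hx, rfl⟩
  rwa [e] at h

end Unmixed

section Jacobian

open RingTheory.Sequence IsLocalRing

variable {K : Type*} [Field K] {N : ℕ}

/-- The Jacobian rows of `g` are linearly independent modulo the prime `P`. -/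
def JacobianFullRank {n : ℕ} (g : Fin n → MvPolynomial (Fin N) K)
    (P : Ideal (MvPolynomial (Fin N) K)) : Prop :=
  ∀ u : Fin n → MvPolynomial (Fin N) K, (∀ l, ∑ j, u j * pderiv l (g j) ∈ P) → ∀ j, u j ∈ P

theorem pderiv_mem_of_mem_sq {P : Ideal (MvPolynomial (Fin N) K)} {f : MvPolynomial (Fin N) K}
    (hf : f ∈ P ^ 2) (l : Fin N) : pderiv l f ∈ P := by
  rw [sq] at hf
  induction hf using Submodule.mul_induction_on' with
  | mem_mul_mem a ha b hb =>
    rw [Derivation.leibniz]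
    exact P.add_mem (P.mul_mem_right _ ha) (P.mul_mem_right _ hb)
  | add x _ y _ hx hy => rw [map_add]; exact P.add_mem hx hy

theorem JacobianFullRank.linearIndependent {n : ℕ} {g : Fin n → MvPolynomial (Fin N) K}
    {P : Ideal (MvPolynomial (Fin N) K)} [hP : P.IsPrime] (h : JacobianFullRank g P)
    (hg : ∀ j, g j ∈ P)
    (hg' : ∀ j, algebraMap _ (Localization.AtPrime P) (g j) ∈
      maximalIdeal (Localization.AtPrime P)) :
    LinearIndependent (ResidueField (Localization.AtPrime P)) fun j ↦
      (maximalIdeal (Localization.AtPrime P)).toCotangent ⟨_, hg' j⟩ := by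
  set A := Localization.AtPrime P
  rw [Fintype.linearIndependent_iff]
  intro c hc
  choose a ha using fun j ↦ IsLocalRing.residue_surjective (c j)
  obtain ⟨t, ht⟩ := IsLocalization.exist_integer_multiples_of_finite P.primeCompl a
  choose u hu using ht
  have h1 : ∑ j, a j * algebraMap _ A (g j) ∈ maximalIdeal A ^ 2 := by
    have h2 : (∑ j, a j • (⟨_, hg' j⟩ : maximalIdeal A)) ∈
        LinearMap.ker (maximalIdeal A).toCotangent := by
      rw [LinearMap.mem_ker, map_sum, ← hc]
      refine Finset.sum_congr rfl fun j _ ↦ ?_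
      rw [map_smul, ← ha]
      rfl
    rw [LinearMap.mem_ker, Ideal.toCotangent_eq_zero] at h2
    simpa using h2
  have h3 : algebraMap _ A (∑ j, u j * g j) ∈ (P ^ 2).map (algebraMap _ A) := by
    rw [Ideal.map_pow, Localization.AtPrime.map_eq_maximalIdeal]
    have : algebraMap _ A (∑ j, u j * g j) =
        algebraMap _ A (t : MvPolynomial (Fin N) K) * ∑ j, a j * algebraMap _ A (g j) := by
      rw [map_sum, Finset.mul_sum]
      refine Finset.sum_congr rfl fun j _ ↦ ?_
      rw [map_mul, hu, Algebra.smul_def, mul_assoc]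
    rw [this]
    exact Ideal.mul_mem_left _ _ h1
  rw [IsLocalization.algebraMap_mem_map_algebraMap_iff P.primeCompl] at h3
  obtain ⟨s, hs, hs2⟩ := h3
  have h4 : ∀ l, ∑ j, (s * u j) * pderiv l (g j) ∈ P := by
    intro l
    have h5 := pderiv_mem_of_mem_sq hs2 l
    have h6 : pderiv l (s * ∑ j, u j * g j) =
        ∑ j, (s * u j) * pderiv l (g j) + ∑ j, g j * pderiv l (s * u j) := by
      rw [Finset.mul_sum, map_sum, ← Finset.sum_add_distrib]
      refine Finset.sum_congr rfl fun j _ ↦ ?_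
      rw [← mul_assoc, Derivation.leibniz, smul_eq_mul, smul_eq_mul]
    rw [h6] at h5
    refine (Ideal.add_mem_iff_left _ ?_).1 h5
    exact Ideal.sum_mem _ fun j _ ↦ P.mul_mem_right _ (hg j)
  intro j
  have h7 : u j ∈ P := (hP.mem_or_mem (h _ h4 j)).resolve_left hs
  rw [← ha, IsLocalRing.residue_eq_zero_iff]
  have h8 : algebraMap _ A (u j) ∈ maximalIdeal A := by
    rw [← Localization.AtPrime.map_eq_maximalIdeal]
    exact Ideal.mem_map_of_mem _ h7
  rw [hu, Algebra.smul_def] at h8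
  have h9 : IsUnit (algebraMap (MvPolynomial (Fin N) K) A t) := IsLocalization.map_units A t
  exact ((maximalIdeal.isMaximal A).isPrime.mem_or_mem h8).resolve_left fun h10 ↦
    (IsLocalRing.mem_maximalIdeal _).1 h10 h9

theorem JacobianFullRank.isRegularLocalRing {n : ℕ} {g : Fin n → MvPolynomial (Fin N) K}
    (P : Ideal (MvPolynomial (Fin N) K ⧸ Ideal.span (Set.range g))) [hP : P.IsPrime]
    (h : JacobianFullRank g (P.comap (Ideal.Quotient.mk (Ideal.span (Set.range g))))) :
    IsRegularLocalRing (Localization.AtPrime P) ∧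
      ringKrullDim (Localization.AtPrime P) + n =
        (P.comap (Ideal.Quotient.mk (Ideal.span (Set.range g)))).height := by
  set Q := P.comap (Ideal.Quotient.mk (Ideal.span (Set.range g))) with hQ
  have hg : ∀ j, g j ∈ Q := fun j ↦ by
    rw [hQ, Ideal.mem_comap,
      Ideal.Quotient.eq_zero_iff_mem.2 (Ideal.subset_span (Set.mem_range_self j))]
    exact P.zero_mem
  have hg' : ∀ j, algebraMap _ (Localization.AtPrime Q) (g j) ∈
      maximalIdeal (Localization.AtPrime Q) := fun j ↦ by
    rw [← Localization.AtPrime.map_eq_maximalIdeal]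
    exact Ideal.mem_map_of_mem _ (hg j)
  have hreg := isRegularLocalRing_quotient_span_range _ (h.linearIndependent hg hg')
  have hloc := isLocalization_quotient_map (Ideal.span (Set.range g)) P
  have hI : Ideal.span (Set.range fun j ↦ algebraMap (MvPolynomial (Fin N) K)
      (Localization.AtPrime Q) (g j)) =
      (Ideal.span (Set.range g)).map (algebraMap _ (Localization.AtPrime Q)) := by
    rw [Ideal.map_span, ← Set.range_comp]
    rfl
  rw [hI] at hreg
  obtain ⟨hreg, hdim⟩ := hreg
  have e := (IsLocalization.algEquiv P.primeCompl (Localization.AtPrime Q ⧸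
      (Ideal.span (Set.range g)).map (algebraMap _ (Localization.AtPrime Q)))
      (Localization.AtPrime P)).toRingEquiv
  refine ⟨IsRegularLocalRing.of_ringEquiv (R := Localization.AtPrime Q ⧸
      (Ideal.span (Set.range g)).map (algebraMap _ (Localization.AtPrime Q))) e, ?_⟩
  rw [IsLocalization.AtPrime.ringKrullDim_eq_height Q (Localization.AtPrime Q)] at hdim
  rw [← hdim, ← ringKrullDim_eq_of_ringEquiv e]

end Jacobian

section Serre

open RingTheory.Sequence IsLocalRing

variable {C : Type*} [CommRing C]

theorem exists_prime_eq_colon [IsNoetherianRing C] {I : Ideal C} {a : C} (ha : a ∉ I) :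
    ∃ Q : Ideal C, Q.IsPrime ∧ (∃ s, ∀ r, r ∈ Q ↔ r * s ∈ I) ∧ ∀ r, r * a ∈ I → r ∈ Q := by
  obtain ⟨Q, hQ, hle⟩ := exists_le_isAssociatedPrime_of_isNoetherianRing (R := C)
    (Ideal.Quotient.mk I a) (fun h ↦ ha (Ideal.Quotient.eq_zero_iff_mem.1 h))
  rw [isAssociatedPrime_iff] at hQ
  obtain ⟨hp, x, hx⟩ := hQ
  obtain ⟨s, rfl⟩ := Ideal.Quotient.mk_surjective x
  have key : ∀ r b : C, r ∈ (⊥ : Submodule C (C ⧸ I)).colon {Ideal.Quotient.mk I b} ↔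
      r * b ∈ I := by
    intro r b
    rw [Submodule.mem_colon_singleton, Submodule.mem_bot, ← Ideal.Quotient.eq_zero_iff_mem]
    rfl
  exact ⟨Q, hp, ⟨s, fun r ↦ by rw [hx, key]⟩, fun r hr ↦ hle ((key r a).2 hr)⟩

theorem exists_notMem_of_mul_eq_zero {Q : Ideal C} [Q.IsPrime]
    (hd : IsDomain (Localization.AtPrime Q)) {a b : C} (hab : a * b = 0) :
    (∃ t ∉ Q, t * a = 0) ∨ ∃ t ∉ Q, t * b = 0 := by
  have h : algebraMap C (Localization.AtPrime Q) a * algebraMap C (Localization.AtPrime Q) b = 0 := by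
    rw [← map_mul, hab, map_zero]
  have key : ∀ c : C, algebraMap C (Localization.AtPrime Q) c = 0 → ∃ t ∉ Q, t * c = 0 := by
    intro c hc
    obtain ⟨t, ht⟩ := (IsLocalization.map_eq_zero_iff Q.primeCompl _ c).1 hc
    exact ⟨t, t.2, ht⟩
  exact (mul_eq_zero.1 h).imp (key a) (key b)

theorem isReduced_of_isDomain_localization [IsNoetherianRing C]
    (h0 : ∀ (P : Ideal C) [P.IsPrime], (∃ s, ∀ r, r ∈ P ↔ r * s = 0) →
      IsDomain (Localization.AtPrime P)) : IsReduced C := by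
  refine ⟨fun x hx ↦ ?_⟩
  by_contra hne
  obtain ⟨P, hP, ⟨s, hs⟩, hle⟩ := exists_prime_eq_colon (I := (⊥ : Ideal C)) (a := x) (by simpa)
  have := h0 P ⟨s, by simpa using hs⟩
  obtain ⟨n, hn⟩ := hx
  have h1 : algebraMap C (Localization.AtPrime P) x = 0 := by
    refine eq_zero_of_pow_eq_zero (n := n) ?_
    rw [← map_pow, hn, map_zero]
  obtain ⟨t, ht⟩ := (IsLocalization.map_eq_zero_iff P.primeCompl _ x).1 h1
  exact t.2 (hle t (by simpa using ht))

theorem isDomain_of_isDomain_localization [IsNoetherianRing C] [Nontrivial C]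
    (hidem : ∀ e : C, e * e = e → e = 0 ∨ e = 1)
    (h0 : ∀ (P : Ideal C) [P.IsPrime], (∃ s, ∀ r, r ∈ P ↔ r * s = 0) →
      IsDomain (Localization.AtPrime P))
    (h1 : ∀ v ∈ nonZeroDivisors C, ∀ (Q : Ideal C) [Q.IsPrime],
      (∃ s, ∀ r, r ∈ Q ↔ r * s ∈ Ideal.span {v}) → IsDomain (Localization.AtPrime Q)) :
    IsDomain C := by
  classical
  have hred := isReduced_of_isDomain_localization h0
  have hfin := minimalPrimes.finite_of_isNoetherianRing C
  set S := hfin.toFinset with hS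
  have hmemS : ∀ q, q ∈ S ↔ q ∈ minimalPrimes C := fun q ↦ hfin.mem_toFinset
  have hzero : ∀ x : C, (∀ q ∈ S, x ∈ q) → x = 0 := by
    intro x hx
    have : x ∈ sInf (Ideal.minimalPrimes (⊥ : Ideal C)) := by
      rw [Ideal.mem_sInf]
      exact fun {q} hq ↦ hx q ((hmemS q).2 hq)
    rw [Ideal.sInf_minimalPrimes] at this
    have h2 : nilradical C = ⊥ := nilradical_eq_zero C
    rw [nilradical] at h2
    change x ∈ Ideal.radical (0 : Ideal C) at this
    rwa [h2] at this
  obtain ⟨p, hp⟩ : ∃ p, p ∈ S := by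
    by_contra! h
    exact one_ne_zero (hzero 1 fun q hq ↦ absurd hq (h q))
  have hprime : ∀ q ∈ S, q.IsPrime := fun q hq ↦ ((hmemS q).1 hq).1.1
  have hle : ∀ q ∈ S, ∀ q' ∈ S, q ≤ q' → q = q' := fun q hq q' hq' h ↦
    le_antisymm h (((hmemS q').1 hq').2 ((hmemS q).1 hq).1 h)
  have hpp := hprime p hp
  by_cases hSp : ∀ q ∈ S, q = p
  · have : p = ⊥ := by
      rw [eq_bot_iff]
      intro x hx
      exact hzero x fun q hq ↦ (hSp q hq) ▸ hx
    rw [this] at hpp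
    exact IsDomain.of_bot_isPrime C
  exfalso
  push Not at hSp
  obtain ⟨q₀, hq₀, hq₀p⟩ := hSp
  obtain ⟨a, haJ, hap⟩ : ∃ a, (∀ q ∈ S, q ≠ p → a ∈ q) ∧ a ∉ p := by
    by_contra! h
    have h2 : (S.erase p).inf id ≤ p := by
      intro a ha
      refine h a fun q hq hqp ↦ ?_
      have : (S.erase p).inf id ≤ q := Finset.inf_le (f := id) (Finset.mem_erase.2 ⟨hqp, hq⟩)
      exact this ha
    obtain ⟨q, hq, hqp⟩ := (hpp.inf_le').1 h2
    exact (Finset.mem_erase.1 hq).1 (hle q (Finset.mem_erase.1 hq).2 p hp hqp)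
  obtain ⟨b, hbp, hbq⟩ : ∃ b ∈ p, ∀ q ∈ S, q ≠ p → b ∉ q := by
    by_contra! h
    obtain ⟨q, hq, hpq⟩ := (Ideal.subset_union_prime (s := S.erase p) (f := id) p p
      (fun q hq _ _ ↦ hprime q (Finset.mem_of_mem_erase hq)) (I := p)).1 (by
        intro b hb
        obtain ⟨q, hq, hqp, hbq⟩ := h b hb
        exact Set.mem_biUnion (Finset.mem_coe.2 (Finset.mem_erase.2 ⟨hqp, hq⟩)) hbq)
    exact (Finset.mem_erase.1 hq).1 (hle p hp q (Finset.mem_erase.1 hq).2 hpq).symm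
  have hab : a * b = 0 := by
    refine hzero _ fun q hq ↦ ?_
    by_cases hqp : q = p
    · rw [hqp]; exact p.mul_mem_left _ hbp
    · exact q.mul_mem_right _ (haJ q hq hqp)
  have hv : a + b ∈ nonZeroDivisors C := by
    rw [mem_nonZeroDivisors_iff_right]
    intro x hx
    refine hzero x fun q hq ↦ ?_
    have h2 : x * (a + b) ∈ q := by rw [hx]; exact q.zero_mem
    refine ((hprime q hq).mem_or_mem h2).resolve_right fun h3 ↦ ?_
    by_cases hqp : q = p
    · rw [hqp] at h3
      exact hap ((p.add_mem_iff_left hbp).1 h3)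
    · exact hbq q hq hqp ((q.add_mem_iff_right (haJ q hq hqp)).1 h3)
  have hav : a ∈ Ideal.span {a + b} := by
    by_contra hav
    obtain ⟨Q, hQ, hs, hQle⟩ := exists_prime_eq_colon hav
    rcases exists_notMem_of_mul_eq_zero (h1 _ hv Q hs) hab with ⟨t, ht, h⟩ | ⟨t, ht, h⟩
    · exact ht (hQle t (by rw [h]; exact Ideal.zero_mem _))
    · refine ht (hQle t ?_)
      rw [Ideal.mem_span_singleton]
      exact ⟨t, by linear_combination -h⟩
  obtain ⟨e, he⟩ := Ideal.mem_span_singleton'.1 hav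
  have heb : e * b = 0 := by
    refine (mem_nonZeroDivisors_iff_right.1 hv) _ ?_
    linear_combination b * he + hab
  have hea : e * a = a := by linear_combination he - heb
  have hee : e * e = e := by
    have h3 : (e * e - e) * (a + b) = 0 := by linear_combination (e - 1) * he + hea
    exact sub_eq_zero.1 ((mem_nonZeroDivisors_iff_right.1 hv) _ h3)
  rcases hidem e hee with rfl | rfl
  · exact hap (by rw [← hea, zero_mul]; exact p.zero_mem)
  · refine hbq q₀ hq₀ hq₀p ?_
    have : b = 0 := by simpa using heb
    rw [this]; exact q₀.zero_mem

theorem exists_notMem_mul_mem_span_of_isIntegral [IsDomain C] {Q : Ideal C} [Q.IsPrime]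
    (A : Type*) [CommRing A] [IsDomain A] [IsIntegrallyClosed A] [Algebra C A]
    [IsLocalization.AtPrime A Q] {a v : C} (hv0 : v ≠ 0)
    (hx : IsIntegral C (algebraMap C (FractionRing C) a / algebraMap C (FractionRing C) v)) :
    ∃ t ∉ Q, t * a ∈ Ideal.span {v} := by
  have hinj : Function.Injective (algebraMap C A) :=
    IsLocalization.injective A Q.primeCompl_le_nonZeroDivisors
  have hinj' : Function.Injective ((algebraMap A (FractionRing A)).comp (algebraMap C A)) :=
    (IsFractionRing.injective A (FractionRing A)).comp hinj
  have hI := hx.map_of_comp_eq (algebraMap C A) (IsFractionRing.lift hinj') (by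
    ext c; simp)
  obtain ⟨y, hy⟩ := (isIntegrallyClosed_iff (FractionRing A)).1 inferInstance hI
  obtain ⟨⟨c, t⟩, hct⟩ := IsLocalization.surj Q.primeCompl y
  have h2 : algebraMap A (FractionRing A) (algebraMap C A a) =
      algebraMap A (FractionRing A) (y * algebraMap C A v) := by
    rw [map_mul, hy, map_div₀, IsFractionRing.lift_algebraMap, IsFractionRing.lift_algebraMap]
    rw [RingHom.comp_apply, RingHom.comp_apply, div_mul_cancel₀]
    rw [Ne, IsFractionRing.to_map_eq_zero_iff, map_eq_zero_iff _ hinj]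
    exact hv0
  have h3 := IsFractionRing.injective A (FractionRing A) h2
  have h4 : algebraMap C A (t * a) = algebraMap C A (c * v) := by
    rw [map_mul, map_mul, h3, ← hct]; ring
  exact ⟨t, t.2, Ideal.mem_span_singleton'.2 ⟨c, (hinj h4).symm⟩⟩

theorem isIntegrallyClosed_of_localization [IsNoetherianRing C] [IsDomain C]
    (h1 : ∀ v : C, v ≠ 0 → ∀ (Q : Ideal C) [Q.IsPrime],
      (∃ s, ∀ r, r ∈ Q ↔ r * s ∈ Ideal.span {v}) →
        IsIntegrallyClosed (Localization.AtPrime Q)) :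
    IsIntegrallyClosed C := by
  rw [isIntegrallyClosed_iff (FractionRing C)]
  intro x hx
  obtain ⟨a, v, hv, rfl⟩ := IsFractionRing.div_surjective (A := C) x
  have hv0 : v ≠ 0 := nonZeroDivisors.ne_zero hv
  by_cases hav : a ∈ Ideal.span {v}
  · obtain ⟨y, rfl⟩ := Ideal.mem_span_singleton'.1 hav
    refine ⟨y, ?_⟩
    rw [map_mul, mul_div_cancel_right₀]
    rwa [Ne, IsFractionRing.to_map_eq_zero_iff]
  exfalso
  obtain ⟨Q, hQ, hs, hQle⟩ := exists_prime_eq_colon hav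
  have hcl := h1 v hv0 Q hs
  have hdom : IsDomain (Localization.AtPrime Q) :=
    IsLocalization.isDomain_localization Q.primeCompl_le_nonZeroDivisors
  obtain ⟨t, ht, hta⟩ :=
    exists_notMem_mul_mem_span_of_isIntegral (Q := Q) (Localization.AtPrime Q) hv0 hx
  exact ht (hQle t hta)

theorem isIntegrallyClosed_of_isRegularLocalRing {A : Type*} [CommRing A] [IsRegularLocalRing A]
    (hdim : ringKrullDim A ≤ 1) : IsIntegrallyClosed A := by
  have := isDomain_of_isRegularLocalRing A
  by_cases hf : IsField A
  · let := hf.toField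
    infer_instance
  · have h1 : Module.finrank (ResidueField A) (CotangentSpace A) ≤ 1 := by
      have := (IsRegularLocalRing.iff_finrank_cotangentSpace A).1 inferInstance
      rw [← this] at hdim
      exact_mod_cast hdim
    have : IsPrincipalIdealRing A := by
      have h3 := ((tfae_of_isNoetherianRing_of_isLocalRing_of_isDomain A).out 5 0)
      exact h3.1 h1
    infer_instance

end Serre

section Homogeneous

open RingTheory.Sequence IsLocalRing

variable {σ K : Type*} [Field K]

theorem homogeneousComponent_mem_span {A : Type*} [CommRing A] {S : Set (MvPolynomial σ A)}
    (hS : ∀ f ∈ S, ∃ e, f.IsHomogeneous e) {f : MvPolynomial σ A} (hf : f ∈ Ideal.span S) (k : ℕ) :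
    homogeneousComponent k f ∈ Ideal.span S :=
  letI : GradedAlgebra (homogeneousSubmodule σ A) := MvPolynomial.gradedAlgebra
  homogeneousComponent_mem_of_mem (Ideal.homogeneous_span _ S hS) hf k

theorem mem_of_forall_homogeneousComponent_mem {I : Ideal (MvPolynomial σ K)}
    {f : MvPolynomial σ K} (h : ∀ k, homogeneousComponent k f ∈ I) : f ∈ I := by
  rw [← sum_homogeneousComponent f]
  exact I.sum_mem fun k _ ↦ h k

theorem constantCoeff_eq_zero_of_mem_span {S : Set (MvPolynomial σ K)}
    (hS : ∀ f ∈ S, ∃ e, 0 < e ∧ f.IsHomogeneous e) {f : MvPolynomial σ K}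
    (hf : f ∈ Ideal.span S) : constantCoeff f = 0 := by
  have : Ideal.span S ≤ RingHom.ker (constantCoeff (σ := σ) (R := K)) := by
    rw [Ideal.span_le]
    intro g hg
    obtain ⟨e, he, hge⟩ := hS g hg
    rw [SetLike.mem_coe, RingHom.mem_ker, constantCoeff_eq]
    exact hge.coeff_eq_zero (by simpa using he.ne)
  exact this hf

theorem span_ne_top_of_isHomogeneous {S : Set (MvPolynomial σ K)}
    (hS : ∀ f ∈ S, ∃ e, 0 < e ∧ f.IsHomogeneous e) : Ideal.span S ≠ ⊤ := by
  intro h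
  have : (1 : MvPolynomial σ K) ∈ Ideal.span S := h ▸ Submodule.mem_top
  simpa using constantCoeff_eq_zero_of_mem_span hS this

theorem coeff_pow_eq_zero {f : MvPolynomial σ K} (hf : constantCoeff f = 0) (m : ℕ)
    (d : σ →₀ ℕ) (hd : d.degree < m) : coeff d (f ^ m) = 0 := by
  classical
  induction m generalizing d with
  | zero => exact absurd hd (Nat.not_lt_zero _)
  | succ m ih =>
    rw [pow_succ, coeff_mul]
    refine Finset.sum_eq_zero fun x hx ↦ ?_
    rw [Finset.HasAntidiagonal.mem_antidiagonal] at hx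
    by_cases h2 : x.2 = 0
    · rw [h2, ← constantCoeff_eq, hf, mul_zero]
    · rw [ih, zero_mul]
      have : x.1.degree + x.2.degree = d.degree := by rw [← map_add, hx]
      have : x.2.degree ≠ 0 := by rwa [Ne, Finsupp.degree_eq_zero_iff]
      omega

theorem mem_span_of_sq_sub_mem_span {S : Set (MvPolynomial σ K)}
    (hS : ∀ f ∈ S, ∃ e, 0 < e ∧ f.IsHomogeneous e) {f : MvPolynomial σ K}
    (hf : f * f - f ∈ Ideal.span S) (h0 : constantCoeff f = 0) : f ∈ Ideal.span S := by
  have hpow : ∀ k : ℕ, f ^ (k + 1) - f ∈ Ideal.span S := by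
    intro k
    induction k with
    | zero => simp
    | succ k ih =>
      have : f ^ (k + 1 + 1) - f = f * (f ^ (k + 1) - f) + (f * f - f) := by ring
      rw [this]
      exact Ideal.add_mem _ (Ideal.mul_mem_left _ _ ih) hf
  refine mem_of_forall_homogeneousComponent_mem fun k ↦ ?_
  have h1 := homogeneousComponent_mem_span (fun g hg ↦ (hS g hg).imp fun _ h ↦ h.2) (hpow k) k
  have h2 : homogeneousComponent k (f ^ (k + 1)) = 0 := by
    ext d
    rw [coeff_homogeneousComponent, coeff_zero]
    split_ifs with hd
    · exact coeff_pow_eq_zero h0 _ _ (by omega)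
    · rfl
  rw [map_sub, h2, zero_sub] at h1
  exact neg_mem_iff.1 h1

theorem eq_zero_or_one_of_mul_self_eq {S : Set (MvPolynomial σ K)}
    (hS : ∀ f ∈ S, ∃ e, 0 < e ∧ f.IsHomogeneous e) (e : MvPolynomial σ K ⧸ Ideal.span S)
    (he : e * e = e) : e = 0 ∨ e = 1 := by
  obtain ⟨f, rfl⟩ := Ideal.Quotient.mk_surjective e
  have hf : f * f - f ∈ Ideal.span S := by
    rw [← Ideal.Quotient.eq_zero_iff_mem, map_sub, map_mul, he, sub_self]
  have h0 := constantCoeff_eq_zero_of_mem_span hS hf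
  rw [map_sub, map_mul] at h0
  have h1 : constantCoeff f * (constantCoeff f - 1) = 0 := by linear_combination h0
  rcases mul_eq_zero.1 h1 with h | h
  · left
    rw [Ideal.Quotient.eq_zero_iff_mem]
    exact mem_span_of_sq_sub_mem_span hS hf h
  · right
    have h2 : 1 - f ∈ Ideal.span S := by
      refine mem_span_of_sq_sub_mem_span hS ?_ ?_
      · convert hf using 1; ring
      · rw [map_sub, map_one]; linear_combination -h
    rw [← Ideal.Quotient.eq_zero_iff_mem, map_sub, map_one] at h2
    exact (sub_eq_zero.1 h2).symm

end Homogeneous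

section ChainTheorem

open RingTheory.Sequence IsLocalRing

variable {K : Type*} [Field K] {N : ℕ}

theorem ofList_ofFn {A : Type*} [CommRing A] {n : ℕ} (g : Fin n → A) :
    Ideal.ofList (List.ofFn g) = Ideal.span (Set.range g) := by
  apply congrArg Ideal.span
  ext r
  simp [List.mem_ofFn]

theorem isDomain_and_isIntegrallyClosed_of_jacobianFullRank {n : ℕ}
    {g : Fin n → MvPolynomial (Fin N) K} (hg : ∀ i, ∃ e, 0 < e ∧ (g i).IsHomogeneous e)
    (hJ : ∀ (P : Ideal (MvPolynomial (Fin N) K)) [P.IsPrime], P.height ≤ (n + 1 : ℕ) →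
      JacobianFullRank g P)
    (hreg : IsWeaklyRegular (MvPolynomial (Fin N) K) (List.ofFn g)) :
    ∃ _ : IsDomain (MvPolynomial (Fin N) K ⧸ Ideal.span (Set.range g)),
      IsIntegrallyClosed (MvPolynomial (Fin N) K ⧸ Ideal.span (Set.range g)) := by
  set I := Ideal.span (Set.range g) with hI
  have hS : ∀ f ∈ Set.range g, ∃ e, 0 < e ∧ f.IsHomogeneous e := by
    rintro _ ⟨i, rfl⟩; exact hg i
  have hnt : Nontrivial (MvPolynomial (Fin N) K ⧸ I) :=
    Ideal.Quotient.nontrivial_iff.2 (span_ne_top_of_isHomogeneous hS)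
  have h0 : ∀ (P : Ideal (MvPolynomial (Fin N) K ⧸ I)) [P.IsPrime],
      (∃ s, ∀ r, r ∈ P ↔ r * s = 0) → (P.comap (Ideal.Quotient.mk I)).height ≤ n := by
    rintro P hP ⟨s, hs⟩
    obtain ⟨s, rfl⟩ := Ideal.Quotient.mk_surjective s
    have := height_le_length_of_isWeaklyRegular _ hreg (P.comap (Ideal.Quotient.mk I)) s (by
      intro r
      rw [Ideal.mem_comap, hs, ← map_mul, Ideal.Quotient.eq_zero_iff_mem, ofList_ofFn])
    simpa using this
  have h1 : ∀ v ∈ nonZeroDivisors (MvPolynomial (Fin N) K ⧸ I),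
      ∀ (P : Ideal (MvPolynomial (Fin N) K ⧸ I)) [P.IsPrime],
      (∃ s, ∀ r, r ∈ P ↔ r * s ∈ Ideal.span {v}) →
        (P.comap (Ideal.Quotient.mk I)).height ≤ (n + 1 : ℕ) := by
    rintro v hv P hP ⟨s, hs⟩
    obtain ⟨s, rfl⟩ := Ideal.Quotient.mk_surjective s
    obtain ⟨v, rfl⟩ := Ideal.Quotient.mk_surjective v
    have hof : Ideal.ofList (List.ofFn g ++ [v]) = I ⊔ Ideal.span {v} := by
      rw [Ideal.ofList_append, ofList_ofFn, Ideal.ofList_singleton]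
    have hreg' : IsWeaklyRegular (MvPolynomial (Fin N) K) (List.ofFn g ++ [v]) := by
      rw [isWeaklyRegular_append_iff]
      refine ⟨hreg, (isWeaklyRegular_singleton_iff _ _).2 ?_⟩
      rw [isSMulRegular_quotient_iff_mem_of_smul_mem]
      intro x hx
      rw [smul_eq_mul, Ideal.mul_top, ofList_ofFn, smul_eq_mul] at hx
      rw [smul_eq_mul, Ideal.mul_top, ofList_ofFn]
      rw [← Ideal.Quotient.eq_zero_iff_mem] at hx ⊢
      rw [map_mul] at hx
      exact (mem_nonZeroDivisors_iff.1 hv).1 _ hx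
    have := height_le_length_of_isWeaklyRegular _ hreg' (P.comap (Ideal.Quotient.mk I)) s (by
      intro r
      rw [Ideal.mem_comap, hs, ← map_mul, hof, ← Set.image_singleton, ← Ideal.map_span,
        Ideal.mem_quotient_iff_mem_sup, sup_comm])
    simpa using this
  have hle : ((n : ℕ) : ℕ∞) ≤ (n + 1 : ℕ) := by exact_mod_cast n.le_succ
  have hdom : IsDomain (MvPolynomial (Fin N) K ⧸ I) := by
    refine isDomain_of_isDomain_localization (eq_zero_or_one_of_mul_self_eq hS) ?_ ?_
    · intro P hP hs
      have := (JacobianFullRank.isRegularLocalRing P (hJ _ ((h0 P hs).trans hle))).1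
      exact isDomain_of_isRegularLocalRing _
    · intro v hv P hP hs
      have := (JacobianFullRank.isRegularLocalRing P (hJ _ (h1 v hv P hs))).1
      exact isDomain_of_isRegularLocalRing _
  refine ⟨hdom, isIntegrallyClosed_of_localization fun v hv P hP hs ↦ ?_⟩
  have hht := h1 v (mem_nonZeroDivisors_of_ne_zero hv) P hs
  obtain ⟨hr, hd⟩ := JacobianFullRank.isRegularLocalRing P (hJ _ hht)
  refine isIntegrallyClosed_of_isRegularLocalRing ?_
  obtain ⟨m, hm⟩ := exists_natCast_ringKrullDim_eq (A := Localization.AtPrime P)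
  rw [hm] at hd ⊢
  have h2 : ((m : WithBot ℕ∞) + n) ≤ ((n + 1 : ℕ) : ℕ∞) := by
    rw [hd]; exact_mod_cast hht
  have h3 : m + n ≤ n + 1 := by exact_mod_cast h2
  have : m ≤ 1 := by omega
  exact_mod_cast this

theorem JacobianFullRank.castLE {n m : ℕ} (h : m ≤ n) {g : Fin n → MvPolynomial (Fin N) K}
    {P : Ideal (MvPolynomial (Fin N) K)} (hJ : JacobianFullRank g P) :
    JacobianFullRank (fun j : Fin m ↦ g (Fin.castLE h j)) P := by
  classical
  intro u hu j
  have key : ∀ (F : Fin n → MvPolynomial (Fin N) K),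
      ∑ i : Fin n, (if hi : (i : ℕ) < m then u ⟨i, hi⟩ else 0) * F i =
        ∑ j : Fin m, u j * F (Fin.castLE h j) := by
    intro F
    symm
    refine Finset.sum_of_injOn (Fin.castLE h) (Fin.castLE_injective h).injOn
      (fun _ _ ↦ Finset.mem_coe.2 (Finset.mem_univ _)) ?_ ?_
    · intro i _ hi
      rw [dif_neg, zero_mul]
      intro him
      exact hi ⟨⟨i, him⟩, by simp⟩
    · intro j _
      simp
  have := hJ (fun i ↦ if hi : (i : ℕ) < m then u ⟨i, hi⟩ else 0) (fun l ↦ by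
    rw [key (fun i ↦ pderiv l (g i))]
    exact hu l) (Fin.castLE h j)
  simpa using this

theorem notMem_span_of_jacobianFullRank {n : ℕ} {g : Fin (n + 1) → MvPolynomial (Fin N) K}
    {P : Ideal (MvPolynomial (Fin N) K)} [hP : P.IsPrime]
    (hPg : Ideal.span (Set.range fun j : Fin n ↦ g j.castSucc) ≤ P)
    (hJ : JacobianFullRank g P) :
    g (Fin.last n) ∉ Ideal.span (Set.range fun j : Fin n ↦ g j.castSucc) := by
  intro hmem
  obtain ⟨c, hc⟩ := Ideal.mem_span_range_iff_exists_fun.1 hmem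
  have h1 : ∀ j : Fin n, g j.castSucc ∈ P := fun j ↦ hPg (Ideal.subset_span ⟨j, rfl⟩)
  have h2 := hJ (Fin.snoc (fun j ↦ -c j) 1) (fun l ↦ by
    rw [Fin.sum_univ_castSucc]
    simp only [Fin.snoc_castSucc, Fin.snoc_last]
    rw [one_mul, ← hc, map_sum, ← Finset.sum_add_distrib]
    refine P.sum_mem fun j _ ↦ ?_
    rw [Derivation.leibniz, smul_eq_mul, smul_eq_mul]
    have : -c j * pderiv l (g j.castSucc) +
        (c j * pderiv l (g j.castSucc) + g j.castSucc * pderiv l (c j)) =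
        g j.castSucc * pderiv l (c j) := by ring
    rw [this]
    exact P.mul_mem_right _ (h1 j)) (Fin.last n)
  rw [Fin.snoc_last] at h2
  exact hP.ne_top (P.eq_top_of_isUnit_mem h2 isUnit_one)

theorem isPrime_and_isWeaklyRegular_of_jacobianFullRank {n : ℕ}
    {g : Fin n → MvPolynomial (Fin N) K} (hg : ∀ i, ∃ e, 0 < e ∧ (g i).IsHomogeneous e)
    (hJ : ∀ (P : Ideal (MvPolynomial (Fin N) K)) [P.IsPrime], P.height ≤ (n + 1 : ℕ) →
      JacobianFullRank g P) :
    (Ideal.span (Set.range g)).IsPrime ∧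
      IsIntegrallyClosed (MvPolynomial (Fin N) K ⧸ Ideal.span (Set.range g)) ∧
      IsWeaklyRegular (MvPolynomial (Fin N) K) (List.ofFn g) := by
  suffices h : IsWeaklyRegular (MvPolynomial (Fin N) K) (List.ofFn g) by
    obtain ⟨h1, h2⟩ := isDomain_and_isIntegrallyClosed_of_jacobianFullRank hg hJ h
    exact ⟨(Ideal.Quotient.isDomain_iff_prime _).1 h1, h2, h⟩
  induction n with
  | zero => simp
  | succ n ih =>
    have hJ' : ∀ (P : Ideal (MvPolynomial (Fin N) K)) [P.IsPrime], P.height ≤ (n + 1 : ℕ) →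
        JacobianFullRank (fun j : Fin n ↦ g j.castSucc) P := fun P _ hP ↦
      (hJ P (hP.trans (by exact_mod_cast (n + 1).le_succ))).castLE n.le_succ
    have hreg := ih (fun i ↦ hg i.castSucc) hJ'
    have hprime : (Ideal.span (Set.range fun j : Fin n ↦ g j.castSucc)).IsPrime :=
      (Ideal.Quotient.isDomain_iff_prime _).1
        (isDomain_and_isIntegrallyClosed_of_jacobianFullRank (fun i ↦ hg i.castSucc) hJ' hreg).1
    have hht : (Ideal.span (Set.range fun j : Fin n ↦ g j.castSucc)).height ≤ n := by
      refine (Ideal.height_le_spanFinrank _ hprime.ne_top).trans ?_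
      have h1 := Submodule.spanFinrank_span_le_ncard_of_finite (R := MvPolynomial (Fin N) K)
        (Set.finite_range fun j : Fin n ↦ g j.castSucc)
      have h2 : (Set.range fun j : Fin n ↦ g j.castSucc).ncard ≤ n := by
        rw [← Set.image_univ]
        refine (Set.ncard_image_le Set.finite_univ).trans ?_
        simp
      exact_mod_cast h1.trans h2
    have hnot := notMem_span_of_jacobianFullRank le_rfl
      (hJ _ (hht.trans (by exact_mod_cast (by omega : n ≤ n + 1 + 1))))
    rw [List.ofFn_succ', List.concat_eq_append, isWeaklyRegular_append_iff]
    refine ⟨hreg, (isWeaklyRegular_singleton_iff _ _).2 ?_⟩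
    rw [isSMulRegular_quotient_iff_mem_of_smul_mem]
    intro x hx
    rw [smul_eq_mul, Ideal.mul_top, ofList_ofFn, smul_eq_mul] at hx
    rw [smul_eq_mul, Ideal.mul_top, ofList_ofFn]
    exact (hprime.mem_or_mem hx).resolve_left hnot

end ChainTheorem

section PthRoot

variable {L : Type*} [Field L] (p : ℕ) [hp : Fact p.Prime] [CharP L p]

theorem minpoly_eq_X_pow_sub_C {M : Subfield L} (hM : ∀ x : L, x ^ p ∈ M) {y : L} (hy : y ∉ M) :
    minpoly M y = Polynomial.X ^ p - Polynomial.C ⟨y ^ p, hM y⟩ := by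
  symm
  refine minpoly.eq_of_irreducible_of_monic ?_ ?_ ?_
  · refine X_pow_sub_C_irreducible_of_prime hp.out fun b hb ↦ hy ?_
    have h1 : (b : L) ^ p = y ^ p := congrArg Subtype.val hb
    have h2 : (b : L) = y := frobenius_inj L p (by simpa [frobenius_def] using h1)
    exact h2 ▸ b.2
  · rw [map_sub, map_pow, Polynomial.aeval_X, Polynomial.aeval_C]
    exact sub_self _
  · exact Polynomial.monic_X_pow_sub_C _ hp.out.ne_zero

theorem finrank_adjoin_eq {M : Subfield L} (hM : ∀ x : L, x ^ p ∈ M) {y : L} (hy : y ∉ M) :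
    IsIntegral M y ∧ Module.finrank M (IntermediateField.adjoin M {y}) = p := by
  have hyint : IsIntegral M y := by
    refine ⟨Polynomial.X ^ p - Polynomial.C ⟨y ^ p, hM y⟩,
      Polynomial.monic_X_pow_sub_C _ hp.out.ne_zero, ?_⟩
    rw [Polynomial.eval₂_sub, Polynomial.eval₂_pow, Polynomial.eval₂_X, Polynomial.eval₂_C]
    exact sub_self _
  refine ⟨hyint, ?_⟩
  rw [IntermediateField.adjoin.finrank hyint, minpoly_eq_X_pow_sub_C p hM hy,
    Polynomial.natDegree_X_pow_sub_C]

theorem exists_subfield_aeval_surjective {a : L} (ha : ∀ b : L, b ^ p ≠ a) :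
    ∃ M : Subfield L, (∀ x : L, x ^ p ∈ M) ∧ a ∉ M ∧
      Function.Surjective (Polynomial.aeval (R := M) a) := by
  obtain ⟨M, -, hM⟩ := zorn_le_nonempty₀ {T : Subfield L | (∀ x : L, x ^ p ∈ T) ∧ a ∉ T} (by
    intro c hc hchain y hy
    refine ⟨sSup c, ⟨fun x ↦ ?_, fun hac ↦ ?_⟩, fun z hz ↦ le_sSup hz⟩
    · exact (le_sSup hy : y ≤ sSup c) ((hc hy).1 x)
    · obtain ⟨T, hT, haT⟩ := (Subfield.mem_sSup_of_directedOn ⟨y, hy⟩ hchain.directedOn).1 hac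
      exact (hc hT).2 haT) (frobenius L p).fieldRange
    ⟨fun x ↦ ⟨x, rfl⟩, fun ⟨b, hb⟩ ↦ ha b hb⟩
  obtain ⟨hMp, haM⟩ := hM.prop
  refine ⟨M, hMp, haM, fun y ↦ ?_⟩
  have hya : y ∈ IntermediateField.adjoin M {a} := by
    by_cases hy : y ∈ M
    · exact IntermediateField.algebraMap_mem _ (⟨y, hy⟩ : M)
    have hay : a ∈ IntermediateField.adjoin M {y} := by
      by_contra hay
      have hle : M ≤ (IntermediateField.adjoin M {y}).toSubfield := fun x hx ↦
        IntermediateField.algebraMap_mem (IntermediateField.adjoin M {y}) (⟨x, hx⟩ : M)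
      have := hM.le_of_ge (y := (IntermediateField.adjoin M {y}).toSubfield)
        ⟨fun x ↦ hle (hMp x), hay⟩ hle
      exact hy (this (IntermediateField.mem_adjoin_simple_self M y))
    have h1 := finrank_adjoin_eq p hMp hy
    have h2 := finrank_adjoin_eq p hMp haM
    have := IntermediateField.adjoin.finiteDimensional h1.1
    have heq : IntermediateField.adjoin M {a} = IntermediateField.adjoin M {y} :=
      IntermediateField.eq_of_le_of_finrank_eq
        (IntermediateField.adjoin_simple_le_iff.2 hay) (h2.2.trans h1.2.symm)
    rw [heq]
    exact IntermediateField.mem_adjoin_simple_self M y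
  rw [← IntermediateField.mem_toSubalgebra,
    IntermediateField.adjoin_simple_toSubalgebra_of_isAlgebraic
      (finrank_adjoin_eq p hMp haM).1.isAlgebraic, Algebra.adjoin_singleton_eq_range_aeval] at hya
  exact hya

theorem exists_derivation_ne_zero {a : L} (ha : ∀ b : L, b ^ p ≠ a) :
    ∃ D : L →+ L, (∀ x y, D (x * y) = x * D y + y * D x) ∧ D a ≠ 0 := by
  obtain ⟨M, hMp, haM, hsurj⟩ := exists_subfield_aeval_surjective p ha
  have hMc : CharP M p := (algebraMap M L).charP (algebraMap M L).injective p
  have hker : ∀ q q' : Polynomial M, Polynomial.aeval a q = Polynomial.aeval a q' →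
      Polynomial.aeval a (Polynomial.derivative q) =
        Polynomial.aeval a (Polynomial.derivative q') := by
    intro q q' h
    rw [← sub_eq_zero, ← map_sub] at h
    obtain ⟨r, hr⟩ := minpoly.dvd M a h
    rw [← sub_eq_zero, ← map_sub, ← map_sub, hr, Polynomial.derivative_mul, map_add, map_mul,
      map_mul, minpoly.aeval, zero_mul, add_zero, minpoly_eq_X_pow_sub_C p hMp haM,
      Polynomial.derivative_sub, Polynomial.derivative_X_pow, CharP.cast_eq_zero]
    simp
  choose q hq using hsurj
  refine ⟨AddMonoidHom.mk' (fun y ↦ Polynomial.aeval a (Polynomial.derivative (q y))) ?_, ?_, ?_⟩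
  · intro x y
    rw [← map_add, ← map_add]
    exact hker _ _ (by rw [map_add, hq, hq, hq])
  · intro x y
    change Polynomial.aeval a (Polynomial.derivative (q (x * y))) =
      x * Polynomial.aeval a (Polynomial.derivative (q y)) +
      y * Polynomial.aeval a (Polynomial.derivative (q x))
    rw [hker (q (x * y)) (q x * q y) (by rw [map_mul, hq, hq, hq]), Polynomial.derivative_mul,
      map_add, map_mul, map_mul, hq, hq]
    ring
  · change Polynomial.aeval a (Polynomial.derivative (q a)) ≠ 0
    rw [hker (q a) Polynomial.X (by rw [hq, Polynomial.aeval_X])]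
    simp

end PthRoot

section Frobenius

variable {K : Type*} [Field K] [IsAlgClosed K] {N : ℕ}

theorem exists_pow_eq_of_pderiv_eq_zero (p : ℕ) [hp : Fact p.Prime] [CharP K p] {L : Type*}
    [Field L] [CharP L p] (φ : MvPolynomial (Fin N) K →+* L) {F : MvPolynomial (Fin N) K}
    (hF : ∀ l, φ (pderiv l F) = 0) : ∃ b : L, b ^ p = φ F := by
  by_contra! h
  obtain ⟨D, hD, hne⟩ := exists_derivation_ne_zero p h
  have hD1 : D 1 = 0 := by simpa using hD 1 1
  have hpow : ∀ (x : L) (n : ℕ), D (x ^ n) = n * x ^ (n - 1) * D x := by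
    intro x n
    induction n with
    | zero => simp [hD1]
    | succ n ih =>
      rw [pow_succ, hD, ih]
      rcases n with _ | n
      · simp
      · push_cast
        ring
  refine hne ?_
  have key : ∀ f : MvPolynomial (Fin N) K, D (φ f) = ∑ l, φ (pderiv l f) * D (φ (X l)) := by
    intro f
    induction f using MvPolynomial.induction_on with
    | C c =>
      obtain ⟨b, rfl⟩ := IsAlgClosed.exists_pow_nat_eq c hp.out.pos
      rw [map_pow, map_pow, hpow]
      simp
    | add f g hf hg =>
      simp only [map_add, hf, hg, add_mul, Finset.sum_add_distrib]
    | mul_X f i hf =>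
      rw [map_mul, hD, hf]
      simp only [Derivation.leibniz, smul_eq_mul, map_add, map_mul, add_mul,
        Finset.sum_add_distrib, pderiv_X, Pi.single_apply]
      rw [Finset.mul_sum]
      congr 1
      · simp
      · exact Finset.sum_congr rfl fun l _ ↦ by ring
  rw [key]
  simp [hF]

theorem exists_mem_sup_span_of_pderiv_mem {I : Ideal (MvPolynomial (Fin N) K)} [hI : I.IsPrime]
    (hhom : ∀ f ∈ I, ∀ k, homogeneousComponent k f ∈ I)
    (hcl : IsIntegrallyClosed (MvPolynomial (Fin N) K ⧸ I)) {F : MvPolynomial (Fin N) K} {e : ℕ}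
    (he : 2 ≤ e) (hF : F.IsHomogeneous e) (hd : ∀ l, pderiv l F ∈ I) :
    ∃ (G : MvPolynomial (Fin N) K) (e' : ℕ), 0 < e' ∧ e' < e ∧ G.IsHomogeneous e' ∧
      F ∈ I ⊔ Ideal.span {G} := by
  by_cases he0 : (e : K) ≠ 0
  · refine ⟨0, 1, one_pos, by omega, isHomogeneous_zero _ _ _, Ideal.mem_sup_left ?_⟩
    have h1 : e • F ∈ I := by
      rw [← hF.sum_X_mul_pderiv]
      exact I.sum_mem fun l _ ↦ I.mul_mem_left _ (hd l)
    have h2 : F = C (e : K)⁻¹ * (e • F) := by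
      rw [nsmul_eq_mul, ← mul_assoc, ← C_eq_coe_nat, ← C_mul, inv_mul_cancel₀ he0, C_1, one_mul]
    rw [h2]
    exact I.mul_mem_left _ h1
  push Not at he0
  obtain ⟨p, hpc⟩ := CharP.exists K
  have hpe : p ∣ e := (CharP.cast_eq_zero_iff K p e).1 he0
  have hp : p.Prime := by
    rcases CharP.char_is_prime_or_zero K p with h | h
    · exact h
    · rw [h, zero_dvd_iff] at hpe; omega
  have := Fact.mk hp
  have hinj : Function.Injective (algebraMap K (MvPolynomial (Fin N) K ⧸ I)) :=
    (algebraMap K (MvPolynomial (Fin N) K ⧸ I)).injective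
  have hCp : CharP (MvPolynomial (Fin N) K ⧸ I) p := charP_of_injective_ringHom hinj p
  have hLp : CharP (FractionRing (MvPolynomial (Fin N) K ⧸ I)) p :=
    charP_of_injective_ringHom (IsFractionRing.injective (MvPolynomial (Fin N) K ⧸ I)
      (FractionRing (MvPolynomial (Fin N) K ⧸ I))) p
  obtain ⟨b, hb⟩ := exists_pow_eq_of_pderiv_eq_zero p
    ((algebraMap (MvPolynomial (Fin N) K ⧸ I) (FractionRing (MvPolynomial (Fin N) K ⧸ I))).comp
      (Ideal.Quotient.mk I)) (F := F) (fun l ↦ by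
        rw [RingHom.comp_apply, Ideal.Quotient.eq_zero_iff_mem.2 (hd l), map_zero])
  obtain ⟨w, hw⟩ := IsIntegrallyClosed.exists_algebraMap_eq_of_isIntegral_pow
    (R := MvPolynomial (Fin N) K ⧸ I) hp.pos (x := b) (by
      rw [hb]; exact isIntegral_algebraMap)
  obtain ⟨f, rfl⟩ := Ideal.Quotient.mk_surjective w
  have hfI : f ^ p - F ∈ I := by
    rw [← Ideal.Quotient.eq_zero_iff_mem, map_sub, map_pow, sub_eq_zero]
    apply IsFractionRing.injective (MvPolynomial (Fin N) K ⧸ I)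
      (FractionRing (MvPolynomial (Fin N) K ⧸ I))
    rw [map_pow, hw, hb]; rfl
  obtain ⟨m, rfl⟩ := hpe
  have hm : 0 < m := Nat.pos_of_ne_zero (by rintro rfl; omega)
  refine ⟨homogeneousComponent m f, m, hm, ?_, homogeneousComponent_isHomogeneous _ _, ?_⟩
  · nlinarith [hp.two_le]
  have hcomp : homogeneousComponent (p * m) (f ^ p) = homogeneousComponent m f ^ p := by
    conv_lhs => rw [← sum_homogeneousComponent f, sum_pow_char p, map_sum]
    have h1 : ∀ i, homogeneousComponent (p * m) (homogeneousComponent i f ^ p) =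
        if i = m then homogeneousComponent m f ^ p else 0 := by
      intro i
      rw [homogeneousComponent_of_mem (((homogeneousComponent_isHomogeneous i f).pow p))]
      by_cases him : i = m
      · subst him; simp [mul_comm]
      · rw [if_neg, if_neg him]
        exact fun h ↦ him (Nat.eq_of_mul_eq_mul_right hp.pos (h.symm.trans (mul_comm p m)))
    simp only [h1, Finset.sum_ite_eq', Finset.mem_range]
    split_ifs with hlt
    · rfl
    · rw [homogeneousComponent_eq_zero _ _ (by omega), zero_pow hp.ne_zero]
  have h2 := hhom _ hfI (p * m)
  rw [map_sub, hcomp, homogeneousComponent_eq_self hF] at h2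
  have h3 : F = -(homogeneousComponent m f ^ p - F) + homogeneousComponent m f ^ p := by ring
  rw [h3]
  refine Ideal.add_mem _ (Ideal.mem_sup_left (I.neg_mem h2)) (Ideal.mem_sup_right ?_)
  exact Ideal.pow_mem_of_mem _ (Ideal.mem_span_singleton_self _) _ hp.pos

end Frobenius

section BaseChange

variable {K A : Type*} [Field K] [CommRing A] [Algebra K A] {N : ℕ}

/-- Apply a linear functional to all coefficients of a polynomial. -/
noncomputable def coeffMap (φ : A →ₗ[K] K) (u : MvPolynomial (Fin N) A) : MvPolynomial (Fin N) K :=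
  ∑ m ∈ u.support, monomial m (φ (coeff m u))

theorem coeff_coeffMap (φ : A →ₗ[K] K) (u : MvPolynomial (Fin N) A) (m : Fin N →₀ ℕ) :
    coeff m (coeffMap φ u) = φ (coeff m u) := by
  classical
  rw [coeffMap, coeff_sum]
  simp only [coeff_monomial, Finset.sum_ite_eq', mem_support_iff]
  split_ifs with h
  · rfl
  · rw [not_not.1 h, map_zero]

theorem aeval_coeffMap (φ : A →ₗ[K] K) (u : MvPolynomial (Fin N) A) (z : Fin N → K) :
    aeval z (coeffMap φ u) = φ (eval (fun i ↦ algebraMap K A (z i)) u) := by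
  rw [coeffMap, map_sum, eval_eq, map_sum]
  refine Finset.sum_congr rfl fun m _ ↦ ?_
  rw [aeval_monomial, Finsupp.prod_fintype _ _ (by simp), Algebra.algebraMap_self, RingHom.id_apply,
    ← Finset.prod_subset (Finset.subset_univ m.support) (by
      intro i _ hi; rw [Finsupp.notMem_support_iff.1 hi, pow_zero])]
  simp_rw [← map_pow, ← map_prod]
  rw [mul_comm (coeff m u), ← Algebra.smul_def, map_smul, smul_eq_mul, mul_comm]

theorem mem_map_of_forall_coeffMap_mem {I : Ideal (MvPolynomial (Fin N) K)}
    {u : MvPolynomial (Fin N) A} (h : ∀ φ : A →ₗ[K] K, coeffMap φ u ∈ I) :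
    u ∈ I.map (map (algebraMap K A)) := by
  classical
  let b := Module.Basis.ofVectorSpace K A
  set T := u.support.biUnion fun m ↦ (b.repr (coeff m u)).support with hT
  have hu : u = ∑ β ∈ T, C (b β) * map (algebraMap K A) (coeffMap (b.coord β) u) := by
    ext m
    rw [coeff_sum]
    simp only [coeff_C_mul, coeff_map, coeff_coeffMap, Module.Basis.coord_apply]
    conv_lhs => rw [← b.linearCombination_repr (coeff m u)]
    rw [Finsupp.linearCombination_apply, Finsupp.sum]
    simp only [mul_comm (b _), ← Algebra.smul_def]
    refine Finset.sum_subset ?_ ?_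
    · by_cases hm : m ∈ u.support
      · exact Finset.subset_biUnion_of_mem (fun m ↦ (b.repr (coeff m u)).support) hm
      · rw [notMem_support_iff.1 hm]; simp
    · intro β _ hβ
      rw [Finsupp.notMem_support_iff.1 hβ, zero_smul]
  rw [hu]
  exact Ideal.sum_mem _ fun β _ ↦ Ideal.mul_mem_left _ _ (Ideal.mem_map_of_mem _ (h _))

theorem eval_eq_zero_of_mem_map {I : Ideal (MvPolynomial (Fin N) K)}
    {u : MvPolynomial (Fin N) A} (hu : u ∈ I.map (map (algebraMap K A))) {z : Fin N → K}
    (hz : z ∈ zeroLocus K I) : eval (fun i ↦ algebraMap K A (z i)) u = 0 := by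
  have : I.map (map (algebraMap K A)) ≤
      RingHom.ker (eval fun i ↦ algebraMap K A (z i)) := by
    rw [Ideal.map_le_iff_le_comap]
    intro f hf
    rw [Ideal.mem_comap, RingHom.mem_ker, eval_map, ← aeval_def]
    change aeval (algebraMap K A ∘ z) f = 0
    rw [aeval_algebraMap_apply, hz f hf, map_zero]
  exact this hu

variable [IsAlgClosed K]

theorem exists_aeval_ne_zero {I : Ideal (MvPolynomial (Fin N) K)} [I.IsPrime]
    {f : MvPolynomial (Fin N) K} (hf : f ∉ I) : ∃ z ∈ zeroLocus K I, aeval z f ≠ 0 := by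
  rw [← IsPrime.vanishingIdeal_zeroLocus (K := K) I, mem_vanishingIdeal_iff] at hf
  push Not at hf
  exact hf

theorem mem_of_map_mem_map [Nontrivial A] {I : Ideal (MvPolynomial (Fin N) K)} [I.IsPrime]
    {f : MvPolynomial (Fin N) K} (hf : map (algebraMap K A) f ∈ I.map (map (algebraMap K A))) :
    f ∈ I := by
  by_contra hfI
  obtain ⟨z, hz, hne⟩ := exists_aeval_ne_zero hfI
  have h := eval_eq_zero_of_mem_map hf hz
  rw [eval_map, ← aeval_def] at h
  change aeval (algebraMap K A ∘ z) f = 0 at h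
  rw [aeval_algebraMap_apply] at h
  exact hne ((map_eq_zero_iff _ (algebraMap K A).injective).1 h)

theorem isPrime_map [IsDomain A] (I : Ideal (MvPolynomial (Fin N) K)) [hI : I.IsPrime] :
    (I.map (map (algebraMap K A))).IsPrime := by
  refine ⟨fun h ↦ ?_, fun {u v} huv ↦ ?_⟩
  · refine hI.ne_top (I.eq_top_of_isUnit_mem (mem_of_map_mem_map (A := A) ?_) isUnit_one)
    rw [h]; trivial
  · by_contra! hne
    obtain ⟨hu, hv⟩ := hne
    obtain ⟨φ, hφ⟩ := not_forall.1 (mt mem_map_of_forall_coeffMap_mem hu)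
    obtain ⟨ψ, hψ⟩ := not_forall.1 (mt mem_map_of_forall_coeffMap_mem hv)
    obtain ⟨z, hz, hne⟩ := exists_aeval_ne_zero (mt hI.mem_or_mem (not_or.2 ⟨hφ, hψ⟩))
    rw [map_mul, aeval_coeffMap, aeval_coeffMap] at hne
    have h0 := eval_eq_zero_of_mem_map huv hz
    rw [map_mul] at h0
    rcases mul_eq_zero.1 h0 with h | h
    · rw [h, map_zero, zero_mul] at hne; exact hne rfl
    · rw [h, map_zero, mul_zero] at hne; exact hne rfl

end BaseChange

section LeadingForm

variable {σ A : Type*} [CommRing A]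

theorem eq_sum_homogeneousComponent {f : MvPolynomial σ A} {m : ℕ} (hf : f.totalDegree ≤ m) :
    f = ∑ i ∈ Finset.range (m + 1), homogeneousComponent i f := by
  conv_lhs => rw [← sum_homogeneousComponent f]
  refine Finset.sum_subset (Finset.range_mono (by omega)) fun i _ hi ↦ ?_
  exact homogeneousComponent_eq_zero _ _ (by simpa using hi)

theorem homogeneousComponent_mul_add {f g : MvPolynomial σ A} {m n : ℕ} (hf : f.totalDegree ≤ m)
    (hg : g.totalDegree ≤ n) : homogeneousComponent (m + n) (f * g) =
      homogeneousComponent m f * homogeneousComponent n g := by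
  conv_lhs => rw [eq_sum_homogeneousComponent hf, eq_sum_homogeneousComponent hg]
  rw [Finset.sum_mul_sum, map_sum]
  have h1 : ∀ i j, homogeneousComponent (m + n)
      (homogeneousComponent i f * homogeneousComponent j g) =
      if m + n = i + j then homogeneousComponent i f * homogeneousComponent j g else 0 := by
    intro i j
    rw [homogeneousComponent_of_mem ((homogeneousComponent_isHomogeneous i f).mul
      (homogeneousComponent_isHomogeneous j g))]
  simp only [map_sum, h1]
  rw [Finset.sum_eq_single m, Finset.sum_eq_single n]
  · simp
  · intro j _ hj; rw [if_neg (by omega)]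
  · simp
  · intro i hi him
    refine Finset.sum_eq_zero fun j hj ↦ ?_
    rw [Finset.mem_range] at hi hj
    rw [if_neg (by omega)]
  · simp

theorem homogeneousComponent_mul_of_isHomogeneous (f : MvPolynomial σ A) {g : MvPolynomial σ A}
    {e : ℕ} (hg : g.IsHomogeneous e) (m : ℕ) : homogeneousComponent m (f * g) =
      if e ≤ m then homogeneousComponent (m - e) f * g else 0 := by
  conv_lhs => rw [← sum_homogeneousComponent f]
  rw [Finset.sum_mul, map_sum]
  have h1 : ∀ i, homogeneousComponent m (homogeneousComponent i f * g) =
      if m = i + e then homogeneousComponent i f * g else 0 := by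
    intro i
    rw [homogeneousComponent_of_mem ((homogeneousComponent_isHomogeneous i f).mul hg)]
  simp only [h1]
  split_ifs with h
  · rw [Finset.sum_eq_single (m - e), if_pos (by omega)]
    · intro i _ hi; rw [if_neg (by omega)]
    · intro hi
      rw [homogeneousComponent_eq_zero, zero_mul, ite_self]
      rw [Finset.mem_range, not_lt] at hi
      omega
  · exact Finset.sum_eq_zero fun i _ ↦ if_neg (by omega)

theorem homogeneousComponent_map {B : Type*} [CommRing B] (φ : A →+* B) (f : MvPolynomial σ A)
    (m : ℕ) : homogeneousComponent m (map φ f) = map φ (homogeneousComponent m f) := by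
  ext d
  rw [coeff_homogeneousComponent, coeff_map, coeff_map, coeff_homogeneousComponent]
  split_ifs <;> simp

variable {n : ℕ}

/-- Modulo the ideal generated by the `g j - C (a j)`, every polynomial outside this ideal can be
replaced by one whose leading form is not in the ideal generated by the forms `g j`. -/
theorem exists_sub_mem_leadingForm_notMem {g : Fin n → MvPolynomial σ A}
    (hg : ∀ i, ∃ e, 0 < e ∧ (g i).IsHomogeneous e) (a : Fin n → A) (f : MvPolynomial σ A)
    (hf : f ∉ Ideal.span (Set.range fun j ↦ g j - C (a j))) :
    ∃ f' m, f - f' ∈ Ideal.span (Set.range fun j ↦ g j - C (a j)) ∧ f'.totalDegree ≤ m ∧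
      homogeneousComponent m f' ∉ Ideal.span (Set.range g) := by
  set J := Ideal.span (Set.range fun j ↦ g j - C (a j)) with hJ
  have hS : ∀ f ∈ Set.range g, ∃ e, f.IsHomogeneous e := by
    rintro _ ⟨i, rfl⟩; exact (hg i).imp fun _ h ↦ h.2
  choose e he0 he using hg
  obtain ⟨m, hm⟩ : ∃ m, f.totalDegree ≤ m := ⟨_, le_rfl⟩
  induction m using Nat.strong_induction_on generalizing f with
  | _ m ih =>
  by_cases hmem : homogeneousComponent m f ∈ Ideal.span (Set.range g)
  swap
  · exact ⟨f, m, by simp, hm, hmem⟩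
  obtain ⟨c, hc⟩ := Ideal.mem_span_range_iff_exists_fun.1 hmem
  have hc' : homogeneousComponent m f =
      ∑ j, if e j ≤ m then homogeneousComponent (m - e j) (c j) * g j else 0 := by
    rw [← homogeneousComponent_eq_self (homogeneousComponent_isHomogeneous m f), ← hc, map_sum]
    exact Finset.sum_congr rfl fun j _ ↦ homogeneousComponent_mul_of_isHomogeneous _ (he j) m
  set r := ∑ j, if e j ≤ m then homogeneousComponent (m - e j) (c j) * (g j - C (a j)) else 0
    with hr
  have hrJ : r ∈ J := by
    refine Ideal.sum_mem _ fun j _ ↦ ?_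
    split_ifs
    · exact Ideal.mul_mem_left _ _ (Ideal.subset_span ⟨j, rfl⟩)
    · exact Ideal.zero_mem _
  have hfr : f - r = (∑ i ∈ Finset.range m, homogeneousComponent i f) +
      ∑ j, if e j ≤ m then homogeneousComponent (m - e j) (c j) * C (a j) else 0 := by
    conv_lhs => rw [eq_sum_homogeneousComponent hm, Finset.sum_range_succ, hc']
    rw [add_sub_assoc, hr, ← Finset.sum_sub_distrib]
    congr 1
    refine Finset.sum_congr rfl fun j _ ↦ ?_
    split_ifs
    · ring
    · simp
  have hfrJ : f - r ∉ J := fun h ↦ hf ((J.sub_mem_iff_left hrJ).1 h)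
  have hm0 : 0 < m := by
    rcases Nat.eq_zero_or_pos m with rfl | h
    · refine absurd ?_ hfrJ
      rw [hfr, Finset.range_zero, Finset.sum_empty, zero_add, Finset.sum_eq_zero]
      · exact J.zero_mem
      · intro j _
        rw [if_neg]
        have := he0 j
        omega
    · exact h
  have hdeg : (f - r).totalDegree ≤ m - 1 := by
    rw [hfr]
    refine (totalDegree_add _ _).trans (max_le ?_ ?_)
    · refine totalDegree_finsetSum_le fun i hi ↦ ?_
      have := (homogeneousComponent_isHomogeneous i f).totalDegree_le
      rw [Finset.mem_range] at hi
      omega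
    · refine totalDegree_finsetSum_le fun j _ ↦ ?_
      split_ifs
      · have h1 := totalDegree_mul (homogeneousComponent (m - e j) (c j)) (C (a j))
        have h2 := (homogeneousComponent_isHomogeneous (m - e j) (c j)).totalDegree_le
        have := he0 j
        rw [totalDegree_C] at h1
        omega
      · simp
  obtain ⟨f', m', h1, h2⟩ := ih (m - 1) (by omega) (f - r) hfrJ hdeg
  refine ⟨f', m', ?_, h2⟩
  have : f - f' = r + (f - r - f') := by ring
  rw [this]
  exact J.add_mem hrJ h1

theorem range_castSucc_union {B : Type*} (g : Fin (n + 1) → B) :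
    Set.range g = insert (g (Fin.last n)) (Set.range fun j : Fin n ↦ g j.castSucc) := by
  ext x
  simp only [Set.mem_range, Set.mem_insert_iff, Fin.exists_fin_succ']
  tauto

/-- The leading forms of the ideal generated by the `g j - C (a j)` lie in the ideal generated by
the `g j`, if the latter is a regular sequence. -/
theorem homogeneousComponent_mem_of_mem_span_sub {g : Fin n → MvPolynomial σ A}
    (hg : ∀ i, ∃ e, 0 < e ∧ (g i).IsHomogeneous e) (a : Fin n → A)
    (hreg : ∀ (i : Fin n) (f : MvPolynomial σ A),
      f * g i ∈ Ideal.span (Set.range fun j : Fin i ↦ g (Fin.castLE i.2.le j)) →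
        f ∈ Ideal.span (Set.range fun j : Fin i ↦ g (Fin.castLE i.2.le j)))
    {f : MvPolynomial σ A} (hf : f ∈ Ideal.span (Set.range fun j ↦ g j - C (a j))) {m : ℕ}
    (hm : f.totalDegree ≤ m) : homogeneousComponent m f ∈ Ideal.span (Set.range g) := by
  induction n generalizing f m with
  | zero =>
    have hf0 : f = 0 := by simpa using hf
    simp [hf0]
  | succ n ih =>
    have ih' := fun {f} hf {m} ↦ @ih (fun j ↦ g j.castSucc) (fun i ↦ hg i.castSucc)
      (fun j ↦ a j.castSucc) (fun i f h ↦ hreg i.castSucc f h) f hf m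
    have hle : Ideal.span (Set.range fun j : Fin n ↦ g j.castSucc) ≤ Ideal.span (Set.range g) :=
      Ideal.span_mono (by rintro _ ⟨j, rfl⟩; exact ⟨_, rfl⟩)
    rw [range_castSucc_union, Ideal.mem_span_insert] at hf
    obtain ⟨h, j, hj, rfl⟩ := hf
    set J := Ideal.span (Set.range fun j : Fin n ↦ g j.castSucc - C (a j.castSucc)) with hJ
    by_cases hhJ : h ∈ J
    · exact hle (ih' (J.add_mem (J.mul_mem_right _ hhJ) hj) hm)
    obtain ⟨h', m', hh', hm', hnot⟩ := exists_sub_mem_leadingForm_notMem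
      (fun i : Fin n ↦ hg i.castSucc) (fun j ↦ a j.castSucc) h hhJ
    obtain ⟨e, he0, he⟩ := hg (Fin.last n)
    set f := h * (g (Fin.last n) - C (a (Fin.last n))) + j with hf
    set j' := f - h' * (g (Fin.last n) - C (a (Fin.last n))) with hj'
    have hj'J : j' ∈ J := by
      have : j' = (h - h') * (g (Fin.last n) - C (a (Fin.last n))) + j := by rw [hj', hf]; ring
      rw [this]
      exact J.add_mem (J.mul_mem_right _ hh') hj
    have hdeg : j'.totalDegree ≤ max m (m' + e) := by
      rw [hj']
      refine (totalDegree_sub _ _).trans (max_le_max hm ?_)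
      refine (totalDegree_mul _ _).trans (add_le_add hm' ?_)
      refine (totalDegree_sub _ _).trans (max_le he.totalDegree_le ?_)
      simp
    have hlead : homogeneousComponent (max m (m' + e)) j' =
        homogeneousComponent (max m (m' + e)) f -
          homogeneousComponent (max m (m' + e) - e) h' * g (Fin.last n) := by
      rw [hj', map_sub, mul_sub, map_sub, homogeneousComponent_mul_of_isHomogeneous _ he,
        if_pos (by omega), homogeneousComponent_eq_zero _ (h' * C _), sub_zero]
      have := totalDegree_mul h' (C (a (Fin.last n)))
      rw [totalDegree_C] at this
      omega
    have hj'm := ih' hj'J hdeg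
    rw [hlead] at hj'm
    have hmm : m' + e ≤ m := by
      by_contra! hlt
      rw [max_eq_right hlt.le, homogeneousComponent_eq_zero _ f (by omega), zero_sub,
        neg_mem_iff, Nat.add_sub_cancel] at hj'm
      exact hnot (hreg (Fin.last n) _ hj'm)
    rw [max_eq_left hmm] at hj'm
    have hgl : homogeneousComponent (m - e) h' * g (Fin.last n) ∈ Ideal.span (Set.range g) :=
      Ideal.mul_mem_left _ _ (Ideal.subset_span ⟨_, rfl⟩)
    exact ((Ideal.span (Set.range g)).sub_mem_iff_left hgl).1 (hle hj'm)

theorem isPrime_span_sub {g : Fin n → MvPolynomial σ A}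
    (hg : ∀ i, ∃ e, 0 < e ∧ (g i).IsHomogeneous e) (a : Fin n → A)
    (hreg : ∀ (i : Fin n) (f : MvPolynomial σ A),
      f * g i ∈ Ideal.span (Set.range fun j : Fin i ↦ g (Fin.castLE i.2.le j)) →
        f ∈ Ideal.span (Set.range fun j : Fin i ↦ g (Fin.castLE i.2.le j)))
    (hp : (Ideal.span (Set.range g)).IsPrime) :
    (Ideal.span (Set.range fun j ↦ g j - C (a j))).IsPrime := by
  set J := Ideal.span (Set.range fun j ↦ g j - C (a j)) with hJ
  refine ⟨fun h ↦ ?_, fun {u v} huv ↦ ?_⟩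
  · have h1 : (1 : MvPolynomial σ A) ∈ J := by rw [h]; trivial
    have h2 := homogeneousComponent_mem_of_mem_span_sub hg a hreg h1 (m := 0) (by simp)
    rw [homogeneousComponent_eq_self (isHomogeneous_one σ A)] at h2
    exact hp.ne_top (Ideal.eq_top_of_isUnit_mem _ h2 isUnit_one)
  · by_contra! hne
    obtain ⟨u', m, hu, hum, hun⟩ := exists_sub_mem_leadingForm_notMem hg a u hne.1
    obtain ⟨v', n, hv, hvm, hvn⟩ := exists_sub_mem_leadingForm_notMem hg a v hne.2
    have h1 : u' * v' ∈ J := by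
      have : u' * v' = u * v - ((u - u') * v + u' * (v - v')) := by ring
      rw [this]
      exact J.sub_mem huv (J.add_mem (J.mul_mem_right _ hu) (J.mul_mem_left _ hv))
    have h2 := homogeneousComponent_mem_of_mem_span_sub hg a hreg h1
      ((totalDegree_mul _ _).trans (add_le_add hum hvm))
    rw [homogeneousComponent_mul_add hum hvm] at h2
    exact (hp.mem_or_mem h2).elim hun hvn

end LeadingForm

section Contraction

variable {K : Type*} [Field K] {N n : ℕ}

/-- The extension of `Q` along `K[g] → R` after generic specialisation: the polynomials whose base
change to `R ⧸ Q` lies in the ideal of the fibre of `g` through the generic point of `Q`. -/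
noncomputable def fibreIdeal (g : Fin n → MvPolynomial (Fin N) K)
    (Q : Ideal (MvPolynomial (Fin N) K)) : Ideal (MvPolynomial (Fin N) K) :=
  (Ideal.span (Set.range fun j ↦ map (algebraMap K (MvPolynomial (Fin N) K ⧸ Q)) (g j) -
    C (Ideal.Quotient.mk Q (g j)))).comap (map (algebraMap K (MvPolynomial (Fin N) K ⧸ Q)))

variable {g : Fin n → MvPolynomial (Fin N) K} {Q Q' : Ideal (MvPolynomial (Fin N) K)}

theorem fibreIdeal_le : fibreIdeal g Q ≤ Q := by
  intro f hf
  have hle : Ideal.span (Set.range fun j ↦ map (algebraMap K (MvPolynomial (Fin N) K ⧸ Q)) (g j) -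
      C (Ideal.Quotient.mk Q (g j))) ≤
      RingHom.ker (eval fun i ↦ Ideal.Quotient.mk Q (X i : MvPolynomial (Fin N) K)) := by
    rw [Ideal.span_le]
    rintro _ ⟨j, rfl⟩
    rw [SetLike.mem_coe, RingHom.mem_ker, map_sub, eval_C, eval_map, ← aeval_def, sub_eq_zero]
    exact (comp_aeval_apply _ (Ideal.Quotient.mkₐ K Q) (g j)).symm.trans (by simp)
  have := hle hf
  rw [RingHom.mem_ker, eval_map, ← aeval_def] at this
  rw [← Ideal.Quotient.eq_zero_iff_mem, ← this]
  exact ((comp_aeval_apply _ (Ideal.Quotient.mkₐ K Q) f).symm.trans (by simp)).symm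

theorem fibreIdeal_mono (h : Q ≤ Q') : fibreIdeal g Q ≤ fibreIdeal g Q' := by
  intro f hf
  rw [fibreIdeal, Ideal.mem_comap] at hf ⊢
  have hcomp : (Ideal.Quotient.factor h).comp (algebraMap K (MvPolynomial (Fin N) K ⧸ Q)) =
      algebraMap K (MvPolynomial (Fin N) K ⧸ Q') := rfl
  have hf' := Ideal.mem_map_of_mem (map (Ideal.Quotient.factor h)) hf
  rw [map_map, hcomp, Ideal.map_span, ← Set.range_comp] at hf'
  refine Ideal.span_mono ?_ hf'
  rintro _ ⟨j, rfl⟩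
  refine ⟨j, ?_⟩
  simp [map_map, hcomp]

theorem mem_fibreIdeal_of_mem_adjoin {f : MvPolynomial (Fin N) K}
    (hf : f ∈ Algebra.adjoin K (Set.range g)) (hfQ : f ∈ Q) : f ∈ fibreIdeal g Q := by
  have key : map (algebraMap K (MvPolynomial (Fin N) K ⧸ Q)) f - C (Ideal.Quotient.mk Q f) ∈
      Ideal.span (Set.range fun j ↦ map (algebraMap K (MvPolynomial (Fin N) K ⧸ Q)) (g j) -
        C (Ideal.Quotient.mk Q (g j))) := by
    clear hfQ
    induction hf using Algebra.adjoin_induction with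
    | mem x hx => obtain ⟨j, rfl⟩ := hx; exact Ideal.subset_span ⟨j, rfl⟩
    | algebraMap r =>
      rw [algebraMap_eq, map_C]
      convert Ideal.zero_mem _ using 1
      rw [sub_eq_zero]
      rfl
    | add x y _ _ hx hy =>
      convert Ideal.add_mem _ hx hy using 1
      simp only [map_add]
      ring
    | mul x y _ _ hx hy =>
      convert Ideal.add_mem _ (Ideal.mul_mem_left _ (map (algebraMap K _) x) hy)
        (Ideal.mul_mem_left _ (C (Ideal.Quotient.mk Q y)) hx) using 1
      simp only [map_mul]
      ring
  rw [Ideal.Quotient.eq_zero_iff_mem.2 hfQ, map_zero] at key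
  rw [fibreIdeal, Ideal.mem_comap]
  convert key using 1
  ring

theorem isHomogeneous_map {A : Type*} [CommRing A] [Algebra K A]
    (hg : ∀ i, ∃ e, 0 < e ∧ (g i).IsHomogeneous e) (i : Fin n) :
    ∃ e, 0 < e ∧ (map (algebraMap K A) (g i)).IsHomogeneous e :=
  (hg i).imp fun _ h ↦ ⟨h.1, h.2.map _⟩

variable [IsAlgClosed K]

theorem mem_span_map_of_mul_mem {A : Type*} [CommRing A] [IsDomain A] [Algebra K A]
    (hprime : ∀ i (hi : i ≤ n), (Ideal.span (Set.range fun j : Fin i ↦ g (Fin.castLE hi j))).IsPrime)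
    (hnot : ∀ i : Fin n, g i ∉ Ideal.span (Set.range fun j : Fin i ↦ g (Fin.castLE i.2.le j)))
    (i : Fin n) (f : MvPolynomial (Fin N) A)
    (hf : f * map (algebraMap K A) (g i) ∈
      Ideal.span (Set.range fun j : Fin i ↦ map (algebraMap K A) (g (Fin.castLE i.2.le j)))) :
    f ∈ Ideal.span (Set.range fun j : Fin i ↦ map (algebraMap K A) (g (Fin.castLE i.2.le j))) := by
  have := hprime i i.2.le
  have hp := isPrime_map (A := A) (Ideal.span (Set.range fun j : Fin i ↦ g (Fin.castLE i.2.le j)))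
  have heq : (Ideal.span (Set.range fun j : Fin i ↦ g (Fin.castLE i.2.le j))).map
      (map (algebraMap K A)) =
      Ideal.span (Set.range fun j : Fin i ↦ map (algebraMap K A) (g (Fin.castLE i.2.le j))) := by
    rw [Ideal.map_span, ← Set.range_comp]; rfl
  rw [← heq] at hf ⊢
  exact (hp.mem_or_mem hf).resolve_right fun h ↦ hnot i (mem_of_map_mem_map h)

theorem homogeneousComponent_mem_of_mem_fibreIdeal [Q.IsPrime]
    (hg : ∀ i, ∃ e, 0 < e ∧ (g i).IsHomogeneous e)
    (hprime : ∀ i (hi : i ≤ n), (Ideal.span (Set.range fun j : Fin i ↦ g (Fin.castLE hi j))).IsPrime)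
    (hnot : ∀ i : Fin n, g i ∉ Ideal.span (Set.range fun j : Fin i ↦ g (Fin.castLE i.2.le j)))
    {f : MvPolynomial (Fin N) K} (hf : f ∈ fibreIdeal g Q) {m : ℕ} (hm : f.totalDegree ≤ m) :
    homogeneousComponent m f ∈ Ideal.span (Set.range g) := by
  have hI : (Ideal.span (Set.range g)).IsPrime := by simpa using hprime n le_rfl
  have h := homogeneousComponent_mem_of_mem_span_sub (isHomogeneous_map hg) _
    (mem_span_map_of_mul_mem hprime hnot) (Ideal.mem_comap.1 hf)
    ((Finset.sup_mono (support_map_subset _ _)).trans hm)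
  rw [homogeneousComponent_map] at h
  refine mem_of_map_mem_map (A := MvPolynomial (Fin N) K ⧸ Q) ?_
  rw [Ideal.map_span, ← Set.range_comp]
  exact h

theorem isPrime_fibreIdeal [Q.IsPrime]
    (hg : ∀ i, ∃ e, 0 < e ∧ (g i).IsHomogeneous e)
    (hprime : ∀ i (hi : i ≤ n), (Ideal.span (Set.range fun j : Fin i ↦ g (Fin.castLE hi j))).IsPrime)
    (hnot : ∀ i : Fin n, g i ∉ Ideal.span (Set.range fun j : Fin i ↦ g (Fin.castLE i.2.le j))) :
    (fibreIdeal g Q).IsPrime := by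
  have hI : (Ideal.span (Set.range g)).IsPrime := by simpa using hprime n le_rfl
  have hp := isPrime_map (A := MvPolynomial (Fin N) K ⧸ Q) (Ideal.span (Set.range g))
  rw [Ideal.map_span, ← Set.range_comp] at hp
  have := isPrime_span_sub (isHomogeneous_map (A := MvPolynomial (Fin N) K ⧸ Q) hg)
    (fun j ↦ Ideal.Quotient.mk Q (g j)) (mem_span_map_of_mul_mem hprime hnot) hp
  exact Ideal.comap_isPrime _ _

end Contraction

section DeterminingSet

variable {R : Type*} [CommRing R]

/-- `s` determines the prime `Q`: every monotone operator shrinking primes to primes and keeping the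
elements of `s` fixes `Q`. -/
def Determines (s : Set R) (Q : Ideal R) : Prop :=
  ∀ E : Ideal R → Ideal R, (∀ P, P.IsPrime → (E P).IsPrime) → (∀ P, E P ≤ P) → Monotone E →
    (∀ P, ∀ f ∈ s, f ∈ P → f ∈ E P) → Q ≤ E Q

theorem exists_determines [IsNoetherianRing R] [IsDomain R] {D : Set R} {Q : Ideal R} [Q.IsPrime]
    (hD : D ⊆ Q) {h : ℕ} (hQ : Q.height ≤ h) :
    ∃ (s : Finset R) (Q' : Ideal R), ↑s ⊆ D ∧ s.card ≤ h ∧ Q'.IsPrime ∧ Q' ≤ Q ∧ D ⊆ Q' ∧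
      Determines ↑s Q' := by
  classical
  by_contra! hcon
  have key : ∀ i : ℕ, ∃ (s : Finset R) (Q' : Ideal R), ↑s ⊆ D ∧ s.card ≤ i ∧ Q'.IsPrime ∧ Q' ≤ Q ∧
      i ≤ Q'.height ∧ Determines ↑s Q' := by
    intro i
    induction i with
    | zero =>
      exact ⟨∅, ⊥, by simp, by simp, Ideal.isPrime_bot, bot_le, by simp, fun _ _ _ _ _ ↦ bot_le⟩
    | succ i ih =>
      obtain ⟨s, Q', hsD, hsc, hQ', hle, hi, hdet⟩ := ih
      have hih : i ≤ h := by
        exact_mod_cast hi.trans ((Ideal.height_mono hle).trans hQ)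
      obtain ⟨f, hfD, hfQ'⟩ := Set.not_subset.1
        fun hDQ ↦ hcon s Q' hsD (hsc.trans hih) hQ' hle hDQ hdet
      obtain ⟨P, hPmin, hPQ⟩ := Ideal.exists_minimalPrimes_le
        (I := Q' ⊔ Ideal.span {f}) (J := Q)
        (sup_le hle (by rw [Ideal.span_singleton_le_iff_mem]; exact hD hfD))
      have hP : P.IsPrime := hPmin.1.1
      have hQ'P : Q' ≤ P := le_sup_left.trans hPmin.1.2
      have hfP : f ∈ P := hPmin.1.2 (Ideal.mem_sup_right (Ideal.mem_span_singleton_self f))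
      refine ⟨insert f s, P, ?_, (Finset.card_insert_le _ _).trans (by omega), hP, hPQ, ?_, ?_⟩
      · rw [Finset.coe_insert]; exact Set.insert_subset hfD hsD
      · have hlt : Q' < P := lt_of_le_of_ne hQ'P fun h ↦ hfQ' (h ▸ hfP)
        push_cast
        exact (add_le_add_left hi 1).trans (Ideal.height_add_one_le_of_lt_of_isPrime hlt)
      · intro E h1 h2 h3 h4
        refine hPmin.2 ⟨h1 P hP, sup_le ?_ ?_⟩ (h2 P)
        · refine (hdet E h1 h2 h3 fun P f hf ↦ h4 P f ?_).trans (h3 hQ'P)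
          simp [Finset.mem_coe.1 hf]
        · rw [Ideal.span_singleton_le_iff_mem]
          exact h4 P f (by simp) hfP
  obtain ⟨s, Q', -, -, -, hle, hi, -⟩ := key (h + 1)
  have := hi.trans ((Ideal.height_mono hle).trans hQ)
  norm_cast at this
  omega

end DeterminingSet

section Specialisation

/-- There is an element `w` outside a prime `P` such that adding a set `S` to `P` raises the height
by at most the size of `S` at all primes avoiding `w`. -/
theorem exists_height_le_of_mem_minimalPrimes_sup {R : Type*} [CommRing R] [IsNoetherianRing R]
    (P : Ideal R) [hP : P.IsPrime] {H : ℕ} (hH : P.height ≤ H) :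
    ∃ w ∉ P, ∀ (S : Finset R) (Q : Ideal R), Q ∈ (P ⊔ Ideal.span ↑S).minimalPrimes → w ∉ Q →
      Q.height ≤ (H + S.card : ℕ) := by
  classical
  obtain ⟨t, ht, htc⟩ : ∃ t : Finset R, P ∈ (Ideal.span (t : Set R)).minimalPrimes ∧ t.card ≤ H := by
    obtain ⟨t, ht, htc⟩ := P.exists_finset_card_eq_height_of_isNoetherianRing
    exact ⟨t, ht, by exact_mod_cast htc.trans_le hH⟩
  have hfin := (Ideal.span (t : Set R)).finite_minimalPrimes_of_isNoetherianRing
  have hw : ¬ (hfin.toFinset.erase P).inf id ≤ P := by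
    rw [hP.inf_le']
    rintro ⟨P', hP', hle⟩
    rw [Finset.mem_erase, Set.Finite.mem_toFinset] at hP'
    exact hP'.1 (le_antisymm hle (ht.2 hP'.2.1 hle))
  obtain ⟨w, hw1, hw2⟩ := Set.not_subset.1 hw
  refine ⟨w, hw2, fun S Q hQ hwQ ↦ ?_⟩
  have hQmin : Q ∈ (Ideal.span ((t ∪ S : Finset R) : Set R)).minimalPrimes := by
    rw [Finset.coe_union, Ideal.span_union]
    refine ⟨⟨hQ.1.1, (sup_le_sup_right ht.1.2 _).trans hQ.1.2⟩, fun Q₀ hQ₀ hle ↦ ?_⟩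
    have hQ₀p : Q₀.IsPrime := hQ₀.1
    obtain ⟨P', hP', hP'Q⟩ := Ideal.exists_minimalPrimes_le (le_sup_left.trans hQ₀.2)
    by_cases hPP : P' = P
    · subst hPP
      exact hQ.2 ⟨hQ₀p, sup_le hP'Q (le_sup_right.trans hQ₀.2)⟩ hle
    · refine absurd (hle (hP'Q ?_)) hwQ
      exact (Finset.inf_le (f := id) (by simpa [hPP] using hP') : _ ≤ P') hw1
  refine (Ideal.height_le_card_of_mem_minimalPrimes_span_finset hQmin).trans ?_
  exact_mod_cast (Finset.card_union_le _ _).trans (by omega)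

variable {K : Type*} [Field K] [IsAlgClosed K] {N n : ℕ}

/-- If the Jacobian matrix of `g` is degenerate modulo a prime `P`, then some nontrivial
`K`-linear combination of the `g j` has all its derivatives in a prime of bounded height. -/
theorem exists_combination_pderiv_mem {g : Fin n → MvPolynomial (Fin N) K}
    {P : Ideal (MvPolynomial (Fin N) K)} [P.IsPrime] {H : ℕ} (hP : P.height ≤ H)
    (hJ : ¬ JacobianFullRank g P) :
    ∃ (c : Fin n → K) (Q : Ideal (MvPolynomial (Fin N) K)), (∃ j, c j ≠ 0) ∧ Q.IsPrime ∧
      Q.height ≤ (H + n : ℕ) ∧ ∀ l, pderiv l (∑ j, c j • g j) ∈ Q := by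
  classical
  simp only [JacobianFullRank] at hJ
  push Not at hJ
  obtain ⟨u, hu, j₀, hj₀⟩ := hJ
  obtain ⟨w, hwP, hw⟩ := exists_height_le_of_mem_minimalPrimes_sup P hP
  obtain ⟨z, hz, hzne⟩ := exists_aeval_ne_zero
    (mt (Ideal.IsPrime.mem_or_mem ‹_›) (not_or.2 ⟨hwP, hj₀⟩))
  rw [map_mul, mul_ne_zero_iff] at hzne
  obtain ⟨hzw, hzne⟩ := hzne
  set c : Fin n → K := fun j ↦ aeval z (u j) / aeval z (u j₀) with hc
  set S : Finset (MvPolynomial (Fin N) K) := Finset.univ.image fun j ↦ u j - c j • u j₀ with hS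
  have hm : (RingHom.ker (aeval z : MvPolynomial (Fin N) K →ₐ[K] K)).IsPrime := RingHom.ker_isPrime _
  obtain ⟨Q, hQmin, hQz⟩ := Ideal.exists_minimalPrimes_le (I := P ⊔ Ideal.span ↑S)
    (J := RingHom.ker (aeval z : MvPolynomial (Fin N) K →ₐ[K] K)) (by
      refine sup_le (fun f hf ↦ hz f hf) (Ideal.span_le.2 ?_)
      intro f hf
      rw [hS, Finset.coe_image] at hf
      obtain ⟨j, -, rfl⟩ := hf
      rw [SetLike.mem_coe, RingHom.mem_ker, map_sub, map_smul, smul_eq_mul, hc]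
      simp only
      rw [div_mul_cancel₀ _ hzne, sub_self])
  have hQ : Q.IsPrime := hQmin.1.1
  have hPQ : P ≤ Q := le_sup_left.trans hQmin.1.2
  have hSQ : Ideal.span ↑S ≤ Q := le_sup_right.trans hQmin.1.2
  refine ⟨c, Q, ⟨j₀, ?_⟩, hQ, ?_, fun l ↦ ?_⟩
  · rw [hc]; simp only; rw [div_self hzne]; exact one_ne_zero
  · refine (hw S Q hQmin fun h ↦ hzw (hQz h)).trans ?_
    have : S.card ≤ n := Finset.card_image_le.trans (by simp)
    exact_mod_cast Nat.add_le_add_left this H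
  · have hv : u j₀ ∉ Q := fun h ↦ hzne (hQz h)
    refine (hQ.mem_or_mem (x := u j₀) ?_).resolve_left hv
    have : u j₀ * pderiv l (∑ j, c j • g j) =
        ∑ j, u j * pderiv l (g j) - ∑ j, (u j - c j • u j₀) * pderiv l (g j) := by
      rw [← Finset.sum_sub_distrib, map_sum, Finset.mul_sum]
      refine Finset.sum_congr rfl fun j _ ↦ ?_
      rw [Derivation.map_smul, smul_eq_C_mul, smul_eq_C_mul]
      ring
    rw [this]
    exact Q.sub_mem (hPQ (hu l)) (Q.sum_mem fun j _ ↦ Q.mul_mem_right _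
      (hSQ (Ideal.subset_span (by simp [hS]))))

end Specialisation

section Collapse

variable {σ K : Type*} [Field K]

/-- `F` has an `l`-collapse for some `l ≤ k`. -/
def CollapseLE (e k : ℕ) (F : MvPolynomial σ K) : Prop :=
  ∃ l ≤ k, HasCollapse e l F

theorem CollapseLE.mono {e k k' : ℕ} {F : MvPolynomial σ K} (hF : CollapseLE e k F) (h : k ≤ k') :
    CollapseLE e k' F :=
  hF.imp fun _ hl ↦ ⟨hl.1.trans h, hl.2⟩

theorem collapseLE_zero (e k : ℕ) : CollapseLE e k (0 : MvPolynomial σ K) :=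
  ⟨0, k.zero_le, Fin.elim0, Fin.elim0, fun i ↦ i.elim0, Ideal.zero_mem _⟩

theorem CollapseLE.hasCollapse {e k : ℕ} {F : MvPolynomial σ K} (hF : CollapseLE e k F)
    (he : 2 ≤ e) : HasCollapse e k F := by
  obtain ⟨l, hl, G, d, hG, hF⟩ := hF
  refine ⟨fun i ↦ if h : (i : ℕ) < l then G ⟨i, h⟩ else 0,
    fun i ↦ if h : (i : ℕ) < l then d ⟨i, h⟩ else 1, fun i ↦ ?_, ?_⟩
  · dsimp only
    split_ifs
    · exact hG _
    · exact ⟨one_pos, he, isHomogeneous_zero _ _ _⟩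
  · refine Ideal.span_mono ?_ hF
    rintro _ ⟨i, rfl⟩
    exact ⟨⟨i, i.2.trans_le hl⟩, by simp⟩

theorem CollapseLE.eq_zero {e k : ℕ} {F : MvPolynomial σ K} (hF : CollapseLE e k F)
    (he : e ≤ 1) : F = 0 := by
  obtain ⟨l, hl, G, d, hG, hF⟩ := hF
  cases l with
  | zero => simpa using hF
  | succ l => have := hG 0; omega

/-- No nontrivial linear combination of the forms `g j` has all its homogeneous components of small
strength; `A` prescribes the bounds in terms of the degree and the number of forms. -/
def IsStrong (A : ℕ → ℕ → ℕ) {ι : Type*} [Fintype ι] (g : ι → MvPolynomial σ K) : Prop :=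
  ∀ c : ι → K, (∀ m, CollapseLE m (A m (Fintype.card ι)) (homogeneousComponent m (∑ j, c j • g j))) →
    c = 0

theorem homogeneousComponent_sum_smul {ι : Type*} [Fintype ι] {g : ι → MvPolynomial σ K}
    {e : ι → ℕ} (hg : ∀ j, (g j).IsHomogeneous (e j)) (c : ι → K) (m : ℕ) :
    homogeneousComponent m (∑ j, c j • g j) = ∑ j, if e j = m then c j • g j else 0 := by
  rw [map_sum]
  refine Finset.sum_congr rfl fun j _ ↦ ?_
  rw [map_smul, homogeneousComponent_of_mem (hg j)]
  by_cases h : e j = m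
  · simp [h]
  · simp [h, Ne.symm h]

theorem exists_mul_homogeneous_of_collapseLE {e k : ℕ} {F : MvPolynomial σ K}
    (hF : F.IsHomogeneous e) (hc : CollapseLE e k F) :
    ∃ l ≤ k, ∃ (P G : Fin l → MvPolynomial σ K) (a b : Fin l → ℕ),
      (∀ i, 0 < a i ∧ a i < e ∧ (P i).IsHomogeneous (a i)) ∧
      (∀ i, 0 < b i ∧ b i < e ∧ (G i).IsHomogeneous (b i)) ∧ F = ∑ i, P i * G i := by
  obtain ⟨l, hl, G, b, hG, hFG⟩ := hc
  obtain ⟨u, hu⟩ := Ideal.mem_span_range_iff_exists_fun.1 hFG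
  refine ⟨l, hl, fun i ↦ homogeneousComponent (e - b i) (u i), G, fun i ↦ e - b i, b,
    fun i ↦ ⟨?_, ?_, homogeneousComponent_isHomogeneous _ _⟩, hG, ?_⟩
  · have := (hG i).2.1; dsimp only; omega
  · have := (hG i).1; have := (hG i).2.1; dsimp only; omega
  · rw [← homogeneousComponent_eq_self hF, ← hu, map_sum]
    refine Finset.sum_congr rfl fun i _ ↦ ?_
    rw [homogeneousComponent_mul_of_isHomogeneous _ (hG i).2.2, if_pos (hG i).2.1.le]

theorem exists_isStrong_bound (A : ℕ → ℕ → ℕ) (M : Multiset ℕ) :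
    ∃ B : ℕ, ∀ (K : Type*) [Field K] (σ : Type*) (ι : Type) [Fintype ι]
      (g : ι → MvPolynomial σ K) (e : ι → ℕ), (∀ j, 0 < e j ∧ (g j).IsHomogeneous (e j)) →
      ∑ j, ({e j} : Multiset ℕ) = M →
      ∃ (κ : Type) (_ : Fintype κ) (g' : κ → MvPolynomial σ K) (e' : κ → ℕ),
        Fintype.card κ ≤ B ∧ (∀ j, 0 < e' j ∧ (g' j).IsHomogeneous (e' j)) ∧ IsStrong A g' ∧
        (∀ j, ∃ m ∈ M, e' j ≤ m) ∧ Set.range g ⊆ Algebra.adjoin K (Set.range g') := by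
  classical
  have hwf : WellFounded (Multiset.IsDershowitzMannaLT (α := ℕ)) :=
    Multiset.wellFounded_isDershowitzMannaLT
  induction M using hwf.induction with
  | _ M ih =>
  choose! B hB using ih
  refine ⟨max (Multiset.card M) (M.toFinset.sup fun e₀ ↦
    ((2 * A e₀ (Multiset.card M)) • Multiset.range e₀).powerset.toFinset.sup
      fun s ↦ B (M.erase e₀ + s)), ?_⟩
  intro K _ σ ι _ g e hg hM
  have hcard : Fintype.card ι = Multiset.card M := by
    rw [← hM, Multiset.card_sum]; simp
  by_cases hs : IsStrong A g
  · refine ⟨ι, inferInstance, g, e, by simp [hcard], hg, hs, fun j ↦ ⟨e j, ?_, le_rfl⟩,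
      Algebra.subset_adjoin⟩
    rw [← hM, Multiset.mem_sum]
    exact ⟨j, Finset.mem_univ _, by simp⟩
  simp only [IsStrong] at hs
  push Not at hs
  obtain ⟨c, hc, hc0⟩ := hs
  obtain ⟨j₀, hj₀⟩ := Function.ne_iff.1 hc0
  obtain ⟨l, hl, P, G, a, b, hP, hG, hF⟩ := exists_mul_homogeneous_of_collapseLE
    (homogeneousComponent_isHomogeneous _ _) (hc (e j₀))
  have hjM : e j₀ ∈ M := by
    rw [← hM, Multiset.mem_sum]
    exact ⟨j₀, Finset.mem_univ _, by simp⟩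
  set s : Multiset ℕ := ∑ i, {a i} + ∑ i, {b i} with hs
  have hslt : ∀ y ∈ s, y < e j₀ := by
    intro y hy
    rw [hs, Multiset.mem_add, Multiset.mem_sum, Multiset.mem_sum] at hy
    rcases hy with ⟨i, -, hi⟩ | ⟨i, -, hi⟩
    · rw [Multiset.mem_singleton.1 hi]; exact (hP i).2.1
    · rw [Multiset.mem_singleton.1 hi]; exact (hG i).2.1
  have hscard : Multiset.card s = 2 * l := by
    rw [hs, Multiset.card_add, Multiset.card_sum, Multiset.card_sum]; simp; omega
  have hle : s ≤ (2 * A (e j₀) (Multiset.card M)) • Multiset.range (e j₀) := by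
    rw [Multiset.le_iff_count]
    intro y
    by_cases hy : y ∈ s
    · rw [Multiset.count_nsmul, Multiset.count_eq_one_of_mem (Multiset.nodup_range _)
        (Multiset.mem_range.2 (hslt y hy)), mul_one]
      refine (Multiset.count_le_card _ _).trans ?_
      rw [hscard, ← hcard]
      omega
    · rw [Multiset.count_eq_zero_of_notMem hy]; exact Nat.zero_le _
  have hlt : Multiset.IsDershowitzMannaLT (M.erase (e j₀) + s) M :=
    ⟨M.erase (e j₀), s, {e j₀}, by simp, rfl, by
      rw [add_comm, Multiset.singleton_add, Multiset.cons_erase hjM],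
      fun y hy ↦ ⟨e j₀, by simp, hslt y hy⟩⟩
  obtain ⟨κ, hκ, g', e', h1, h2, h3, h4, h5⟩ := hB _ hlt K σ
    ({j // j ≠ j₀} ⊕ (Fin l ⊕ Fin l)) (Sum.elim (fun j ↦ g j) (Sum.elim P G))
    (Sum.elim (fun j ↦ e j) (Sum.elim a b)) (by
      rintro (j | i | i)
      · exact hg j
      · exact ⟨(hP i).1, (hP i).2.2⟩
      · exact ⟨(hG i).1, (hG i).2.2⟩) (by
      rw [Fintype.sum_sum_type, Fintype.sum_sum_type]
      simp only [Sum.elim_inl, Sum.elim_inr]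
      rw [← hM, Fintype.sum_eq_add_sum_subtype_ne _ j₀, Multiset.singleton_add,
        Multiset.erase_cons_head])
  refine ⟨κ, hκ, g', e', ?_, h2, h3, fun j ↦ ?_, ?_⟩
  · refine h1.trans (le_max_of_le_right ?_)
    refine le_trans ?_ (Finset.le_sup (b := e j₀) (Multiset.mem_toFinset.2 hjM))
    exact Finset.le_sup (f := fun s ↦ B (M.erase (e j₀) + s)) (b := s)
      (Multiset.mem_toFinset.2 (Multiset.mem_powerset.2 hle))
  · obtain ⟨m, hm, hjm⟩ := h4 j
    rcases Multiset.mem_add.1 hm with hm | hm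
    · exact ⟨m, Multiset.mem_of_mem_erase hm, hjm⟩
    · exact ⟨e j₀, hjM, hjm.trans (hslt m hm).le⟩
  · have hmem : ∀ x, Sum.elim (fun j : {j // j ≠ j₀} ↦ g j) (Sum.elim P G) x ∈
        Algebra.adjoin K (Set.range g') := fun x ↦ h5 ⟨x, rfl⟩
    have hne : ∀ j, j ≠ j₀ → g j ∈ Algebra.adjoin K (Set.range g') :=
      fun j hj ↦ hmem (Sum.inl ⟨j, hj⟩)
    rintro _ ⟨j, rfl⟩
    by_cases hj : j = j₀
    swap
    · exact hne j hj
    subst hj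
    rw [homogeneousComponent_sum_smul fun j ↦ (hg j).2, Fintype.sum_eq_add_sum_subtype_ne _ j,
      if_pos rfl] at hF
    have hcg : c j • g j ∈ Algebra.adjoin K (Set.range g') := by
      rw [eq_sub_of_add_eq hF]
      refine sub_mem (sum_mem fun i _ ↦ mul_mem (hmem (.inr (.inl i))) (hmem (.inr (.inr i))))
        (sum_mem fun i _ ↦ ?_)
      split_ifs
      · exact Subalgebra.smul_mem _ (hne i i.2) _
      · exact zero_mem _
    have := Subalgebra.smul_mem _ hcg (c j)⁻¹
    rwa [smul_smul, inv_mul_cancel₀ hj₀, one_smul] at this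

variable {N n : ℕ}

theorem exists_prime_chain_of_jacobianFullRank {g : Fin n → MvPolynomial (Fin N) K}
    (hg : ∀ i, ∃ e, 0 < e ∧ (g i).IsHomogeneous e)
    (hJ : ∀ (P : Ideal (MvPolynomial (Fin N) K)) [P.IsPrime], P.height ≤ (n + 1 : ℕ) →
      JacobianFullRank g P) :
    (∀ i (hi : i ≤ n), (Ideal.span (Set.range fun j : Fin i ↦ g (Fin.castLE hi j))).IsPrime) ∧
      ∀ i : Fin n, g i ∉ Ideal.span (Set.range fun j : Fin i ↦ g (Fin.castLE i.2.le j)) := by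
  have hp : ∀ i (hi : i ≤ n),
      (Ideal.span (Set.range fun j : Fin i ↦ g (Fin.castLE hi j))).IsPrime := fun i hi ↦
    (isPrime_and_isWeaklyRegular_of_jacobianFullRank (fun j ↦ hg _) fun P _ hP ↦
      (hJ P (hP.trans (by exact_mod_cast Nat.add_le_add_right hi 1))).castLE hi).1
  refine ⟨hp, fun i ↦ ?_⟩
  have := hp i i.2.le
  refine notMem_span_of_jacobianFullRank (g := fun j : Fin (i + 1) ↦ g (Fin.castLE i.2 j))
    (P := Ideal.span (Set.range fun j : Fin i ↦ g (Fin.castLE i.2.le j))) le_rfl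
    ((hJ _ ?_).castLE i.2)
  refine (Ideal.height_le_card_of_mem_minimalPrimes_span
    (s := Set.range fun j : Fin i ↦ g (Fin.castLE i.2.le j)) (Set.finite_range _)
    (by rw [Ideal.minimalPrimes_eq_subsingleton_self]; rfl)).trans ?_
  have h1 : (Set.range fun j : Fin i ↦ g (Fin.castLE i.2.le j)).ncard ≤ i := by
    rw [← Set.image_univ]
    refine (Set.ncard_image_le Set.finite_univ).trans (by simp)
  exact_mod_cast h1.trans (by omega)

theorem exists_collapseLE_of_mem_sup {σ : Type*} {g : Fin n → MvPolynomial σ K} {e : ℕ}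
    (hg : ∀ i, ∃ a, 0 < a ∧ a < e ∧ (g i).IsHomogeneous a) {F G : MvPolynomial σ K} {b : ℕ}
    (hb : 0 < b ∧ b < e ∧ G.IsHomogeneous b) (hF : F ∈ Ideal.span (Set.range g) ⊔ Ideal.span {G}) :
    CollapseLE e (n + 1) F := by
  choose a ha using hg
  refine ⟨n + 1, le_rfl, Fin.cons G g, Fin.cons b a, Fin.cases hb ha, ?_⟩
  rw [← Ideal.span_union] at hF
  convert hF using 2
  rw [Fin.range_cons, Set.union_singleton]

theorem mem_adjoin_of_homogeneousComponent_mem {σ : Type*} {F : MvPolynomial σ K} {m : ℕ}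
    (hF : F.totalDegree ≤ m) {S : Subalgebra K (MvPolynomial σ K)}
    (h : ∀ i < m, homogeneousComponent (i + 1) F ∈ S) : F ∈ S := by
  rw [eq_sum_homogeneousComponent hF, Finset.sum_range_succ']
  refine add_mem (sum_mem fun i hi ↦ h i (Finset.mem_range.1 hi)) ?_
  rw [homogeneousComponent_zero, ← algebraMap_eq]
  exact S.algebraMap_mem _

end Collapse

universe v

section Strength

theorem homogeneousComponent_pderiv {σ A : Type*} [CommRing A] (F : MvPolynomial σ A) (l : σ)
    (m : ℕ) : homogeneousComponent m (pderiv l F) = pderiv l (homogeneousComponent (m + 1) F) := by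
  ext d
  rw [coeff_homogeneousComponent, coeff_pderiv, coeff_pderiv, coeff_homogeneousComponent]
  have : (d + Finsupp.single l 1).degree = d.degree + 1 := by simp
  rw [this]
  by_cases h : d.degree = m <;> simp [h]

theorem totalDegree_pderiv_le {σ A : Type*} [CommRing A] {F : MvPolynomial σ A} (l : σ)
    {m : ℕ} (hF : F.totalDegree ≤ m + 1) : (pderiv l F).totalDegree ≤ m := by
  refine Finset.sup_le fun d hd ↦ ?_
  rw [mem_support_iff, coeff_pderiv] at hd
  have h := le_totalDegree (p := F) (mem_support_iff.2 (left_ne_zero_of_mul hd))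
  have h2 : ((d + Finsupp.single l 1).sum fun _ e ↦ e) = (d.sum fun _ e ↦ e) + 1 := by
    rw [Finsupp.sum_add_index' (fun _ ↦ rfl) (fun _ _ _ ↦ rfl), Finsupp.sum_single_index rfl]
  omega

/-- If all first derivatives of a polynomial of degree at most `e` lie in a prime of height at most
`h`, then its component of degree `e` has a `k`-collapse. -/
def PolarBound (e h k : ℕ) : Prop :=
  ∀ (K : Type v) [Field K] [IsAlgClosed K] (N : ℕ) (F : MvPolynomial (Fin N) K)
    (Q : Ideal (MvPolynomial (Fin N) K)) [Q.IsPrime], F.totalDegree ≤ e → Q.height ≤ h →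
    (∀ l, pderiv l F ∈ Q) → CollapseLE e k (homogeneousComponent e F)

variable {K : Type v} [Field K] [IsAlgClosed K] {N n : ℕ}

theorem IsStrong.jacobianFullRank {g : Fin n → MvPolynomial (Fin N) K} {e : Fin n → ℕ}
    (hg : ∀ j, (g j).IsHomogeneous (e j)) {A : ℕ → ℕ → ℕ} (hs : IsStrong A g) {H : ℕ}
    (hA : ∀ j, PolarBound.{v} (e j) (H + n) (A (e j) n))
    (P : Ideal (MvPolynomial (Fin N) K)) [P.IsPrime] (hP : P.height ≤ H) :
    JacobianFullRank g P := by
  classical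
  by_contra hJ
  obtain ⟨c, Q, ⟨j₁, hj₁⟩, hQ, hQh, hder⟩ := exists_combination_pderiv_mem hP hJ
  obtain ⟨j₀, hj₀, hmax⟩ := Finset.exists_max_image (Finset.univ.filter fun j ↦ c j ≠ 0) e
    ⟨j₁, by simpa using hj₁⟩
  rw [Finset.mem_filter] at hj₀
  have hdeg : (∑ j, c j • g j).totalDegree ≤ e j₀ := by
    refine totalDegree_finsetSum_le fun j _ ↦ ?_
    by_cases hj : c j = 0
    · simp [hj]
    · exact (totalDegree_smul_le _ _).trans ((hg j).totalDegree_le.trans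
        (hmax j (by simpa using hj)))
  have hcol := hA j₀ K N _ Q hdeg hQh hder
  have h0 := hs (fun j ↦ if e j = e j₀ then c j else 0) fun m ↦ by
    rw [homogeneousComponent_sum_smul hg, Fintype.card_fin]
    by_cases hm : m = e j₀
    · subst hm
      rw [homogeneousComponent_sum_smul hg] at hcol
      convert hcol using 3 with j
      split_ifs; rfl
    · convert collapseLE_zero m _
      refine Finset.sum_eq_zero fun j _ ↦ ?_
      split_ifs with h1 h2
      · exact absurd (h1.symm.trans h2) hm
      · exact zero_smul _ _
      · rfl
  exact hj₀.2 (by simpa using congrFun h0 j₀)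

theorem IsStrong.comp_equiv {σ F ι κ : Type*} [Field F] [Fintype ι] [Fintype κ]
    {g : ι → MvPolynomial σ F} {A : ℕ → ℕ → ℕ} (hs : IsStrong A g) (f : κ ≃ ι) :
    IsStrong A (g ∘ f) := by
  intro c hc
  have h := hs (c ∘ f.symm) fun m ↦ by
    have := hc m
    rw [Fintype.card_congr f] at this
    convert this using 2
    rw [← f.sum_comp]
    simp
  funext j
  simpa using congrFun h (f j)

theorem polarBound_one (h : ℕ) : PolarBound.{v} 1 h 0 := by
  intro K _ _ N F Q hQ hF hh hder
  suffices homogeneousComponent 1 F = 0 by rw [this]; exact collapseLE_zero _ _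
  have h1 : ∀ l, pderiv l (homogeneousComponent 1 F) = 0 := by
    intro l
    rw [← homogeneousComponent_pderiv, homogeneousComponent_zero]
    have h2 := totalDegree_eq_zero_iff_eq_C.1 (Nat.le_zero.1 (totalDegree_pderiv_le l hF))
    by_contra hne
    refine hQ.ne_top (Q.eq_top_of_isUnit_mem (hder l) ?_)
    rw [h2]
    refine IsUnit.map C (isUnit_iff_ne_zero.2 fun h0 ↦ hne (by rw [h0, map_zero]))
  have h3 := (homogeneousComponent_isHomogeneous 1 F).sum_X_mul_pderiv
  simp only [h1, mul_zero, Finset.sum_const_zero, one_smul] at h3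
  exact h3.symm

theorem exists_polarBound (e : ℕ) (he : 1 ≤ e) (h : ℕ) : ∃ k, PolarBound.{v} e h k := by
  classical
  induction e using Nat.strong_induction_on generalizing h with
  | _ e ih =>
  rcases he.eq_or_lt with rfl | he2
  · exact ⟨0, polarBound_one h⟩
  obtain ⟨m, rfl⟩ : ∃ m, e = m + 1 := ⟨e - 1, by omega⟩
  choose! κ hκ using fun (i : ℕ) (hi : i < m + 1) (h1 : 1 ≤ i) (h : ℕ) ↦ ih i hi h1 h
  set A : ℕ → ℕ → ℕ := fun i n ↦ κ i (n + 2 + n) with hA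
  set M : Multiset ℕ := ∑ i : Fin m, {(i : ℕ) + 1} with hM
  choose B hB using exists_isStrong_bound A
  refine ⟨((Finset.range (h + 1)).sup fun c ↦ B (c • M)) + 1, ?_⟩
  intro K _ _ N F Q hQ hF hQh hder
  obtain ⟨s, Q', hsD, hsc, hQ', -, hDQ', hdet⟩ := exists_determines
    (D := Set.range fun l ↦ pderiv l F) (by rintro _ ⟨l, rfl⟩; exact hder l) hQh
  have hdeg : ∀ f ∈ Set.range fun l ↦ pderiv l F, f.totalDegree ≤ m := by
    rintro _ ⟨l, rfl⟩
    exact totalDegree_pderiv_le l hF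
  obtain ⟨ι, hι, g₀, e₀, hcard, hg₀, hstr, hle, hadj⟩ := hB (s.card • M) K (Fin N)
    (Fin s.card × Fin m) (fun p ↦ homogeneousComponent (p.2 + 1) (s.equivFin.symm p.1).1)
    (fun p ↦ p.2 + 1)
    (fun p ↦ ⟨Nat.succ_pos _, homogeneousComponent_isHomogeneous _ _⟩) (by
      rw [Fintype.sum_prod_type]
      simp [hM])
  set n := Fintype.card ι with hn
  set σ := (Fintype.equivFin ι).symm
  set g : Fin n → MvPolynomial (Fin N) K := g₀ ∘ σ with hg
  have hstr' : IsStrong A g := hstr.comp_equiv σ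
  have hrange : Set.range g = Set.range g₀ := σ.surjective.range_comp g₀
  have hM1 : ∀ i ∈ s.card • M, i < m + 1 := by
    intro i hi
    have := Multiset.mem_of_mem_nsmul hi
    rw [hM, Multiset.mem_sum] at this
    obtain ⟨j, -, hj⟩ := this
    rw [Multiset.mem_singleton] at hj
    omega
  have he₀ : ∀ j, e₀ j < m + 1 := by
    intro j
    obtain ⟨i, hi, hji⟩ := hle j
    have := hM1 i hi
    omega
  have hghom : ∀ j, ∃ e, 0 < e ∧ (g j).IsHomogeneous e := fun j ↦ ⟨_, hg₀ (σ j)⟩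
  have hJ : ∀ (P : Ideal (MvPolynomial (Fin N) K)) [P.IsPrime], P.height ≤ (n + 1 : ℕ) →
      JacobianFullRank g P := by
    intro P _ hP
    refine hstr'.jacobianFullRank (H := n + 2) (e := e₀ ∘ σ) (fun j ↦ (hg₀ _).2) (fun j ↦ ?_) P
      (hP.trans (by exact_mod_cast (by omega)))
    exact hκ _ (he₀ _) (hg₀ _).1 _
  obtain ⟨hprime, hnot⟩ := exists_prime_chain_of_jacobianFullRank hghom hJ
  obtain ⟨hIp, hIc, -⟩ := isPrime_and_isWeaklyRegular_of_jacobianFullRank hghom hJ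
  have hQ'E : Q' ≤ fibreIdeal g Q' := by
    refine hdet (fibreIdeal g) (fun P _ ↦ isPrime_fibreIdeal hghom hprime hnot)
      (fun P ↦ fibreIdeal_le) (fun P P' ↦ fibreIdeal_mono) fun P f hf hfP ↦
      mem_fibreIdeal_of_mem_adjoin ?_ hfP
    refine mem_adjoin_of_homogeneousComponent_mem (hdeg f (hsD hf)) fun i hi ↦ ?_
    rw [hrange]
    have := hadj ⟨(s.equivFin ⟨f, hf⟩, ⟨i, hi⟩), rfl⟩
    simpa using this
  have hpd : ∀ l, pderiv l (homogeneousComponent (m + 1) F) ∈ Ideal.span (Set.range g) := by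
    intro l
    rw [← homogeneousComponent_pderiv]
    exact homogeneousComponent_mem_of_mem_fibreIdeal hghom hprime hnot
      (hQ'E (hDQ' ⟨l, rfl⟩)) (totalDegree_pderiv_le l hF)
  obtain ⟨G, b, hb0, hb, hG, hFG⟩ := exists_mem_sup_span_of_pderiv_mem
    (fun f hf k ↦ homogeneousComponent_mem_span
      (by rintro _ ⟨j, rfl⟩; exact (hghom j).imp fun _ h ↦ h.2) hf k) hIc he2
    (homogeneousComponent_isHomogeneous _ _) hpd
  refine (exists_collapseLE_of_mem_sup (fun j ↦ ⟨e₀ (σ j), (hg₀ _).1, he₀ _, (hg₀ _).2⟩)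
    ⟨hb0, hb, hG⟩ hFG).mono ?_
  refine Nat.add_le_add_right (hcard.trans ?_) 1
  exact Finset.le_sup (f := fun c ↦ B (c • M)) (Finset.mem_range.2 (by omega))

end Strength

section Conclusion

theorem isRegularLocal_of_isRegularLocalRing {A : Type*} [CommRing A] [IsRegularLocalRing A] :
    IsRegularLocal A := by
  have hfg : Submodule.FG (IsLocalRing.maximalIdeal A) := IsNoetherian.noetherian _
  refine ⟨inferInstance, hfg.finite_generators.toFinset, ?_, ?_⟩
  · rw [Set.Finite.coe_toFinset]
    exact Submodule.span_generators _
  · rw [← Set.ncard_eq_toFinset_card (hs := hfg.finite_generators), hfg.generators_ncard]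
    exact IsRegularLocalRing.spanFinrank_maximalIdeal

theorem PolarBound.anti.{w} {e h h' k : ℕ} (H : PolarBound.{w} e h k) (hh : h' ≤ h) :
    PolarBound.{w} e h' k := by
  intro K _ _ N F Q _ hF hQ hD
  exact H K N F Q hF (hQ.trans (by exact_mod_cast hh)) hD

variable {K : Type*} [Field K]

theorem card_le_sum_finrank {M ι κ : Type*} [AddCommGroup M] [Module K M] [Fintype ι] [Fintype κ]
    {V : ι → Submodule K M} (hV : ∀ i, FiniteDimensional K (V i)) {G : κ → M} {a : κ → ι}
    (hG : ∀ j, G j ∈ V (a j)) (hli : LinearIndependent K G) :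
    Fintype.card κ ≤ ∑ i, Module.finrank K (V i) := by
  classical
  rw [← Finset.card_univ, Finset.card_eq_sum_card_fiberwise (f := a) (t := Finset.univ)
    (fun _ _ ↦ Finset.mem_coe.2 (Finset.mem_univ _))]
  refine Finset.sum_le_sum fun i _ ↦ ?_
  let G' : {j // a j = i} → V i := fun j ↦ ⟨G j, by simpa only [j.2] using hG j⟩
  have hli' : LinearIndependent K G' :=
    LinearIndependent.of_comp (V i).subtype (hli.comp _ Subtype.val_injective)
  have := hV i
  rw [← Fintype.card_subtype]
  exact hli'.fintype_card_le_finrank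

theorem isStrong_of_not_hasCollapse {σ ι κ : Type*} [Fintype κ]
    {V : ι → Submodule K (MvPolynomial σ K)} {e : ι → ℕ} (he : Function.Injective e)
    (hV : ∀ i, V i ≤ homogeneousSubmodule σ K (e i)) {A : ℕ → ℕ → ℕ}
    (hA : ∀ i, ∀ F ∈ V i, F ≠ 0 → ¬ HasCollapse (e i) (A (e i) (Fintype.card κ)) F)
    {G : κ → MvPolynomial σ K} {a : κ → ι} (hG : ∀ j, G j ∈ V (a j))
    (hli : LinearIndependent K G) : IsStrong A G := by
  intro c hc
  have hhom : ∀ j, (G j).IsHomogeneous (e (a j)) := fun j ↦ hV _ (hG j)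
  have key : ∀ m, homogeneousComponent m (∑ j, c j • G j) = 0 := by
    intro m
    by_cases hm : ∃ i, e i = m
    · obtain ⟨i, rfl⟩ := hm
      by_contra hne
      have hmem : homogeneousComponent (e i) (∑ j, c j • G j) ∈ V i := by
        rw [homogeneousComponent_sum_smul hhom]
        refine Submodule.sum_mem _ fun j _ ↦ ?_
        split_ifs with h
        · exact Submodule.smul_mem _ _ (he h ▸ hG j)
        · exact Submodule.zero_mem _
      rcases Nat.lt_or_ge 1 (e i) with h1 | h1
      · exact hA i _ hmem hne ((hc _).hasCollapse h1)
      · exact hne ((hc _).eq_zero h1)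
    · rw [homogeneousComponent_sum_smul hhom]
      exact Finset.sum_eq_zero fun j _ ↦ if_neg fun h ↦ hm ⟨_, h⟩
  have hsum : ∑ j, c j • G j = 0 := by
    rw [← sum_homogeneousComponent (∑ j, c j • G j)]
    exact Finset.sum_eq_zero fun m _ ↦ key m
  exact funext fun j ↦ Fintype.linearIndependent_iff.1 hli c hsum j

variable {N s : ℕ} {G : Fin s → MvPolynomial (Fin N) K}

theorem isRnSequence_of_jacobianFullRank {η : ℕ}
    (hG : ∀ j, ∃ e, 0 < e ∧ (G j).IsHomogeneous e)
    (hJ : ∀ (P : Ideal (MvPolynomial (Fin N) K)) [P.IsPrime],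
      P.height ≤ (η + s : ℕ) → JacobianFullRank G P) : IsRnSequence η G := by
  refine ⟨span_ne_top_of_isHomogeneous (by rintro _ ⟨j, rfl⟩; exact hG j), fun i hi ↦ ?_⟩
  rw [span_image_lt_eq G i hi]
  set g : Fin i → MvPolynomial (Fin N) K := fun j ↦ G (Fin.castLE hi j)
  intro P hP hPη
  have hsub : Set.range g ⊆ P.comap (Ideal.Quotient.mk (Ideal.span (Set.range g))) := by
    intro f hf
    rw [SetLike.mem_coe, Ideal.mem_comap, Ideal.Quotient.eq_zero_iff_mem.2 (Ideal.subset_span hf)]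
    exact P.zero_mem
  have hle := Ideal.height_le_height_add_encard_of_subset _ hsub
  rw [Ideal.map_comap_of_surjective _ Ideal.Quotient.mk_surjective] at hle
  have hPη' : P.height ≤ (η : ℕ∞) := by
    rw [← PrimeSpectrum.height_eq_orderHeight] at hPη
    exact hPη
  have hcard : (Set.range g).encard ≤ (s : ℕ∞) := by
    rw [← Set.image_univ]
    refine (Set.encard_image_le _ _).trans ?_
    rw [Set.encard_univ, ENat.card_eq_coe_fintype_card, Fintype.card_fin]
    exact_mod_cast hi
  have hfull := hJ _ (hle.trans ((add_le_add hPη' hcard).trans (by push_cast; exact le_rfl)))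
  have := ((hfull.castLE hi).isRegularLocalRing P).1
  exact isRegularLocal_of_isRegularLocalRing

theorem isRegular_of_jacobianFullRank (hG : ∀ j, ∃ e, 0 < e ∧ (G j).IsHomogeneous e)
    (hJ : ∀ (P : Ideal (MvPolynomial (Fin N) K)) [P.IsPrime],
      P.height ≤ (s + 1 : ℕ) → JacobianFullRank G P) :
    RingTheory.Sequence.IsRegular (MvPolynomial (Fin N) K) (List.ofFn G) := by
  refine ⟨(isPrime_and_isWeaklyRegular_of_jacobianFullRank hG hJ).2.2, ?_⟩
  rw [ofList_ofFn, smul_eq_mul, Ideal.mul_top]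
  exact (span_ne_top_of_isHomogeneous (by rintro _ ⟨j, rfl⟩; exact hG j)).symm

end Conclusion

end AnanyanHochster

open AnanyanHochster

/-- For every positive `η` and `d ≥ 1` there are functions
`A 0, …, A (d-1) : ℕ^d → ℕ` (here `A i` governs the forms of degree `i + 1`), independent of
`N` and `K`, such that for every algebraically closed field `K`, every `N`, and every graded
subspace `V = V_1 ⊕ ⋯ ⊕ V_d` of `K[x_1, …, x_N]` with dimension sequence `δ`, if every nonzero
element of `V_i` has strength at least `A i δ`, then every sequence of `K`-linearly independent
forms in `V` is an `R_η`-sequence (in particular, a regular sequence). -/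
theorem statement1 (η d : ℕ) (hη : 0 < η) (hd : 1 ≤ d) :
    ∃ A : Fin d → (Fin d → ℕ) → ℕ,
      ∀ (K : Type u) [Field K] [IsAlgClosed K] (N : ℕ)
        (V : Fin d → Submodule K (MvPolynomial (Fin N) K)),
        (∀ i, V i ≤ homogeneousSubmodule (Fin N) K ((i : ℕ) + 1)) →
        (∀ i, FiniteDimensional K (V i)) →
        (∀ i : Fin d, ∀ F ∈ V i, F ≠ 0 →
          ¬ HasCollapse ((i : ℕ) + 1) (A i fun j => Module.finrank K (V j)) F) →
        ∀ (s : ℕ) (G : Fin s → MvPolynomial (Fin N) K),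
          (∀ j, ∃ i, G j ∈ V i) → LinearIndependent K G →
          IsRnSequence η G ∧
            RingTheory.Sequence.IsRegular (MvPolynomial (Fin N) K) (List.ofFn G) := by
  choose! κ hκ using exists_polarBound.{u}
  refine ⟨fun i δ ↦ κ (i + 1) (2 * ∑ j, δ j + η), ?_⟩
  intro K _ _ N V hV hfin hstr s G hG hli
  choose a ha using hG
  have hs : s ≤ ∑ i, Module.finrank K (V i) := by
    simpa using card_le_sum_finrank hfin ha hli
  have hstrong : IsStrong (fun m _ ↦ κ m (2 * ∑ i, Module.finrank K (V i) + η)) G :=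
    isStrong_of_not_hasCollapse (e := fun i : Fin d ↦ (i : ℕ) + 1)
      (fun i j h ↦ Fin.ext (Nat.succ.inj h)) hV hstr ha hli
  have hJ : ∀ (P : Ideal (MvPolynomial (Fin N) K)) [P.IsPrime],
      P.height ≤ (η + s : ℕ) → JacobianFullRank G P := fun P _ hP ↦
    hstrong.jacobianFullRank (fun j ↦ hV _ (ha j))
      (fun j ↦ (hκ _ (Nat.succ_pos _) _).anti (by omega)) P hP
  have hhom : ∀ j, ∃ e, 0 < e ∧ (G j).IsHomogeneous e := fun j ↦
    ⟨_, Nat.succ_pos _, hV _ (ha j)⟩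
  refine ⟨isRnSequence_of_jacobianFullRank hhom hJ, isRegular_of_jacobianFullRank hhom ?_⟩
  exact fun P _ hP ↦ hJ P (hP.trans (by exact_mod_cast (by omega)))
end
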